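/- Assume hypothesis (****) and that both K and L have supporting spheres at all of their boundary points (for S^d of radii less than π/2). Then the following are equivalent. (1) For each φ, ψ, the set conv((φK) ∪ (ψL)) is centrally symmetric. (2) For each φ, ψ such that conv((φK) ∪ (ψL)) has a unique diametral segment D, the set conv((φK) ∪ (ψL)) is symmetric with respect to the orthogonal bisector hyperplane of D. (3) Whenever φ, ψ and x ∈ bd K, y ∈ bd L satisfy: (A) for S^d, diam(conv((φK) ∪ (ψL))) is sufficiently close to π, and for ℝ^d and H^d this diameter is sufficiently large; and (B) conv((φK) ∪ (ψL)) has D := [φx, ψy] as its unique diametral segment — then conv((φK) ∪ (ψL)) is centrally symmetric. (4) The same as (3) with 'centrally symmetric' replaced by 'symmetric with respect to the orthogonal bisector hyperplane of D'. (5) Whenever φ, ψ, x, y satisfy (A) and (B) of (3), there exists ε(K,L,x,y,φ,ψ) > 0 (for S^d with D(ε) ⊂ S) such that for all 0 < ε < ε(K,L,x,y,φ,ψ), the set conv((φK) ∪ (ψL)) ∩ D(ε) is centrally symmetric, where D := [φx, ψy]. (6) The same as (5) with 'centrally symmetric' replaced by 'symmetric with respect to the orthogonal bisector hyperplane of D'.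 (7) K and L are congruent balls (for S^d of radius less than π/2). -/

import Mathlib

open Metric Set Filter

namespace BallChar

/-- `X` is (isometric to) the `d`-dimensional round sphere of radius 1,
with the intrinsic (great-circle) metric. -/
def IsSphereSpace (X : Type*) [MetricSpace X] (d : ℕ) : Prop :=
  ∃ e : X → EuclideanSpace ℝ (Fin (d + 1)),
    Function.Injective e ∧
    Set.range e = Metric.sphere (0 : EuclideanSpace ℝ (Fin (d + 1))) 1 ∧
    ∀ x y : X, dist x y = Real.arccos (@inner ℝ _ _ (e x) (e y))

/-- `X` is (isometric to) the `d`-dimensional Euclidean space. -/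
def IsEuclideanSpaceForm (X : Type*) [MetricSpace X] (d : ℕ) : Prop :=
  Nonempty (X ≃ᵢ EuclideanSpace ℝ (Fin d))

/-- The Minkowski bilinear form on `ℝ^d × ℝ`. -/
noncomputable def mink (d : ℕ) (u v : EuclideanSpace ℝ (Fin d) × ℝ) : ℝ :=
  @inner ℝ _ _ u.1 v.1 - u.2 * v.2

/-- `X` is (isometric to) the `d`-dimensional hyperbolic space of curvature `-1`
(the hyperboloid model). -/
def IsHyperbolicSpace (X : Type*) [MetricSpace X] (d : ℕ) : Prop :=
  ∃ e : X → EuclideanSpace ℝ (Fin d) × ℝ,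
    Function.Injective e ∧
    Set.range e = {u | mink d u u = -1 ∧ 0 < u.2} ∧
    ∀ x y : X, Real.cosh (dist x y) = - mink d (e x) (e y)

/-- `X` is `S^d`, `ℝ^d` or `H^d`. -/
def IsSpaceForm (X : Type*) [MetricSpace X] (d : ℕ) : Prop :=
  IsSphereSpace X d ∨ IsEuclideanSpaceForm X d ∨ IsHyperbolicSpace X d

variable {X : Type*} [MetricSpace X]

/-- Metric betweenness: `z` lies on a shortest geodesic from `x` to `y`. -/
def Btw (x z y : X) : Prop := dist x z + dist z y = dist x y

/-- `z` is the unique point between `x` and `y` at its distance from `x`. -/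
def UniqueBtwPt (x z y : X) : Prop :=
  Btw x z y ∧ ∀ w, Btw x w y → dist x w = dist x z → w = z

/-- Geodesic convexity (for two antipodal points of a sphere no condition is imposed). -/
def GConvex (K : Set X) : Prop :=
  ∀ x ∈ K, ∀ y ∈ K, ∀ z, UniqueBtwPt x z y → z ∈ K

/-- `p` is a (metric) midpoint of `x` and `y`. -/
def IsMidpoint (p x y : X) : Prop := Btw x p y ∧ dist x p = dist p y

/-- A reflection in a hyperplane: a non-trivial involutive isometry whose
non-fixed locus is disconnected (by the mirror hyperplane). -/
def IsReflection (σ : X ≃ᵢ X) : Prop :=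
  σ.trans σ = IsometryEquiv.refl X ∧ σ ≠ IsometryEquiv.refl X ∧
    ¬ IsPreconnected {x : X | σ x ≠ x}

/-- An orientation preserving congruence: a product of an even number of reflections. -/
def OrientationPreserving (f : X ≃ᵢ X) : Prop :=
  ∃ l : List (X ≃ᵢ X), (∀ σ ∈ l, IsReflection σ) ∧ Even l.length ∧
    f = l.foldr IsometryEquiv.trans (IsometryEquiv.refl X)

/-- Two subsets are congruent if some isometry of the space maps one onto the other. -/
def Congruent (A B : Set X) : Prop := ∃ f : X ≃ᵢ X, ⇑f '' A = B

/-- `S` admits some non-trivial congruence. -/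
def AdmitsNontrivialCongruence (S : Set X) : Prop :=
  ∃ f : X ≃ᵢ X, f ≠ IsometryEquiv.refl X ∧ ⇑f '' S = S

/-- `S` is axially symmetric (symmetric with respect to some reflection). -/
def AxiallySymmetric (S : Set X) : Prop :=
  ∃ σ : X ≃ᵢ X, IsReflection σ ∧ ⇑σ '' S = S

/-- `S` is centrally symmetric: some involutive isometry fixing a point `p`
maps `S` onto itself, `p` being a midpoint of every pair `x`, `σ x` of `S`. -/
def CentrallySymmetric (S : Set X) : Prop :=
  ∃ (σ : X ≃ᵢ X) (p : X), Function.Involutive ⇑σ ∧ σ p = p ∧ ⇑σ '' S = S ∧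
    ∀ x ∈ S, IsMidpoint p x (σ x)

/-- `S` is symmetric with respect to the orthogonal bisector hyperplane of
the segment `[a, b]`, i.e. invariant under the reflection interchanging `a` and `b`. -/
def SymmetricWrtPerpBisector (S : Set X) (a b : X) : Prop :=
  ∃ σ : X ≃ᵢ X, IsReflection σ ∧ σ a = b ∧ ⇑σ '' S = S

/-- A closed half-space: one of the two closed sides of the mirror of a reflection. -/
def IsHalfspace (P : Set X) : Prop :=
  ∃ σ : X ≃ᵢ X, IsReflection σ ∧ IsClosed P ∧
    P ∪ ⇑σ '' P = univ ∧ P ∩ ⇑σ '' P = {x | σ x = x}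

/-- A hyperplane: the mirror (fixed point set) of a reflection. -/
def IsHyperplane (B : Set X) : Prop :=
  ∃ σ : X ≃ᵢ X, IsReflection σ ∧ B = {x | σ x = x}

/-- A paraball (horoball): a sublevel set of a Busemann function. -/
def IsParaball (K : Set X) : Prop :=
  ∃ γ : ℝ → X, Isometry γ ∧
    K = {x | ∃ b ≤ 0, Tendsto (fun t => dist x (γ t) - t) atTop (nhds b)}

/-- A parasphere (horosphere): the boundary of a paraball. -/
def IsParasphere (C : Set X) : Prop := ∃ K : Set X, IsParaball K ∧ C = frontier K

/-- A hypersphere at distance `lam > 0` from its base hyperplane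
(degeneration to a hyperplane excluded). -/
def IsHypersphere (C : Set X) (lam : ℝ) : Prop :=
  0 < lam ∧ (∃ P : Set X, IsHalfspace P ∧ C = frontier {x | infDist x P ≤ lam}) ∧
    ¬ IsHyperplane C

/-- The family of connected components of the boundary of `K`. -/
def bdryComponents (K : Set X) : Set (Set X) :=
  (connectedComponentIn (frontier K)) '' (frontier K)

/-- `closedBall p r` is an inball of `M` (a ball of maximal radius contained in `M`). -/
def IsInball (M : Set X) (p : X) (r : ℝ) : Prop :=
  0 ≤ r ∧ closedBall p r ⊆ M ∧ ∀ (q : X) (s : ℝ), closedBall q s ⊆ M → s ≤ r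

/-- `closedBall p r` is the unique inball of `M`. -/
def HasUniqueInball (M : Set X) (p : X) (r : ℝ) : Prop :=
  IsInball M p r ∧ ∀ (q : X) (s : ℝ), IsInball M q s → q = p

/-- The (geodesic) convex hull of a set. -/
def gconvexHull (Y : Set X) : Set X := ⋂₀ {C : Set X | GConvex C ∧ Y ⊆ C}

/-- `z` lies on the complete geodesic line through `a` and `b`. -/
def OnLine (a b z : X) : Prop := Btw a z b ∨ Btw z a b ∨ Btw a b z

/-- The closed `(d-1)`-ball of radius `ε` centred at `a` in the hyperplane through `a`
orthogonal to the segment `[a, b]`. -/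
def perpDisc (a b : X) (ε : ℝ) : Set X :=
  {x | (∀ z, OnLine a b z → dist x a ≤ dist x z) ∧ dist x a ≤ ε}

/-- The set `D(ε)` associated to the segment `D = [a, b]`: the convex hull of the two
`(d-1)`-balls of radius `ε` orthogonal to `D` at its endpoints. -/
def segCyl (a b : X) (ε : ℝ) : Set X :=
  gconvexHull (perpDisc a b ε ∪ perpDisc b a ε)

/-- `[a, b]` is the unique diametral segment of `M`. -/
def UniqueDiametral (M : Set X) (a b : X) : Prop :=
  a ∈ M ∧ b ∈ M ∧ a ≠ b ∧ dist a b = diam M ∧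
    ∀ a' ∈ M, ∀ b' ∈ M, dist a' b' = diam M → (a' = a ∧ b' = b) ∨ (a' = b ∧ b' = a)

/-- Condition (**): at every boundary point, `K` contains a ball having this point
on its boundary. -/
def CondBallInside (K : Set X) : Prop :=
  ∀ x ∈ frontier K, ∃ ε > 0, ∃ p : X, closedBall p ε ⊆ K ∧ x ∈ sphere p ε

/-- `K` has an extreme point. -/
def HasExtremePoint (K : Set X) : Prop :=
  ∃ x ∈ K, ∀ y ∈ K, ∀ z ∈ K, Btw y x z → x = y ∨ x = z

/-- Condition (***): near every boundary point, `K` is contained in a ball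
(resp. in a convex set bounded by a hypersphere, for hyperbolic space) whose boundary
has sectional curvatures bounded below and passes through the given point. -/
def CondCurvBound (d : ℕ) (K : Set X) : Prop :=
  ∀ x ∈ frontier K, ∃ ε > 0, ∃ B : Set X,
    {y | y ∈ K ∧ dist y x ≤ ε} ⊆ B ∧ x ∈ frontier B ∧
    (IsSphereSpace X d → ∃ (q : X) (R : ℝ), 0 < R ∧ R < Real.pi / 2 ∧
        ε ≤ Real.cos R / Real.sin R ∧ B = closedBall q R) ∧
    (IsEuclideanSpaceForm X d → ∃ (q : X) (R : ℝ), 0 < R ∧ ε ≤ 1 / R ∧ B = closedBall q R) ∧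
    (IsHyperbolicSpace X d → ∃ (P : Set X) (lam : ℝ), IsHalfspace P ∧ 0 < lam ∧
        ε ≤ Real.tanh lam ∧ B = {y | infDist y P ≤ lam})

/-- `K` has a supporting sphere at each of its boundary points
(for the sphere, of radius less than `π/2`). -/
def SupportingSpheres (d : ℕ) (K : Set X) : Prop :=
  ∀ x ∈ frontier K, ∃ (p : X) (R : ℝ), 0 < R ∧ K ⊆ closedBall p R ∧ x ∈ sphere p R ∧
    (IsSphereSpace X d → R < Real.pi / 2)

/-- `K` is `C¹` (smooth): at each boundary point there is a unique supporting half-space. -/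
def SmoothBody (K : Set X) : Prop :=
  ∀ x ∈ frontier K, ∃! P : Set X, IsHalfspace P ∧ K ⊆ P ∧ x ∈ frontier P

/-- A complete geodesic (straight line). -/
def IsGeodesicLine (B : Set X) : Prop := ∃ γ : ℝ → X, Isometry γ ∧ B = Set.range γ

/-- A circle (closed disc) of positive radius. -/
def IsDisc (K : Set X) : Prop := ∃ (p : X) (r : ℝ), 0 < r ∧ K = closedBall p r

/-- The parallel domain of `B` at distance `l`. -/
def parallelDomain (B : Set X) (l : ℝ) : Set X := {x | infDist x B ≤ l}

/-- `K` is the parallel domain of some straight line, at some distance `l > 0`. -/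
def IsParallelDomain (K : Set X) : Prop :=
  ∃ (B : Set X) (l : ℝ), IsGeodesicLine B ∧ 0 < l ∧ K = parallelDomain B l

/-- A convex domain bounded by a (proper) hypercycle. -/
def IsHypercycleDomain (K : Set X) : Prop :=
  ∃ (P : Set X) (l : ℝ), IsHalfspace P ∧ 0 < l ∧ K = {x | infDist x P ≤ l}

/-- `C` is a hypercycle or a straight line (a curve at constant distance `l ≥ 0`
from its base line). -/
def IsHypercycleOrLine (C : Set X) : Prop :=
  ∃ (P : Set X) (l : ℝ), IsHalfspace P ∧ 0 ≤ l ∧ C = frontier {x | infDist x P ≤ l}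

/-- `C` is a hypercycle (or straight line) with base line `B`. -/
def HypercycleWithBase (C B : Set X) : Prop :=
  ∃ (P : Set X) (l : ℝ), IsHalfspace P ∧ 0 ≤ l ∧ frontier P = B ∧
    C = frontier {x | infDist x P ≤ l}


/-! Cases (A)-(E) of Theorem 5 (hyperbolic plane). -/

/-- One of the basic bodies of case (A). -/
def CaseABody (K : Set X) : Prop :=
  IsDisc K ∨ IsParaball K ∨ IsHypercycleDomain K ∨ IsHalfspace K

/-- Case (A) of Theorem 5. -/
def CaseA (K L : Set X) : Prop :=
  CaseABody K ∧ CaseABody L ∧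
    ((IsHypercycleDomain K ∨ IsHalfspace K) → IsDisc L ∨ Congruent K L) ∧
    ((IsHypercycleDomain L ∨ IsHalfspace L) → IsDisc K ∨ Congruent L K)

/-- `M` is bounded either by two hypercycles whose base lines coincide, or by a
hypercycle and its base line. -/
def TwoHypSameBase (M : Set X) : Prop :=
  ∃ (B C₁ C₂ : Set X), IsGeodesicLine B ∧ C₁ ≠ C₂ ∧
    HypercycleWithBase C₁ B ∧ HypercycleWithBase C₂ B ∧ frontier M = C₁ ∪ C₂

/-- Case (B) of Theorem 5. -/
def CaseB (K L : Set X) : Prop :=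
  (IsDisc K ∧ TwoHypSameBase L) ∨ (IsDisc L ∧ TwoHypSameBase K)

/-- `M` is bounded by at least two hypercycles or straight lines, with all base lines
different, whose mutual distances are at least `2r`. -/
def MultiHypFarApart (M : Set X) (r : ℝ) : Prop :=
  (∀ x ∈ frontier M, IsHypercycleOrLine (connectedComponentIn (frontier M) x)) ∧
  (∃ x ∈ frontier M, ∃ y ∈ frontier M,
      connectedComponentIn (frontier M) x ≠ connectedComponentIn (frontier M) y) ∧
  (∀ x ∈ frontier M, ∀ y ∈ frontier M,
      connectedComponentIn (frontier M) x ≠ connectedComponentIn (frontier M) y →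
        2 * r ≤ dist x y ∧
        ∀ B₁ B₂ : Set X, HypercycleWithBase (connectedComponentIn (frontier M) x) B₁ →
          HypercycleWithBase (connectedComponentIn (frontier M) y) B₂ → B₁ ≠ B₂)

/-- Case (C) of Theorem 5. -/
def CaseC (K L : Set X) : Prop :=
  (∃ (p : X) (r : ℝ), 0 < r ∧ K = closedBall p r ∧ MultiHypFarApart L r) ∨
  (∃ (p : X) (r : ℝ), 0 < r ∧ L = closedBall p r ∧ MultiHypFarApart K r)

/-- Case (D) of Theorem 5. -/
def CaseD (K L : Set X) : Prop :=
  (IsParaball K ∧ IsParallelDomain L) ∨ (IsParaball L ∧ IsParallelDomain K)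

/-- Case (E) of Theorem 5. -/
def CaseE (K L : Set X) : Prop :=
  Congruent K L ∧ IsParallelDomain K ∧ IsParallelDomain L

/-- All cases of (3) of Theorem 5 together. -/
def Theorem5Cases (K L : Set X) : Prop :=
  CaseA K L ∨ CaseB K L ∨ CaseC K L ∨ CaseD K L ∨ CaseE K L

/-- Condition (1) of Theorem 5: every intersection of congruent copies admits some
non-trivial congruence. -/
def T5Cond1 (K L : Set X) : Prop :=
  ∀ φ ψ : X ≃ᵢ X, OrientationPreserving φ → OrientationPreserving ψ →
    (interior ((⇑φ '' K) ∩ (⇑ψ '' L))).Nonempty →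
    AdmitsNontrivialCongruence ((⇑φ '' K) ∩ (⇑ψ '' L))

/-- Condition (2) of Theorem 5: every intersection of congruent copies is axially
symmetric. -/
def T5Cond2 (K L : Set X) : Prop :=
  ∀ φ ψ : X ≃ᵢ X, OrientationPreserving φ → OrientationPreserving ψ →
    (interior ((⇑φ '' K) ∩ (⇑ψ '' L))).Nonempty →
    AxiallySymmetric ((⇑φ '' K) ∩ (⇑ψ '' L))

/-- All connected components of the boundary of `K` are hypercycles or straight lines. -/
def BdryHypOrLine (K : Set X) : Prop :=
  ∀ x ∈ frontier K, IsHypercycleOrLine (connectedComponentIn (frontier K) x)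

/-- The boundary of `K` has at least two connected components. -/
def AtLeastTwoComponents (K : Set X) : Prop :=
  ∃ x ∈ frontier K, ∃ y ∈ frontier K,
    connectedComponentIn (frontier K) x ≠ connectedComponentIn (frontier K) y

/-- The boundary of `K` is nonempty and has a single connected component. -/
def SingleComponent (K : Set X) : Prop :=
  (frontier K).Nonempty ∧ ∀ x ∈ frontier K, ∀ y ∈ frontier K,
    connectedComponentIn (frontier K) x = connectedComponentIn (frontier K) y

/-- The associated graph of `K` contains two edges with at least one common endpoint:
`K` has two distinct boundary components which are asymptotic (come arbitrarily close). -/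
def TwoAsymptoticComponents (K : Set X) : Prop :=
  ∃ x ∈ frontier K, ∃ y ∈ frontier K,
    connectedComponentIn (frontier K) x ≠ connectedComponentIn (frontier K) y ∧
    ∀ δ > (0 : ℝ), ∃ p ∈ connectedComponentIn (frontier K) x,
      ∃ q ∈ connectedComponentIn (frontier K) y, dist p q < δ

/-- The associated graph of `K` has only pairwise vertex-disjoint edges: distinct
boundary components of `K` stay at positive distance from each other. -/
def VertexDisjointEdges (K : Set X) : Prop :=
  ∀ x ∈ frontier K, ∀ y ∈ frontier K,
    connectedComponentIn (frontier K) x ≠ connectedComponentIn (frontier K) y →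
      ∃ δ > (0 : ℝ), ∀ p ∈ connectedComponentIn (frontier K) x,
        ∀ q ∈ connectedComponentIn (frontier K) y, δ ≤ dist p q

/-! Conditions of Theorem 6. -/

/-- Condition (1) of Theorem 6. -/
def T6Cond1 (K L : Set X) : Prop :=
  ∃ ε > (0 : ℝ), ∀ φ ψ : X ≃ᵢ X, OrientationPreserving φ → OrientationPreserving ψ →
    (interior ((⇑φ '' K) ∩ (⇑ψ '' L))).Nonempty →
    diam ((⇑φ '' K) ∩ (⇑ψ '' L)) < ε →
    CentrallySymmetric ((⇑φ '' K) ∩ (⇑ψ '' L))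

/-- Condition (2) of Theorem 6. -/
def T6Cond2 (K L : Set X) : Prop :=
  ∀ x ∈ frontier K, ∀ y ∈ frontier L, ∃ ε > (0 : ℝ),
    ∀ φ ψ : X ≃ᵢ X, OrientationPreserving φ → OrientationPreserving ψ →
      (interior ((⇑φ '' K) ∩ (⇑ψ '' L))).Nonempty →
      diam ((⇑φ '' K) ∩ (⇑ψ '' L)) < ε →
      ∀ (p : X) (r : ℝ), HasUniqueInball ((⇑φ '' K) ∩ (⇑ψ '' L)) p r →
        frontier ((⇑φ '' K) ∩ (⇑ψ '' L)) ∩ sphere p r = {φ x, ψ y} →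
        φ x ∈ interior (⇑ψ '' L) → ψ y ∈ interior (⇑φ '' K) →
        IsMidpoint p (φ x) (ψ y) →
        CentrallySymmetric ((⇑φ '' K) ∩ (⇑ψ '' L))

/-- Condition (3) of Theorem 6. -/
def T6Cond3 (K L : Set X) : Prop :=
  ∀ x ∈ frontier K, ∀ y ∈ frontier L, ∃ ε > (0 : ℝ),
    ∀ φ ψ : X ≃ᵢ X, OrientationPreserving φ → OrientationPreserving ψ →
      (interior ((⇑φ '' K) ∩ (⇑ψ '' L))).Nonempty →
      diam ((⇑φ '' K) ∩ (⇑ψ '' L)) < ε →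
      ∀ (p : X) (r : ℝ), HasUniqueInball ((⇑φ '' K) ∩ (⇑ψ '' L)) p r →
        frontier ((⇑φ '' K) ∩ (⇑ψ '' L)) ∩ sphere p r = {φ x, ψ y} →
        φ x ∈ interior (⇑ψ '' L) → ψ y ∈ interior (⇑φ '' K) →
        IsMidpoint p (φ x) (ψ y) →
        SymmetricWrtPerpBisector ((⇑φ '' K) ∩ (⇑ψ '' L)) (φ x) (ψ y)

/-- Condition (4) of Theorem 6. -/
def T6Cond4 (d : ℕ) (K L : Set X) : Prop :=
  (∃ r > (0 : ℝ), (IsSphereSpace X d → r ≤ Real.pi / 2) ∧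
      (∀ C ∈ bdryComponents K ∪ bdryComponents L, ∃ p : X, C = sphere p r) ∧
      (∃ p : X, K = closedBall p r) ∧ ∃ q : X, L = closedBall q r) ∨
  ((∀ C ∈ bdryComponents K ∪ bdryComponents L, IsParasphere C) ∧
      IsParaball K ∧ IsParaball L) ∨
  (∃ lam > (0 : ℝ), ∀ C ∈ bdryComponents K ∪ bdryComponents L, IsHypersphere C lam)

/-! Conditions of Theorems 7 and 8. -/

/-- The pair `φ, ψ` is admissible for hypothesis (****): both are orientation
preserving, and for the sphere `(φ K) ∪ (ψ L)` lies in an open hemisphere. -/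
def GoodPair (d : ℕ) (K L : Set X) (φ ψ : X ≃ᵢ X) : Prop :=
  OrientationPreserving φ ∧ OrientationPreserving ψ ∧
    (IsSphereSpace X d → ∃ s : X, (⇑φ '' K) ∪ (⇑ψ '' L) ⊆ ball s (Real.pi / 2))

/-- The convex hull of the union of the two congruent copies. -/
def hullUnion (K L : Set X) (φ ψ : X ≃ᵢ X) : Set X := gconvexHull ((⇑φ '' K) ∪ (⇑ψ '' L))

/-- Condition (A) of (3) of Theorem 7: the diameter of `M` is sufficiently close to `π`
(sphere), resp. sufficiently large (Euclidean, hyperbolic), as measured by `δ`. -/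
def BigDiam (d : ℕ) (X : Type*) [MetricSpace X] (M : Set X) (δ : ℝ) : Prop :=
  (IsSphereSpace X d → Real.pi - δ < diam M) ∧ (¬ IsSphereSpace X d → 1 / δ < diam M)

/-- Condition (1) of Theorem 7. -/
def T7Cond1 (d : ℕ) (K L : Set X) : Prop :=
  ∀ φ ψ : X ≃ᵢ X, GoodPair d K L φ ψ → CentrallySymmetric (hullUnion K L φ ψ)

/-- Condition (2) of Theorem 7. -/
def T7Cond2 (d : ℕ) (K L : Set X) : Prop :=
  ∀ φ ψ : X ≃ᵢ X, GoodPair d K L φ ψ → ∀ a b : X, UniqueDiametral (hullUnion K L φ ψ) a b →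
    SymmetricWrtPerpBisector (hullUnion K L φ ψ) a b

/-- Condition (3) of Theorem 7. -/
def T7Cond3 (d : ℕ) (K L : Set X) : Prop :=
  ∃ δ > (0 : ℝ), ∀ φ ψ : X ≃ᵢ X, GoodPair d K L φ ψ →
    ∀ x ∈ frontier K, ∀ y ∈ frontier L,
      BigDiam d X (hullUnion K L φ ψ) δ →
      UniqueDiametral (hullUnion K L φ ψ) (φ x) (ψ y) →
      CentrallySymmetric (hullUnion K L φ ψ)

/-- Condition (4) of Theorem 7. -/
def T7Cond4 (d : ℕ) (K L : Set X) : Prop :=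
  ∃ δ > (0 : ℝ), ∀ φ ψ : X ≃ᵢ X, GoodPair d K L φ ψ →
    ∀ x ∈ frontier K, ∀ y ∈ frontier L,
      BigDiam d X (hullUnion K L φ ψ) δ →
      UniqueDiametral (hullUnion K L φ ψ) (φ x) (ψ y) →
      SymmetricWrtPerpBisector (hullUnion K L φ ψ) (φ x) (ψ y)

/-- Condition (5) of Theorem 7. -/
def T7Cond5 (d : ℕ) (K L : Set X) : Prop :=
  ∃ δ > (0 : ℝ), ∀ φ ψ : X ≃ᵢ X, GoodPair d K L φ ψ →
    ∀ x ∈ frontier K, ∀ y ∈ frontier L,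
      BigDiam d X (hullUnion K L φ ψ) δ →
      UniqueDiametral (hullUnion K L φ ψ) (φ x) (ψ y) →
      ∃ ε₀ > (0 : ℝ), ∀ ε : ℝ, 0 < ε → ε < ε₀ →
        (IsSphereSpace X d → ∃ s : X, (⇑φ '' K) ∪ (⇑ψ '' L) ⊆ ball s (Real.pi / 2) ∧
            segCyl (φ x) (ψ y) ε ⊆ ball s (Real.pi / 2)) ∧
        CentrallySymmetric (hullUnion K L φ ψ ∩ segCyl (φ x) (ψ y) ε)

/-- Condition (6) of Theorem 7. -/
def T7Cond6 (d : ℕ) (K L : Set X) : Prop :=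
  ∃ δ > (0 : ℝ), ∀ φ ψ : X ≃ᵢ X, GoodPair d K L φ ψ →
    ∀ x ∈ frontier K, ∀ y ∈ frontier L,
      BigDiam d X (hullUnion K L φ ψ) δ →
      UniqueDiametral (hullUnion K L φ ψ) (φ x) (ψ y) →
      ∃ ε₀ > (0 : ℝ), ∀ ε : ℝ, 0 < ε → ε < ε₀ →
        (IsSphereSpace X d → ∃ s : X, (⇑φ '' K) ∪ (⇑ψ '' L) ⊆ ball s (Real.pi / 2) ∧
            segCyl (φ x) (ψ y) ε ⊆ ball s (Real.pi / 2)) ∧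
        SymmetricWrtPerpBisector (hullUnion K L φ ψ ∩ segCyl (φ x) (ψ y) ε) (φ x) (ψ y)

/-- Condition (7) of Theorem 7: `K` and `L` are congruent balls. -/
def T7Cond7 (d : ℕ) (K L : Set X) : Prop :=
  ∃ r > (0 : ℝ), (IsSphereSpace X d → r < Real.pi / 2) ∧
    (∃ p : X, K = closedBall p r) ∧ ∃ q : X, L = closedBall q r

/-- Condition (1) of Theorem 8. -/
def T8Cond1 (K L : Set X) : Prop :=
  ∀ φ ψ : X ≃ᵢ X, GoodPair 2 K L φ ψ → AxiallySymmetric (hullUnion K L φ ψ)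

/-- Condition (2) of Theorem 8. -/
def T8Cond2 (K L : Set X) : Prop :=
  ∀ φ ψ : X ≃ᵢ X, GoodPair 2 K L φ ψ → AdmitsNontrivialCongruence (hullUnion K L φ ψ)

/-- Condition (3) of Theorem 8. -/
def T8Cond3 (K L : Set X) : Prop :=
  ∃ δ > (0 : ℝ), ∀ φ ψ : X ≃ᵢ X, GoodPair 2 K L φ ψ →
    ∀ x ∈ frontier K, ∀ y ∈ frontier L,
      BigDiam 2 X (hullUnion K L φ ψ) δ →
      UniqueDiametral (hullUnion K L φ ψ) (φ x) (ψ y) →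
      AxiallySymmetric (hullUnion K L φ ψ)

/-- Condition (4) of Theorem 8. -/
def T8Cond4 (K L : Set X) : Prop :=
  ∃ δ > (0 : ℝ), ∀ φ ψ : X ≃ᵢ X, GoodPair 2 K L φ ψ →
    ∀ x ∈ frontier K, ∀ y ∈ frontier L,
      BigDiam 2 X (hullUnion K L φ ψ) δ →
      UniqueDiametral (hullUnion K L φ ψ) (φ x) (ψ y) →
      AdmitsNontrivialCongruence (hullUnion K L φ ψ)

/-- Condition (5) of Theorem 8. -/
def T8Cond5 (K L : Set X) : Prop :=
  ∃ δ > (0 : ℝ), ∀ φ ψ : X ≃ᵢ X, GoodPair 2 K L φ ψ →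
    ∀ x ∈ frontier K, ∀ y ∈ frontier L,
      BigDiam 2 X (hullUnion K L φ ψ) δ →
      UniqueDiametral (hullUnion K L φ ψ) (φ x) (ψ y) →
      ∃ ε₀ > (0 : ℝ), ∀ ε : ℝ, 0 < ε → ε < ε₀ →
        (IsSphereSpace X 2 → ∃ s : X, (⇑φ '' K) ∪ (⇑ψ '' L) ⊆ ball s (Real.pi / 2) ∧
            segCyl (φ x) (ψ y) ε ⊆ ball s (Real.pi / 2)) ∧
        AxiallySymmetric (hullUnion K L φ ψ ∩ segCyl (φ x) (ψ y) ε)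

/-- Condition (6) of Theorem 8. -/
def T8Cond6 (K L : Set X) : Prop :=
  ∃ δ > (0 : ℝ), ∀ φ ψ : X ≃ᵢ X, GoodPair 2 K L φ ψ →
    ∀ x ∈ frontier K, ∀ y ∈ frontier L,
      BigDiam 2 X (hullUnion K L φ ψ) δ →
      UniqueDiametral (hullUnion K L φ ψ) (φ x) (ψ y) →
      ∃ ε₀ > (0 : ℝ), ∀ ε : ℝ, 0 < ε → ε < ε₀ →
        (IsSphereSpace X 2 → ∃ s : X, (⇑φ '' K) ∪ (⇑ψ '' L) ⊆ ball s (Real.pi / 2) ∧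
            segCyl (φ x) (ψ y) ε ⊆ ball s (Real.pi / 2)) ∧
        AdmitsNontrivialCongruence (hullUnion K L φ ψ ∩ segCyl (φ x) (ψ y) ε)

/-- Condition (7) of Theorem 8: `K` and `L` are (in general incongruent) circles. -/
def T8Cond7 (K L : Set X) : Prop :=
  ∃ (p q : X) (r s : ℝ), 0 < r ∧ 0 < s ∧
    (IsSphereSpace X 2 → r < Real.pi / 2 ∧ s < Real.pi / 2) ∧
    K = closedBall p r ∧ L = closedBall q s

/-- The generalized cosine of curvature `κ ∈ {1, 0, -1}`. -/
noncomputable def cs (κ s : ℝ) : ℝ :=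
  if κ = 1 then Real.cos s else if κ = 0 then 1 else Real.cosh s

/-- The generalized sine of curvature `κ ∈ {1, 0, -1}`. -/
noncomputable def sn (κ s : ℝ) : ℝ :=
  if κ = 1 then Real.sin s else if κ = 0 then s else Real.sinh s

/-- The generalized versine of curvature `κ ∈ {1, 0, -1}`. -/
noncomputable def vs (κ s : ℝ) : ℝ := 2 * sn κ (s / 2) ^ 2

/-- `κ` is one of the normalized curvatures. -/
def Curv (κ : ℝ) : Prop := κ = 1 ∨ κ = 0 ∨ κ = -1

lemma cs_one (s : ℝ) : cs 1 s = Real.cos s := by simp [cs]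
lemma cs_zero' (s : ℝ) : cs 0 s = 1 := by simp [cs]
lemma cs_neg_one (s : ℝ) : cs (-1) s = Real.cosh s := by
  have : ¬ ((-1 : ℝ) = 1) := by norm_num
  simp [cs, this]
lemma sn_one (s : ℝ) : sn 1 s = Real.sin s := by simp [sn]
lemma sn_zero' (s : ℝ) : sn 0 s = s := by simp [sn]
lemma sn_neg_one (s : ℝ) : sn (-1) s = Real.sinh s := by
  have : ¬ ((-1 : ℝ) = 1) := by norm_num
  simp [sn, this]

section
variable {κ : ℝ}

lemma Curv.sn_add (hκ : Curv κ) (a b : ℝ) :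
    sn κ (a + b) = sn κ a * cs κ b + cs κ a * sn κ b := by
  rcases hκ with rfl | rfl | rfl
  · simp only [sn_one, cs_one, Real.sin_add]
  · simp only [sn_zero', cs_zero']; ring
  · simp only [sn_neg_one, cs_neg_one, Real.sinh_add]

lemma Curv.cs_add (hκ : Curv κ) (a b : ℝ) :
    cs κ (a + b) = cs κ a * cs κ b - κ * sn κ a * sn κ b := by
  rcases hκ with rfl | rfl | rfl
  · simp only [sn_one, cs_one, Real.cos_add]; ring
  · simp only [sn_zero', cs_zero']; ring
  · simp only [sn_neg_one, cs_neg_one, Real.cosh_add]; ring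

lemma Curv.sn_neg (hκ : Curv κ) (a : ℝ) : sn κ (-a) = - sn κ a := by
  rcases hκ with rfl | rfl | rfl
  · simp only [sn_one, Real.sin_neg]
  · simp only [sn_zero']
  · simp only [sn_neg_one, Real.sinh_neg]

lemma Curv.cs_neg (hκ : Curv κ) (a : ℝ) : cs κ (-a) = cs κ a := by
  rcases hκ with rfl | rfl | rfl
  · simp only [cs_one, Real.cos_neg]
  · simp only [cs_zero']
  · simp only [cs_neg_one, Real.cosh_neg]

lemma Curv.sq (hκ : Curv κ) (a : ℝ) : cs κ a ^ 2 + κ * sn κ a ^ 2 = 1 := by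
  rcases hκ with rfl | rfl | rfl
  · simp only [cs_one, sn_one]; nlinarith [Real.sin_sq_add_cos_sq a]
  · simp only [cs_zero', sn_zero']; ring
  · simp only [cs_neg_one, sn_neg_one]; nlinarith [Real.cosh_sq a]

lemma Curv.cs_at_zero (hκ : Curv κ) : cs κ 0 = 1 := by
  rcases hκ with rfl | rfl | rfl <;> simp [cs_one, cs_zero', cs_neg_one]

lemma Curv.sn_at_zero (hκ : Curv κ) : sn κ 0 = 0 := by
  rcases hκ with rfl | rfl | rfl <;> simp [sn_one, sn_zero', sn_neg_one]

lemma Curv.vs_at_zero (hκ : Curv κ) : vs κ 0 = 0 := by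
  simp [vs, hκ.sn_at_zero]

lemma Curv.mul_vs (hκ : Curv κ) (a : ℝ) : κ * vs κ a = 1 - cs κ a := by
  have h := hκ.cs_add (a / 2) (a / 2)
  have h2 := hκ.sq (a / 2)
  rw [add_halves] at h
  unfold vs
  linarith

lemma Curv.sq_cases (hκ : Curv κ) : κ * κ = 1 ∨ κ = 0 := by
  rcases hκ with rfl | rfl | rfl <;> norm_num

lemma Curv.vs_add (hκ : Curv κ) (a b : ℝ) :
    vs κ (a + b) = vs κ a + vs κ b * cs κ a + sn κ a * sn κ b := by
  rcases hκ.sq_cases with h | h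
  · have h1 := hκ.mul_vs a
    have h2 := hκ.mul_vs b
    have h3 := hκ.mul_vs (a + b)
    have h4 := hκ.cs_add a b
    have : κ * vs κ (a + b) = κ * (vs κ a + vs κ b * cs κ a + sn κ a * sn κ b) := by
      rw [h3, h4]; linear_combination -h1 - cs κ a * h2
    exact mul_left_cancel₀ (by rintro rfl; simp at h) this
  · subst h; simp only [vs, sn_zero', cs_zero']; ring

lemma Curv.vs_neg (hκ : Curv κ) (a : ℝ) : vs κ (-a) = vs κ a := by
  unfold vs; rw [neg_div, hκ.sn_neg]; ring

lemma Curv.continuous_sn (hκ : Curv κ) : Continuous (sn κ) := by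
  rcases hκ with rfl | rfl | rfl
  · exact Real.continuous_sin.congr fun s => (sn_one s).symm
  · exact continuous_id.congr fun s => (sn_zero' s).symm
  · exact Real.continuous_sinh.congr fun s => (sn_neg_one s).symm

lemma Curv.continuous_cs (hκ : Curv κ) : Continuous (cs κ) := by
  rcases hκ with rfl | rfl | rfl
  · exact Real.continuous_cos.congr fun s => (cs_one s).symm
  · exact continuous_const.congr fun s => (cs_zero' s).symm
  · exact Real.continuous_cosh.congr fun s => (cs_neg_one s).symm

lemma Curv.continuous_vs (hκ : Curv κ) : Continuous (vs κ) := by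
  unfold vs
  exact continuous_const.mul ((hκ.continuous_sn.comp (continuous_id.div_const 2)).pow 2)

lemma vs_nonneg (κ s : ℝ) : 0 ≤ vs κ s := by unfold vs; positivity

lemma Curv.sn_pos (hκ : Curv κ) {s : ℝ} (h : 0 < s) (h1 : κ = 1 → s < Real.pi) :
    0 < sn κ s := by
  rcases hκ with rfl | rfl | rfl
  · rw [sn_one]; exact Real.sin_pos_of_pos_of_lt_pi h (h1 rfl)
  · rw [sn_zero']; exact h
  · rw [sn_neg_one]; exact Real.sinh_pos_iff.2 h

lemma Curv.sn_nonneg (hκ : Curv κ) {s : ℝ} (h : 0 ≤ s) (h1 : κ = 1 → s ≤ Real.pi) :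
    0 ≤ sn κ s := by
  rcases hκ with rfl | rfl | rfl
  · rw [sn_one]; exact Real.sin_nonneg_of_nonneg_of_le_pi h (h1 rfl)
  · rw [sn_zero']; exact h
  · rw [sn_neg_one]; exact Real.sinh_nonneg_iff.2 h

lemma Curv.cs_pos (hκ : Curv κ) {s : ℝ} (h : 0 ≤ s) (h1 : κ = 1 → s < Real.pi / 2) :
    0 < cs κ s := by
  rcases hκ with rfl | rfl | rfl
  · rw [cs_one]; exact Real.cos_pos_of_mem_Ioo ⟨by linarith [Real.pi_pos], h1 rfl⟩
  · rw [cs_zero']; norm_num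
  · rw [cs_neg_one]; exact Real.cosh_pos s

lemma Curv.sn_strictMono (hκ : Curv κ) {s t : ℝ} (h : 0 ≤ s) (hst : s < t)
    (h1 : κ = 1 → t ≤ Real.pi / 2) : sn κ s < sn κ t := by
  rcases hκ with rfl | rfl | rfl
  · rw [sn_one, sn_one]
    exact Real.sin_lt_sin_of_lt_of_le_pi_div_two (by linarith [Real.pi_pos]) (h1 rfl) hst
  · rw [sn_zero', sn_zero']; exact hst
  · rw [sn_neg_one, sn_neg_one]; exact Real.sinh_lt_sinh.2 hst

lemma Curv.vs_lt (hκ : Curv κ) {s t : ℝ} (h : 0 ≤ s) (hst : s < t)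
    (h1 : κ = 1 → t ≤ Real.pi) : vs κ s < vs κ t := by
  have h2 : sn κ (s / 2) < sn κ (t / 2) :=
    hκ.sn_strictMono (by linarith) (by linarith) (fun h => by linarith [h1 h])
  have h3 : 0 ≤ sn κ (s / 2) :=
    hκ.sn_nonneg (by linarith) (fun h => by linarith [h1 h, Real.pi_pos])
  unfold vs
  nlinarith

lemma Curv.vs_le (hκ : Curv κ) {s t : ℝ} (h : 0 ≤ s) (hst : s ≤ t)
    (h1 : κ = 1 → t ≤ Real.pi) : vs κ s ≤ vs κ t := by
  rcases hst.eq_or_lt with rfl | hst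
  · exact le_rfl
  · exact (hκ.vs_lt h hst h1).le

lemma Curv.lt_of_vs_lt (hκ : Curv κ) {s t : ℝ} (h : 0 ≤ t) (hst : vs κ s < vs κ t)
    (h1 : κ = 1 → s ≤ Real.pi) : s < t := by
  by_contra hc
  exact absurd (hκ.vs_le h (not_lt.1 hc) h1) (not_le.2 hst)

lemma Curv.le_of_vs_le (hκ : Curv κ) {s t : ℝ} (h : 0 ≤ t) (hst : vs κ s ≤ vs κ t)
    (h1 : κ = 1 → s ≤ Real.pi) : s ≤ t := by
  by_contra hc
  exact absurd (hκ.vs_lt h (not_le.1 hc) h1) (not_lt.2 hst)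

lemma Curv.eq_of_vs_eq (hκ : Curv κ) {s t : ℝ} (hs : 0 ≤ s) (ht : 0 ≤ t)
    (hst : vs κ s = vs κ t) (h1 : κ = 1 → s ≤ Real.pi) (h2 : κ = 1 → t ≤ Real.pi) : s = t :=
  le_antisymm (hκ.le_of_vs_le ht hst.le h1) (hκ.le_of_vs_le hs hst.ge h2)

lemma Curv.sq_le_vs (hκ : Curv κ) {s : ℝ} (h : 0 ≤ s) (h1 : κ = 1 → s ≤ Real.pi) :
    s ^ 2 ≤ 5 * vs κ s := by
  unfold vs
  rcases hκ with rfl | rfl | rfl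
  · rw [sn_one]
    have h2 := Real.mul_le_sin (x := s / 2) (by linarith) (by linarith [h1 rfl])
    have h3 : 0.633 * (s / 2) ≤ 2 / Real.pi * (s / 2) := by
      apply mul_le_mul_of_nonneg_right _ (by linarith)
      rw [le_div_iff₀ Real.pi_pos]; nlinarith [Real.pi_lt_d2]
    have h4 := pow_le_pow_left₀ (by linarith) (h3.trans h2) 2
    nlinarith
  · rw [sn_zero']; nlinarith [sq_nonneg s]
  · rw [sn_neg_one]
    have := Real.self_le_sinh_iff.2 (show 0 ≤ s / 2 by linarith)
    nlinarith

lemma Curv.vs_pos (hκ : Curv κ) {s : ℝ} (h : 0 < s) (h1 : κ = 1 → s ≤ Real.pi) :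
    0 < vs κ s := by
  nlinarith [hκ.sq_le_vs h.le h1]

end

/-- The ambient linear space of the projective models. -/
abbrev Amb (d : ℕ) := EuclideanSpace ℝ (Fin d) × ℝ

/-- The ambient form with `br (e x) (e y) = cs κ (dist x y)`. -/
noncomputable def br (κ : ℝ) {d : ℕ} (y z : Amb d) : ℝ := κ * inner ℝ y.1 z.1 + y.2 * z.2

/-- The ambient form inducing the metric tensor. -/
noncomputable def Bf (κ : ℝ) {d : ℕ} (y z : Amb d) : ℝ := inner ℝ y.1 z.1 + κ * (y.2 * z.2)

section
variable {κ : ℝ} {d : ℕ} (y y' z : Amb d) (a : ℝ)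

lemma br_comm : br κ y z = br κ z y := by
  unfold br; rw [real_inner_comm]; ring
lemma br_add_left : br κ (y + y') z = br κ y z + br κ y' z := by
  simp only [br, Prod.fst_add, Prod.snd_add, inner_add_left]; ring
lemma br_smul_left : br κ (a • y) z = a * br κ y z := by
  simp only [br, Prod.smul_fst, Prod.smul_snd, real_inner_smul_left, smul_eq_mul]; ring
lemma br_add_right : br κ z (y + y') = br κ z y + br κ z y' := by
  rw [br_comm, br_add_left, br_comm y, br_comm y']
lemma br_smul_right : br κ z (a • y) = a * br κ z y := by
  rw [br_comm, br_smul_left, br_comm y]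
lemma br_neg_left : br κ (-y) z = - br κ y z := by
  rw [← neg_one_smul ℝ y, br_smul_left]; ring
lemma br_neg_right : br κ z (-y) = - br κ z y := by
  rw [← neg_one_smul ℝ y, br_smul_right]; ring
lemma br_sub_left : br κ (y - y') z = br κ y z - br κ y' z := by
  rw [sub_eq_add_neg, br_add_left, br_neg_left]; ring
lemma br_sub_right : br κ z (y - y') = br κ z y - br κ z y' := by
  rw [sub_eq_add_neg, br_add_right, br_neg_right]; ring

lemma Bf_comm : Bf κ y z = Bf κ z y := by
  unfold Bf; rw [real_inner_comm]; ring
lemma Bf_add_left : Bf κ (y + y') z = Bf κ y z + Bf κ y' z := by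
  simp only [Bf, Prod.fst_add, Prod.snd_add, inner_add_left]; ring
lemma Bf_smul_left : Bf κ (a • y) z = a * Bf κ y z := by
  simp only [Bf, Prod.smul_fst, Prod.smul_snd, real_inner_smul_left, smul_eq_mul]; ring
lemma Bf_add_right : Bf κ z (y + y') = Bf κ z y + Bf κ z y' := by
  rw [Bf_comm, Bf_add_left, Bf_comm y, Bf_comm y']
lemma Bf_smul_right : Bf κ z (a • y) = a * Bf κ z y := by
  rw [Bf_comm, Bf_smul_left, Bf_comm y]
lemma Bf_neg_left : Bf κ (-y) z = - Bf κ y z := by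
  rw [← neg_one_smul ℝ y, Bf_smul_left]; ring
lemma Bf_neg_right : Bf κ z (-y) = - Bf κ z y := by
  rw [← neg_one_smul ℝ y, Bf_smul_right]; ring
lemma Bf_sub_left : Bf κ (y - y') z = Bf κ y z - Bf κ y' z := by
  rw [sub_eq_add_neg, Bf_add_left, Bf_neg_left]; ring
lemma Bf_sub_right : Bf κ z (y - y') = Bf κ z y - Bf κ z y' := by
  rw [sub_eq_add_neg, Bf_add_right, Bf_neg_right]; ring

lemma Bf_eq (h : κ * κ = 1) : Bf κ y z = κ * br κ y z := by
  unfold Bf br; linear_combination (-inner ℝ y.1 z.1) * h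

end

/-- A linear model of the space form of curvature `κ ∈ {1, 0, -1}`. -/
structure Model (κ : ℝ) (X : Type*) [MetricSpace X] (d : ℕ) where
  /-- The embedding of the space in its ambient linear space. -/
  e : X → Amb d
  curv : Curv κ
  q_eq : ∀ x, br κ (e x) (e x) = 1
  ht_pos : κ ≠ 1 → ∀ x, 0 < (e x).2
  surj : ∀ y : Amb d, br κ y y = 1 → (κ ≠ 1 → 0 < y.2) → ∃ x, e x = y
  vs_dist : ∀ x y, vs κ (dist x y) = 1 / 2 * Bf κ (e x - e y) (e x - e y)
  dist_le : κ = 1 → ∀ x y : X, dist x y ≤ Real.pi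

namespace Model
variable {κ : ℝ} {d : ℕ}

lemma ht_one (M : Model κ X d) (h : κ = 0) (x : X) : (M.e x).2 = 1 := by
  subst h
  have h1 := M.q_eq x
  have h2 := M.ht_pos (by norm_num) x
  simp only [br] at h1
  nlinarith

lemma br_zero (M : Model κ X d) (h : κ = 0) (x y : X) : br κ (M.e x) (M.e y) = 1 := by
  unfold br; rw [M.ht_one h, M.ht_one h]; subst h; ring

lemma cs_dist (M : Model κ X d) (x y : X) : cs κ (dist x y) = br κ (M.e x) (M.e y) := by
  have h1 := M.curv.mul_vs (dist x y)
  rcases M.curv.sq_cases with h | h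
  · rw [M.vs_dist, Bf_eq _ _ h] at h1
    simp only [br_sub_left, br_sub_right, M.q_eq, br_comm (M.e y) (M.e x)] at h1
    linear_combination h1 - (1 - br κ (M.e x) (M.e y)) * h
  · rw [M.br_zero h, h, cs_zero']

lemma dist_zero (M : Model κ X d) (h : κ = 0) (x y : X) : dist x y = ‖(M.e x).1 - (M.e y).1‖ := by
  have h1 := M.vs_dist x y
  subst h
  simp only [vs, sn_zero', Bf, real_inner_self_eq_norm_sq] at h1
  have h2 : dist x y ^ 2 = ‖(M.e x).1 - (M.e y).1‖ ^ 2 := by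
    simp only [Prod.fst_sub] at h1; linarith
  exact (pow_left_inj₀ dist_nonneg (norm_nonneg _) two_ne_zero).1 h2

lemma e_inj (M : Model κ X d) {x y : X} (h : M.e x = M.e y) : x = y := by
  have h1 := M.vs_dist x y
  rw [h, sub_self] at h1
  have h2 := M.curv.sq_le_vs (dist_nonneg (x := x) (y := y)) (fun h => M.dist_le h x y)
  rw [h1] at h2
  simp only [Bf, Prod.fst_zero, Prod.snd_zero, inner_zero_left] at h2
  exact dist_le_zero.1 (by nlinarith [dist_nonneg (x := x) (y := y)])

/-- Tangent vectors are spacelike. -/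
lemma eq_zero_of_tangent (M : Model κ X d)
    {z : X} {r : Amb d} (h : br κ r (M.e z) = 0) (h2 : Bf κ r r ≤ 0) :
    r = 0 := by
  have hn : ∀ v : EuclideanSpace ℝ (Fin d), inner ℝ v v = ‖v‖ ^ 2 := real_inner_self_eq_norm_sq
  have hz := M.q_eq z
  rcases M.curv with rfl | rfl | rfl
  · simp only [Bf, hn] at h2
    have h3 : ‖r.1‖ = 0 := by nlinarith [sq_nonneg ‖r.1‖, sq_nonneg r.2]
    have h4 : r.2 = 0 := by nlinarith [sq_nonneg ‖r.1‖, sq_nonneg r.2]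
    exact Prod.ext (norm_eq_zero.1 h3) h4
  · simp only [br, M.ht_one rfl] at h
    simp only [Bf, hn] at h2
    have h3 : ‖r.1‖ = 0 := by nlinarith [sq_nonneg ‖r.1‖]
    exact Prod.ext (norm_eq_zero.1 h3) (by rw [Prod.snd_zero]; linarith)
  · have hp := M.ht_pos (by norm_num) z
    simp only [br, Bf, hn] at h h2 hz
    have h3 := abs_real_inner_le_norm r.1 (M.e z).1
    have h4 : (r.2 * (M.e z).2) ^ 2 ≤ (‖r.1‖ * ‖(M.e z).1‖) ^ 2 := by
      rw [show r.2 * (M.e z).2 = inner ℝ r.1 (M.e z).1 by linarith, ← sq_abs]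
      exact pow_le_pow_left₀ (abs_nonneg _) h3 2
    have h5 : r.2 ^ 2 ≤ 0 := by
      nlinarith [mul_le_mul_of_nonneg_right (show ‖r.1‖ ^ 2 ≤ r.2 ^ 2 by nlinarith)
        (sq_nonneg ‖(M.e z).1‖)]
    have h6 : r.2 = 0 := by nlinarith
    have h7 : ‖r.1‖ = 0 := by rw [h6] at h2; nlinarith [sq_nonneg ‖r.1‖]
    exact Prod.ext (norm_eq_zero.1 h7) h6

/-- A vector of the quadric making a positive product with a point of the model is a point. -/
lemma exists_of_br_pos (M : Model κ X d)
    {y : Amb d} (h : br κ y y = 1) (z : X) (hz : κ = -1 → 0 < br κ (M.e z) y)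
    (h0 : κ = 0 → y.2 = 1) : ∃ x, M.e x = y := by
  refine M.surj y h fun h1 => ?_
  rcases M.curv with rfl | rfl | rfl
  · exact absurd rfl h1
  · rw [h0 rfl]; norm_num
  · have hp := M.ht_pos h1 z
    have hz := hz rfl
    have hq := M.q_eq z
    simp only [br, real_inner_self_eq_norm_sq] at h hz hq
    have h3 := neg_le_of_abs_le (abs_real_inner_le_norm (M.e z).1 y.1)
    by_contra hc
    have h4 : ‖(M.e z).1‖ ≤ (M.e z).2 := by nlinarith [norm_nonneg (M.e z).1]
    have h5 : ‖y.1‖ ≤ -y.2 := by nlinarith [norm_nonneg y.1]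
    nlinarith [mul_le_mul h4 h5 (norm_nonneg _) hp.le]

/-- The linear relation between the points of a geodesic segment. -/
lemma btw_combo (M : Model κ X d) {x z y : X} (h : Btw x z y) :
    sn κ (dist x y) • M.e z = sn κ (dist z y) • M.e x + sn κ (dist x z) • M.e y := by
  have hD : dist x y = dist x z + dist z y := h.symm
  have hs := M.curv.sn_add (dist x z) (dist z y)
  have hc := M.curv.cs_add (dist x z) (dist z y)
  have hq1 := M.curv.sq (dist x z)
  have hq2 := M.curv.sq (dist z y)
  have hxz := M.cs_dist x z
  have hzy := M.cs_dist z y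
  have hxy := M.cs_dist x y
  rw [← sub_eq_zero]
  apply M.eq_zero_of_tangent (z := z)
  · simp only [br_sub_left, br_add_left, br_smul_left, M.q_eq, ← M.cs_dist]
    rw [hD, hs, dist_comm y z]; ring
  · rcases M.curv.sq_cases with h0 | h0
    · rw [Bf_eq _ _ h0]
      simp only [br_sub_left, br_add_left, br_smul_left, br_sub_right, br_add_right,
        br_smul_right, M.q_eq, ← M.cs_dist]
      rw [dist_comm y z, dist_comm z x, dist_comm y x, hD, hs, hc]
      set s := dist x z
      set t := dist z y
      apply le_of_eq
      rw [mul_eq_zero]; right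
      linear_combination (-2 * sn κ s * sn κ t * cs κ s * cs κ t - sn κ t ^ 2) * hq1
        + (- sn κ s ^ 2) * hq2 + 2 * sn κ s * sn κ t * cs κ s * cs κ t * hq1
    · subst h0
      have e1 := M.dist_zero rfl x z
      have e2 := M.dist_zero rfl z y
      have e3 := M.dist_zero rfl x y
      rw [hD, e1, e2] at e3
      have e4 : (M.e x).1 - (M.e y).1 = ((M.e x).1 - (M.e z).1) + ((M.e z).1 - (M.e y).1) := by
        abel
      rw [e4] at e3
      have e6 := sameRay_iff_norm_add.2 e3.symm
      have e7 := sameRay_iff_norm_smul_eq.1 e6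
      simp only [sn_zero']
      have : (dist x y • M.e z - (dist z y • M.e x + dist x z • M.e y)) = 0 := by
        apply Prod.ext
        · rw [← e1, ← e2] at e7
          simp only [smul_sub] at e7
          simp only [hD, Prod.fst_sub, Prod.smul_fst, Prod.fst_add, Prod.fst_zero, add_smul]
          have := sub_eq_zero.2 e7
          rw [← this]; abel
        · simp [M.ht_one, hD]; ring
      rw [this]; simp [Bf]

end Model

/-- The normalized power function of the ball of center `c` and radius `P`. -/
noncomputable def phi (κ : ℝ) (c : X) (P : ℝ) (z : X) : ℝ :=
  (vs κ (dist c z) - vs κ P) / cs κ P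

namespace Model
variable {κ : ℝ} {d : ℕ}

lemma stewart (M : Model κ X d) {x z y : X} (h : Btw x z y) (m : X) :
    sn κ (dist x y) * vs κ (dist m z) =
      sn κ (dist z y) * (vs κ (dist m x) - vs κ (dist x z)) +
        sn κ (dist x z) * (vs κ (dist m y) - vs κ (dist z y)) := by
  have hc := M.btw_combo h
  have hs := M.curv.sn_add (dist x z) (dist z y)
  rw [show dist x z + dist z y = dist x y from h] at hs
  rcases M.curv.sq_cases with h0 | h0
  · have h1 := congrArg (fun v => br κ (M.e m) v) hc
    simp only [br_add_right, br_smul_right, ← M.cs_dist] at h1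
    have hne : κ ≠ 0 := by rintro rfl; simp at h0
    apply mul_left_cancel₀ hne
    have e1 := M.curv.mul_vs (dist m z)
    have e2 := M.curv.mul_vs (dist m x)
    have e3 := M.curv.mul_vs (dist m y)
    have e4 := M.curv.mul_vs (dist x z)
    have e5 := M.curv.mul_vs (dist z y)
    linear_combination -h1 + sn κ (dist x y) * e1 - sn κ (dist z y) * (e2 - e4)
      - sn κ (dist x z) * (e3 - e5) + hs
  · subst h0
    have hD : dist x z + dist z y = dist x y := h
    rcases (dist_nonneg (x := x) (y := y)).eq_or_lt with h1 | h1
    · have h2 : dist x z = 0 := by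
        linarith [dist_nonneg (x := x) (y := z), dist_nonneg (x := z) (y := y)]
      have h3 : dist z y = 0 := by linarith
      simp [← h1, h2, h3, sn_zero']
    · simp only [sn_zero'] at hc ⊢
      have h2 : dist x y • (M.e m - M.e z) =
          dist z y • (M.e m - M.e x) + dist x z • (M.e m - M.e y) := by
        rw [smul_sub, smul_sub, smul_sub, hc, ← hD, add_smul]; abel
      have h3 : M.e x - M.e y = (M.e m - M.e y) - (M.e m - M.e x) := by abel
      have f1 := M.vs_dist m z
      have f2 := M.vs_dist m x
      have f3 := M.vs_dist m y
      have f4 := M.vs_dist x y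
      have h4 := congrArg (fun v => Bf 0 v v) h2
      rw [h3] at f4
      simp only [Bf_add_left, Bf_add_right, Bf_smul_left, Bf_smul_right, Bf_sub_left (_ - _),
        Bf_sub_right (_ - _)] at h4 f4
      rw [Bf_comm (M.e m - M.e y) (M.e m - M.e x)] at h4 f4
      have v1 : vs 0 (dist x z) = dist x z ^ 2 / 2 := by simp only [vs, sn_zero']; ring
      have v2 : vs 0 (dist z y) = dist z y ^ 2 / 2 := by simp only [vs, sn_zero']; ring
      have v3 : vs 0 (dist x y) = dist x y ^ 2 / 2 := by simp only [vs, sn_zero']; ring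
      apply mul_left_cancel₀ h1.ne'
      rw [v3] at f4
      rw [v1, v2, f1, f2, f3]
      rw [← hD] at h4 f4 ⊢
      linear_combination h4 / 2 + dist z y * dist x z * f4

lemma btw_unique (M : Model κ X d) {x z z' y : X} (hD : κ = 1 → dist x y < Real.pi) (h : Btw x z y)
    (h' : Btw x z' y) (hd : dist x z = dist x z') : z = z' := by
  have hE : dist x z + dist z y = dist x y := h
  have hE' : dist x z' + dist z' y = dist x y := h'
  rcases (dist_nonneg (x := x) (y := y)).eq_or_lt with h1 | h1
  · have h2 : dist x z = 0 := by
      linarith [dist_nonneg (x := x) (y := z), dist_nonneg (x := z) (y := y)]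
    exact (dist_eq_zero.1 h2).symm.trans (dist_eq_zero.1 (hd.symm.trans h2))
  · have c1 := M.btw_combo h
    have c2 := M.btw_combo h'
    rw [← hd, show dist z' y = dist z y by linarith, ← c1] at c2
    exact M.e_inj (smul_right_injective _ (M.curv.sn_pos h1 hD).ne' c2.symm)

lemma uniqueBtwPt (M : Model κ X d) {x z y : X} (hD : κ = 1 → dist x y < Real.pi) (h : Btw x z y) :
    UniqueBtwPt x z y :=
  ⟨h, fun _ hw hd => M.btw_unique hD hw h hd⟩

lemma btw_extend_unique (M : Model κ X d)
    {x y z z' : X} (h0 : 0 < dist x y) (hD : κ = 1 → dist x y < Real.pi)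
    (h : Btw x y z) (h' : Btw x y z') (hd : dist y z = dist y z') : z = z' := by
  have hE : dist x y + dist y z = dist x z := h
  have hE' : dist x y + dist y z' = dist x z' := h'
  have c1 := M.btw_combo h
  have c2 := M.btw_combo h'
  rw [← hE', ← hd, hE, c1] at c2
  exact M.e_inj (smul_right_injective _ (M.curv.sn_pos h0 hD).ne' (add_left_cancel c2))

/-- A point of a segment as a combination of its endpoints, with the induced behaviour of the
distance function. -/
lemma btw_coeffs (M : Model κ X d) {x z y : X} (hD : κ = 1 → dist x y < Real.pi) (h : Btw x z y) :
    ∃ α β q : ℝ, 0 ≤ α ∧ 0 ≤ β ∧ 0 ≤ q ∧ M.e z = α • M.e x + β • M.e y ∧ α + β = 1 + κ * q ∧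
      (∀ m, vs κ (dist m z) = α * vs κ (dist m x) + β * vs κ (dist m y) - q) ∧
      (z ≠ x → z ≠ y → 0 < α ∧ 0 < β ∧ 0 < q) := by
  have hE : dist x z + dist z y = dist x y := h
  rcases (dist_nonneg (x := x) (y := y)).eq_or_lt with h1 | h1
  · have h2 : dist x z = 0 := by
      linarith [dist_nonneg (x := x) (y := z), dist_nonneg (x := z) (y := y)]
    rw [dist_eq_zero] at h2; subst h2
    exact ⟨1, 0, 0, by simp⟩
  · have hp := M.curv.sn_pos h1 hD
    have hst := M.stewart h
    have hcb := M.btw_combo h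
    have hs := M.curv.sn_add (dist x z) (dist z y)
    rw [hE] at hs
    set D := dist x y
    set s := dist x z with hsd
    set t := dist z y with htd
    have hs0 : 0 ≤ s := dist_nonneg
    have ht0 : 0 ≤ t := dist_nonneg
    have hα : 0 ≤ sn κ t := M.curv.sn_nonneg ht0 (fun hk => by linarith [hD hk])
    have hβ : 0 ≤ sn κ s := M.curv.sn_nonneg hs0 (fun hk => by linarith [hD hk])
    refine ⟨sn κ t / sn κ D, sn κ s / sn κ D,
      sn κ t / sn κ D * vs κ s + sn κ s / sn κ D * vs κ t, by positivity, by positivity, ?_, ?_, ?_,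
      ?_, ?_⟩
    · have := vs_nonneg κ s; have := vs_nonneg κ t; positivity
    · apply smul_right_injective _ hp.ne'
      simp only [smul_add, smul_smul]
      rw [mul_div_cancel₀ _ hp.ne', mul_div_cancel₀ _ hp.ne', ← hcb]
    · have e4 := M.curv.mul_vs s
      have e5 := M.curv.mul_vs t
      field_simp
      linear_combination -hs - sn κ t * e4 - sn κ s * e5
    · intro m
      have := hst m
      field_simp
      linear_combination this
    · intro hx hy
      have h3 : 0 < s := dist_pos.2 (Ne.symm hx)
      have h4 : 0 < t := dist_pos.2 hy
      have h5 : 0 < sn κ t := M.curv.sn_pos h4 (fun hk => by linarith [hD hk])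
      have h6 : 0 < sn κ s := M.curv.sn_pos h3 (fun hk => by linarith [hD hk])
      have h7 := M.curv.vs_pos h3 (fun hk => by linarith [hD hk])
      have h8 := M.curv.vs_pos h4 (fun hk => by linarith [hD hk])
      exact ⟨by positivity, by positivity, by positivity⟩


lemma phi_nonpos_iff (M : Model κ X d) {c : X} {P : ℝ} (hP : 0 ≤ P) (hc : 0 < cs κ P)
    (h1 : κ = 1 → P ≤ Real.pi) (z : X) : phi κ c P z ≤ 0 ↔ dist c z ≤ P := by
  unfold phi
  rw [div_nonpos_iff]
  constructor
  · rintro (⟨-, h⟩ | ⟨h, -⟩)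
    · linarith
    · exact M.curv.le_of_vs_le hP (by linarith) (fun h => M.dist_le h _ _)
  · intro h
    exact Or.inr ⟨by linarith [M.curv.vs_le dist_nonneg h h1], hc.le⟩

lemma phi_neg_iff (M : Model κ X d) {c : X} {P : ℝ} (hP : 0 ≤ P) (hc : 0 < cs κ P)
    (h1 : κ = 1 → P ≤ Real.pi) (z : X) : phi κ c P z < 0 ↔ dist c z < P := by
  unfold phi
  rw [div_neg_iff]
  constructor
  · rintro (⟨-, h⟩ | ⟨h, -⟩)
    · linarith
    · exact M.curv.lt_of_vs_lt hP (by linarith) (fun h => M.dist_le h _ _)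
  · intro h
    exact Or.inr ⟨by linarith [M.curv.vs_lt dist_nonneg h h1], hc⟩

lemma phi_combo (M : Model κ X d) {x y z : X} {α β q : ℝ} (hq : α + β = 1 + κ * q)
    (h : ∀ m, vs κ (dist m z) = α * vs κ (dist m x) + β * vs κ (dist m y) - q) {c : X} {P : ℝ}
    (hc : 0 < cs κ P) : phi κ c P z = α * phi κ c P x + β * phi κ c P y - q := by
  have h1 := M.curv.mul_vs P
  unfold phi
  rw [h c]
  field_simp
  linear_combination vs κ P * hq + q * h1

/-- Closed balls (of radius less than `π / 2` for the sphere) are strictly convex. -/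
lemma ball_strict (M : Model κ X d)
    {c x y z : X} {P : ℝ} (hP : 0 ≤ P) (h1 : κ = 1 → P < Real.pi / 2)
    (hx : dist c x ≤ P) (hy : dist c y ≤ P) (hz : Btw x z y) (hzx : z ≠ x) (hzy : z ≠ y) :
    dist c z < P := by
  have hc := M.curv.cs_pos hP h1
  have h2 : κ = 1 → P ≤ Real.pi := fun h => by linarith [h1 h, Real.pi_pos]
  have hD : κ = 1 → dist x y < Real.pi := fun h => by
    linarith [h1 h, dist_triangle_left x y c]
  obtain ⟨α, β, q, hα, hβ, hq, -, hs, hm, hst⟩ := M.btw_coeffs hD hz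
  obtain ⟨a1, b1, q1⟩ := hst hzx hzy
  rw [← M.phi_neg_iff hP hc h2, M.phi_combo hs hm hc]
  rw [← M.phi_nonpos_iff hP hc h2] at hx hy
  nlinarith

lemma ball_gconvex (M : Model κ X d) {c : X} {P : ℝ} (hP : 0 ≤ P) (h1 : κ = 1 → P < Real.pi / 2) :
    GConvex (closedBall c P) := by
  intro x hx y hy z hz
  rw [mem_closedBall'] at *
  by_cases h : z = x
  · rwa [h]
  by_cases h' : z = y
  · rwa [h']
  exact (M.ball_strict hP h1 hx hy hz.1 h h').le

/-- The exponential map. -/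
lemma exists_exp (M : Model κ X d)
    (x : X) {u : Amb d} (h1 : br κ (M.e x) u = 0) (h2 : Bf κ u u = 1) :
    ∃ γ : ℝ → X, ∀ t, M.e (γ t) = cs κ t • M.e x + sn κ t • u := by
  have : ∀ t, ∃ z, M.e z = cs κ t • M.e x + sn κ t • u := fun t => by
    have hq : κ = 0 ∨ br κ u u = κ := by
      rcases M.curv.sq_cases with h0 | h0
      · rw [Bf_eq _ _ h0] at h2
        right; linear_combination κ * h2 - br κ u u * h0
      · exact Or.inl h0
    have hu : κ = 0 → u.2 = 0 := fun h => by
      rw [br, M.ht_one h] at h1; simpa [h] using h1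
    apply M.exists_of_br_pos _ x
    · intro hk
      rw [br_add_right, br_smul_right, br_smul_right, M.q_eq, h1]
      have := M.curv.cs_pos (s := |t|) (abs_nonneg t) (by subst hk; norm_num)
      rcases abs_choice t with h | h <;> rw [h] at this
      · linarith
      · rw [M.curv.cs_neg] at this; linarith
    · intro hk
      simp only [Prod.snd_add, Prod.smul_snd, hu hk, M.ht_one hk, smul_eq_mul]
      subst hk; rw [cs_zero']; ring
    · simp only [br_add_left, br_add_right, br_smul_left, br_smul_right, M.q_eq, h1,
        br_comm u (M.e x)]
      have h3 := M.curv.sq t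
      rcases hq with hq | hq
      · have hb : br κ u u = 0 := by rw [br, hu hq]; simp [hq]
        rw [hb]
        linear_combination h3 - sn κ t ^ 2 * hq
      · rw [hq]; linear_combination h3
  choose γ hγ using this
  exact ⟨γ, hγ⟩

lemma vs_dist_exp (M : Model κ X d)
    {x : X} {u : Amb d} (h1 : br κ (M.e x) u = 0) (h2 : Bf κ u u = 1)
    {γ : ℝ → X} (hγ : ∀ t, M.e (γ t) = cs κ t • M.e x + sn κ t • u) (s t : ℝ) :
    vs κ (dist (γ s) (γ t)) = vs κ (s - t) := by
  rw [M.vs_dist, hγ, hγ]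
  have e1 : cs κ s • M.e x + sn κ s • u - (cs κ t • M.e x + sn κ t • u) =
    (cs κ s - cs κ t) • M.e x + (sn κ s - sn κ t) • u := by module
  rw [e1]
  have hv : vs κ (s - t) = 1 / 2 * (κ * (cs κ s - cs κ t) ^ 2 + (sn κ s - sn κ t) ^ 2) := by
    rcases M.curv.sq_cases with h0 | h0
    · have hne : κ ≠ 0 := by rintro rfl; simp at h0
      apply mul_left_cancel₀ hne
      rw [M.curv.mul_vs, sub_eq_add_neg s t, M.curv.cs_add, M.curv.cs_neg, M.curv.sn_neg]
      have a1 := M.curv.sq s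
      have a2 := M.curv.sq t
      linear_combination (-1 / 2) * (a1 + a2) - 1 / 2 * (cs κ s - cs κ t) ^ 2 * h0
    · simp only [vs, h0, sn_zero']; ring
  rw [hv]
  simp only [Bf_add_left, Bf_add_right, Bf_smul_left, Bf_smul_right, h2, Bf_comm u (M.e x)]
  rcases M.curv.sq_cases with h0 | h0
  · rw [Bf_eq _ _ h0, Bf_eq _ _ h0, h1, M.q_eq]; ring
  · have : cs κ s - cs κ t = 0 := by rw [h0, cs_zero', cs_zero']; ring
    rw [this]; ring

lemma dist_exp (M : Model κ X d) {x : X} {u : Amb d} (h1 : br κ (M.e x) u = 0) (h2 : Bf κ u u = 1)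
    {γ : ℝ → X} (hγ : ∀ t, M.e (γ t) = cs κ t • M.e x + sn κ t • u) {s t : ℝ}
    (hst : κ = 1 → |s - t| ≤ Real.pi) : dist (γ s) (γ t) = |s - t| := by
  apply M.curv.eq_of_vs_eq dist_nonneg (abs_nonneg _) _ (fun h => M.dist_le h _ _) hst
  rw [M.vs_dist_exp h1 h2 hγ]
  rcases abs_choice (s - t) with h | h <;> rw [h]
  rw [M.curv.vs_neg]

lemma exists_geodesic (M : Model κ X d) {x y : X} (hxy : x ≠ y) (hD : κ = 1 → dist x y < Real.pi) :
    ∃ γ : ℝ → X, γ 0 = x ∧ γ (dist x y) = y ∧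
      (∀ s t, (κ = 1 → |s - t| ≤ Real.pi) → dist (γ s) (γ t) = |s - t|) ∧
      ∀ t, sn κ (dist x y) • M.e (γ t) =
        sn κ (dist x y - t) • M.e x + sn κ t • M.e y := by
  have h0 : 0 < dist x y := dist_pos.2 hxy
  have hs := M.curv.sn_pos h0 hD
  set D := dist x y with hDd
  set u := (sn κ D)⁻¹ • (M.e y - cs κ D • M.e x) with hu
  have h1 : br κ (M.e x) u = 0 := by
    rw [hu, br_smul_right, br_sub_right, br_smul_right, M.q_eq, ← M.cs_dist]; ring
  have h2 : Bf κ u u = 1 := by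
    rw [hu, Bf_smul_left, Bf_smul_right]
    have : Bf κ (M.e y - cs κ D • M.e x) (M.e y - cs κ D • M.e x) = sn κ D ^ 2 := by
      rcases M.curv.sq_cases with h0 | h0
      · have hne : κ ≠ 0 := by rintro rfl; simp at h0
        rw [Bf_eq _ _ h0]
        simp only [br_sub_left, br_sub_right, br_smul_left, br_smul_right, M.q_eq,
          br_comm (M.e y) (M.e x)]
        rw [← M.cs_dist, ← hDd]
        linear_combination -κ * M.curv.sq D + sn κ D ^ 2 * h0
      · have h3 : cs κ D = 1 := by rw [h0, cs_zero']
        rw [h3, one_smul]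
        have h4 := M.vs_dist y x
        rw [dist_comm, ← hDd] at h4
        have h5 : vs κ D = D ^ 2 / 2 := by simp only [vs, h0, sn_zero']; ring
        have h6 : sn κ D = D := by rw [h0, sn_zero']
        rw [h6]; linarith
    rw [this]; field_simp
  obtain ⟨γ, hγ⟩ := M.exists_exp x h1 h2
  refine ⟨γ, M.e_inj ?_, M.e_inj ?_, fun s t h => M.dist_exp h1 h2 hγ h, fun t => ?_⟩
  · rw [hγ, M.curv.cs_at_zero, M.curv.sn_at_zero]; simp
  · rw [hγ, hu, smul_smul, mul_inv_cancel₀ hs.ne']; simp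
  · have e1 : sn κ (D - t) = sn κ D * cs κ t - cs κ D * sn κ t := by
      rw [sub_eq_add_neg, M.curv.sn_add, M.curv.sn_neg, M.curv.cs_neg]; ring
    rw [hγ, e1, hu, smul_add, smul_smul, smul_smul, smul_smul,
      show sn κ D * sn κ t * (sn κ D)⁻¹ = sn κ t by field_simp, smul_sub, smul_smul, sub_smul,
      mul_comm (sn κ t)]
    abel

lemma dist_eq_iff (M : Model κ X d) {x y x' y' : X} :
    dist x y = dist x' y' ↔ vs κ (dist x y) = vs κ (dist x' y') :=
  ⟨fun h => by rw [h], fun h => M.curv.eq_of_vs_eq dist_nonneg dist_nonneg h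
    (fun h => M.dist_le h _ _) (fun h => M.dist_le h _ _)⟩

lemma vs_sub_eq (M : Model κ X d) (x y z z' : X) : Bf κ (M.e z - M.e z') (M.e x - M.e y) =
    (vs κ (dist z' x) - vs κ (dist z' y)) - (vs κ (dist z x) - vs κ (dist z y)) := by
  simp only [M.vs_dist, Bf_sub_left, Bf_sub_right]
  rw [Bf_comm (M.e x) (M.e z), Bf_comm (M.e x) (M.e z'), Bf_comm (M.e y) (M.e z),
    Bf_comm (M.e y) (M.e z')]
  ring

/-- The reflection interchanging two given points. -/
lemma exists_reflection (M : Model κ X d) {x y : X} (hxy : x ≠ y) :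
    ∃ σ : X ≃ᵢ X, IsReflection σ ∧ σ x = y ∧ ∀ z, σ z = z ↔ dist z x = dist z y := by
  have hv : 0 < vs κ (dist x y) := M.curv.vs_pos (dist_pos.2 hxy) (fun h => M.dist_le h _ _)
  set v := vs κ (dist x y) with hvd
  set n := M.e x - M.e y with hn
  let l : X → ℝ := fun z => (vs κ (dist z x) - vs κ (dist z y)) / v
  have hl : ∀ z, l z * v = vs κ (dist z x) - vs κ (dist z y) := fun z => by
    simp only [l]; field_simp
  have hnn : Bf κ n n = 2 * v := by rw [hvd, M.vs_dist]; ring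
  have hbn : ∀ z, br κ (M.e z) n = -κ * (l z * v) := fun z => by
    rw [hn, br_sub_right, ← M.cs_dist, ← M.cs_dist, hl]
    linear_combination M.curv.mul_vs (dist z x) - M.curv.mul_vs (dist z y)
  have hqn : br κ n n = 2 * κ * v := by
    rw [hn, br_sub_left, br_sub_right, br_sub_right, M.q_eq, M.q_eq, br_comm (M.e y),
      ← M.cs_dist]
    linear_combination -2 * M.curv.mul_vs (dist x y)
  have : ∀ z, ∃ w, M.e w = M.e z + l z • n := fun z => by
    apply M.exists_of_br_pos _ z
    · intro hk
      rw [br_add_right, br_smul_right, M.q_eq, hbn, hk]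
      have : 0 ≤ l z * l z := mul_self_nonneg _
      nlinarith [mul_nonneg this hv.le]
    · intro hk
      simp [hn, M.ht_one hk]
    · rw [br_add_left, br_add_right, br_add_right, br_smul_left, br_smul_right, br_smul_left,
        br_smul_right, M.q_eq, br_comm n, hbn, hqn]
      ring
  choose f hf using this
  have hiso : ∀ z z', dist (f z) (f z') = dist z z' := fun z z' => by
    rw [M.dist_eq_iff, M.vs_dist, M.vs_dist, hf, hf]
    have e1 : M.e z + l z • n - (M.e z' + l z' • n) = (M.e z - M.e z') + (l z - l z') • n := by
      module
    have e2 : Bf κ (M.e z - M.e z') n = (l z' - l z) * v := by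
      rw [hn, M.vs_sub_eq, sub_mul, hl, hl]
    rw [e1, Bf_add_left, Bf_add_right, Bf_add_right, Bf_smul_left, Bf_smul_right, Bf_smul_left,
      Bf_smul_right, Bf_comm n, e2, hnn]
    ring
  have hfx : f x = y := M.e_inj (by
    have : l x = -1 := by simp only [l]; rw [dist_self, M.curv.vs_at_zero]; field_simp; ring
    rw [hf, this, hn]; module)
  have hfy : f y = x := M.e_inj (by
    have : l y = 1 := by
      simp only [l]; rw [dist_self, M.curv.vs_at_zero, dist_comm]; field_simp; ring
    rw [hf, this, hn]; module)
  have hlf : ∀ z, l (f z) = -l z := fun z => by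
    have h1 : dist (f z) x = dist z y := by rw [← hiso z y, hfy]
    have h2 : dist (f z) y = dist z x := by rw [← hiso z x, hfx]
    simp only [l]; rw [h1, h2]; ring
  have hinv : Function.Involutive f := fun z => M.e_inj (by rw [hf, hlf, hf]; module)
  have hfix : ∀ z, f z = z ↔ dist z x = dist z y := fun z => by
    rw [M.dist_eq_iff]
    constructor
    · intro h
      have h1 := hlf z
      rw [h] at h1
      have h2 := hl z
      rw [show l z = 0 by linarith] at h2
      linarith
    · intro h
      have : l z = 0 := by simp only [l]; rw [h]; simp
      exact M.e_inj (by rw [hf, this]; module)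
  let σ : X ≃ᵢ X := ⟨hinv.toPerm f, Isometry.of_dist_eq hiso⟩
  have hσ : ∀ z, σ z = f z := fun _ => rfl
  refine ⟨σ, ⟨?_, ?_, ?_⟩, hfx, hfix⟩
  · ext z; exact hinv z
  · intro h
    have := congrArg (fun s : X ≃ᵢ X => s x) h
    exact hxy (this.symm.trans hfx)
  · intro hc
    have ho1 : IsOpen {z : X | dist z x < dist z y} :=
      isOpen_lt (continuous_id.dist continuous_const) (continuous_id.dist continuous_const)
    have ho2 : IsOpen {z : X | dist z y < dist z x} :=
      isOpen_lt (continuous_id.dist continuous_const) (continuous_id.dist continuous_const)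
    obtain ⟨z, -, h1, h2⟩ := hc _ _ ho1 ho2 (fun z hz => by
        rcases lt_trichotomy (dist z x) (dist z y) with h | h | h
        · exact Or.inl h
        · exact absurd ((hfix z).2 h) hz
        · exact Or.inr h)
      ⟨x, fun h => hxy (h.symm.trans hfx), by simpa using hxy⟩
      ⟨y, fun h => hxy (h.symm.trans hfy).symm, by simpa using hxy.symm⟩
    have h1' : dist z x < dist z y := h1
    exact lt_asymm h1' h2

/-- The symmetry in a point. -/
lemma exists_point_symmetry (M : Model κ X d) (m : X) :
    ∃ σ : X ≃ᵢ X, Function.Involutive σ ∧ σ m = m ∧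
      (∀ z, M.e (σ z) = (2 * br κ (M.e m) (M.e z)) • M.e m - M.e z) ∧
      ∀ z, (κ = 1 → dist z m ≤ Real.pi / 2) → IsMidpoint m z (σ z) := by
  have h0 : ∀ z z', κ = 0 → br κ (M.e m) (M.e z - M.e z') = 0 := fun z z' h => by
    rw [br_sub_right, M.br_zero h, M.br_zero h, sub_self]
  have : ∀ z, ∃ w, M.e w = (2 * br κ (M.e m) (M.e z)) • M.e m - M.e z := fun z => by
    apply M.exists_of_br_pos _ m
    · intro hk
      rw [br_sub_right, br_smul_right, M.q_eq, ← M.cs_dist]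
      have := M.curv.cs_pos (s := dist m z) dist_nonneg (by subst hk; norm_num)
      linarith
    · intro hk
      simp only [Prod.snd_sub, Prod.smul_snd, M.ht_one hk, M.br_zero hk, smul_eq_mul]
      norm_num
    · simp only [br_sub_left, br_sub_right, br_smul_left, br_smul_right, M.q_eq,
        br_comm (M.e z) (M.e m)]
      ring
  choose f hf using this
  have hiso : ∀ z z', dist (f z) (f z') = dist z z' := fun z z' => by
    rw [M.dist_eq_iff, M.vs_dist, M.vs_dist, hf, hf]
    have e1 : (2 * br κ (M.e m) (M.e z)) • M.e m - M.e z -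
        ((2 * br κ (M.e m) (M.e z')) • M.e m - M.e z') =
        (2 * br κ (M.e m) (M.e z - M.e z')) • M.e m - (M.e z - M.e z') := by
      rw [br_sub_right]; module
    rw [e1]
    rcases M.curv.sq_cases with h | h
    · rw [Bf_eq _ _ h, Bf_eq _ _ h]
      generalize M.e z - M.e z' = w
      simp only [br_sub_left, br_sub_right, br_smul_left, br_smul_right, M.q_eq,
        br_comm w (M.e m)]
      ring
    · rw [h0 z z' h, mul_zero, zero_smul, zero_sub, Bf_neg_left, Bf_neg_right, neg_neg]
  have hfm : f m = m := M.e_inj (by rw [hf, M.q_eq]; module)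
  have hinv : Function.Involutive f := fun z => M.e_inj (by
    rw [hf, hf, br_sub_right, br_smul_right, M.q_eq]; module)
  refine ⟨⟨hinv.toPerm f, Isometry.of_dist_eq hiso⟩, hinv, hfm, hf, fun z hz => ?_⟩
  have h1 : dist m (f z) = dist z m := by rw [← hfm, hiso, hfm, dist_comm]
  refine ⟨?_, h1.symm⟩
  change dist z m + dist m (f z) = dist z (f z)
  rw [h1, ← two_mul]
  apply M.curv.eq_of_vs_eq (by positivity) dist_nonneg _ (fun h => by linarith [hz h])
    (fun h => M.dist_le h _ _)
  rw [M.vs_dist, hf]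
  have e1 : M.e z - ((2 * br κ (M.e m) (M.e z)) • M.e m - M.e z) =
    (2 : ℝ) • (M.e z - br κ (M.e m) (M.e z) • M.e m) := by module
  have e2 : vs κ (2 * dist z m) = 2 * sn κ (dist z m) ^ 2 := by
    unfold vs; rw [mul_div_cancel_left₀ _ two_ne_zero]
  rw [e1, e2, Bf_smul_left, Bf_smul_right]
  rcases M.curv.sq_cases with h | h
  · rw [Bf_eq _ _ h]
    simp only [br_sub_left, br_sub_right, br_smul_left, br_smul_right, M.q_eq,
      br_comm (M.e z) (M.e m)]
    rw [← M.cs_dist, dist_comm m z]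
    linear_combination 2 * κ * M.curv.sq (dist z m) - 2 * sn κ (dist z m) ^ 2 * h
  · rw [M.br_zero h, one_smul]
    have h4 := M.vs_dist z m
    have h5 : vs κ (dist z m) = dist z m ^ 2 / 2 := by simp only [vs, h, sn_zero']; ring
    have h6 : sn κ (dist z m) = dist z m := by rw [h, sn_zero']
    rw [h6]; linarith

lemma point_symmetry_swap (M : Model κ X d) {m x y : X} (h : IsMidpoint m x y)
    {σ : X ≃ᵢ X} (hσ : ∀ z, M.e (σ z) = (2 * br κ (M.e m) (M.e z)) • M.e m - M.e z)
    (hD : κ = 1 → dist x y < Real.pi) : σ x = y := by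
  apply M.e_inj
  rw [hσ]
  have hE : dist x m + dist m y = dist x y := h.1
  have hE2 := h.2
  rcases (dist_nonneg (x := x) (y := y)).eq_or_lt with h1 | h1
  · have h2 : dist x m = 0 := by linarith
    have h3 : dist m y = 0 := by linarith
    rw [dist_eq_zero] at h2 h3; subst h2; subst h3
    rw [M.q_eq]; module
  · have hc := M.btw_combo h.1
    have hs : 0 < sn κ (dist x m) := M.curv.sn_pos (by linarith) (fun h => by linarith [hD h])
    have h2 := M.curv.sn_add (dist x m) (dist x m)
    have h3 : dist x y = dist x m + dist x m := by linarith
    rw [h3, ← hE2, h2] at hc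
    rw [← M.cs_dist, dist_comm m x]
    apply smul_right_injective _ hs.ne'
    simp only [smul_sub, smul_smul]
    rw [sub_eq_iff_eq_add', ← hc]
    module

lemma exists_midpoint (M : Model κ X d)
    {x y : X} (hD : κ = 1 → dist x y < Real.pi) : ∃ m, IsMidpoint m x y := by
  by_cases hxy : x = y
  · subst hxy; exact ⟨x, by simp [Btw], rfl⟩
  obtain ⟨γ, h0, h1, h2, -⟩ := M.exists_geodesic hxy hD
  have hp : 0 ≤ dist x y := dist_nonneg
  have e1 : dist x (γ (dist x y / 2)) = dist x y / 2 := by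
    nth_rw 1 [← h0]
    rw [h2, abs_of_nonpos] <;> first | linarith | skip
    intro h; rw [abs_of_nonpos] <;> linarith [hD h, Real.pi_pos]
  have e2 : dist (γ (dist x y / 2)) y = dist x y / 2 := by
    nth_rw 2 [← h1]
    rw [h2, abs_of_nonpos] <;> first | linarith | skip
    intro h; rw [abs_of_nonpos] <;> linarith [hD h, Real.pi_pos]
  exact ⟨γ (dist x y / 2), by unfold Btw; linarith, by linarith⟩

lemma exists_origin (M : Model κ X d) : ∃ o : X, ∀ z, cs κ (dist o z) = (M.e z).2 := by
  obtain ⟨o, ho⟩ := M.surj (0, 1) (by simp [br]) (fun _ => by norm_num)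
  exact ⟨o, fun z => by rw [M.cs_dist, ho]; simp [br]⟩

lemma norm_sub_sq (M : Model κ X d) (x y : X) : ‖(M.e x).1 - (M.e y).1‖ ^ 2 =
    2 * vs κ (dist x y) - κ * ((M.e x).2 - (M.e y).2) ^ 2 := by
  rw [M.vs_dist]
  simp only [Bf, Prod.fst_sub, Prod.snd_sub, real_inner_self_eq_norm_sq]
  ring

lemma continuous_e (M : Model κ X d) : Continuous M.e := by
  obtain ⟨o, ho⟩ := M.exists_origin
  have h2 : Continuous fun z => (M.e z).2 := by
    simp_rw [← ho]
    exact M.curv.continuous_cs.comp (continuous_const.dist continuous_id)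
  refine Continuous.prodMk ?_ h2
  rw [continuous_iff_continuousAt]
  intro x
  rw [ContinuousAt, tendsto_iff_norm_sub_tendsto_zero]
  have h3 : Continuous fun z => √(2 * vs κ (dist z x) - κ * ((M.e z).2 - (M.e x).2) ^ 2) := by
    have := M.curv.continuous_vs.comp (continuous_id.dist (continuous_const (y := x)))
    exact ((continuous_const.mul this).sub (continuous_const.mul
      ((h2.sub continuous_const).pow 2))).sqrt
  have h4 := h3.tendsto x
  simp only [dist_self, M.curv.vs_at_zero, sub_self] at h4
  simp only [← M.norm_sub_sq] at h4
  simpa [Real.sqrt_sq (norm_nonneg _)] using h4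

lemma dist_sq_le (M : Model κ X d) (x y : X) : dist x y ^ 2 ≤ 5 * dist (M.e x) (M.e y) ^ 2 := by
  have h1 := M.curv.sq_le_vs (dist_nonneg (x := x) (y := y)) (fun h => M.dist_le h _ _)
  have h2 := M.norm_sub_sq x y
  have h3 : ‖(M.e x).1 - (M.e y).1‖ ≤ dist (M.e x) (M.e y) := by
    rw [← dist_eq_norm]; exact le_max_left _ _
  have h4 : |(M.e x).2 - (M.e y).2| ≤ dist (M.e x) (M.e y) := by
    rw [← Real.dist_eq]; exact le_max_right _ _
  have h5 := pow_le_pow_left₀ (norm_nonneg _) h3 2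
  have h6 := pow_le_pow_left₀ (abs_nonneg _) h4 2
  rw [sq_abs] at h6
  have h7 : κ ≤ 1 := by rcases M.curv with rfl | rfl | rfl <;> norm_num
  nlinarith [sq_nonneg ((M.e x).2 - (M.e y).2)]

lemma isInducing_e (M : Model κ X d) : Topology.IsInducing M.e := by
  rw [Topology.isInducing_iff_nhds]
  intro x
  apply le_antisymm
  · exact (M.continuous_e.tendsto x).le_comap
  · intro s hs
    obtain ⟨ε, hε, hs⟩ := Metric.mem_nhds_iff.1 hs
    refine ⟨ball (M.e x) (ε / 3), ball_mem_nhds _ (by positivity), fun z hz => hs ?_⟩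
    have h1 : dist (M.e z) (M.e x) < ε / 3 := hz
    rw [mem_ball]
    have := M.dist_sq_le z x
    nlinarith [dist_nonneg (x := z) (y := x), dist_nonneg (x := M.e z) (y := M.e x)]

lemma _root_.BallChar.continuous_br_self : Continuous fun y : Amb d => br κ y y := by
  unfold br; fun_prop

lemma range_e (M : Model κ X d) : Set.range M.e = {y | br κ y y = 1 ∧ (κ ≠ 1 → 0 ≤ y.2)} := by
  ext y
  constructor
  · rintro ⟨x, rfl⟩
    exact ⟨M.q_eq x, fun h => (M.ht_pos h x).le⟩
  · rintro ⟨h1, h2⟩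
    refine M.surj y h1 fun h => (h2 h).lt_of_ne fun h0 => ?_
    rw [br, ← h0, real_inner_self_eq_norm_sq] at h1
    have : κ ≤ 0 := by
      rcases M.curv with rfl | rfl | rfl
      · exact absurd rfl h
      all_goals norm_num
    nlinarith [sq_nonneg ‖y.1‖]

lemma isClosedEmbedding_e (M : Model κ X d) : Topology.IsClosedEmbedding M.e := by
  refine ⟨⟨M.isInducing_e, fun x y h => M.e_inj h⟩, ?_⟩
  rw [M.range_e]
  apply IsClosed.and
  · exact isClosed_eq continuous_br_self continuous_const
  · by_cases h : κ = 1
    · simp [h]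
    · simpa [h] using isClosed_le continuous_const continuous_snd

lemma isCompact_closedBall (M : Model κ X d) (c : X) (r : ℝ) : IsCompact (closedBall c r) := by
  obtain ⟨o, ho⟩ := M.exists_origin
  set I := Icc 0 (dist o c + r)
  have hI : IsCompact I := isCompact_Icc
  obtain ⟨C, hC⟩ := (hI.image M.curv.continuous_cs).isBounded.exists_norm_le
  obtain ⟨S, hS⟩ := (hI.image M.curv.continuous_vs).isBounded.exists_norm_le
  have hcl : closedBall c r ⊆ M.e ⁻¹' closedBall 0 (max (2 * S + (C + |(M.e o).2|) ^ 2 + 1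
      + ‖(M.e o).1‖) C) := by
    intro z hz
    have hz1 : dist o z ∈ I := ⟨dist_nonneg, by
      linarith [dist_triangle o c z, mem_closedBall'.1 hz]⟩
    have h1 := hC _ ⟨_, hz1, rfl⟩
    have h2 := hS _ ⟨_, hz1, rfl⟩
    rw [ho, Real.norm_eq_abs] at h1
    have h2 := (Real.norm_eq_abs _ ▸ le_abs_self (vs κ (dist o z))).trans h2
    have h3 := M.norm_sub_sq z o
    rw [dist_comm] at h3
    have h4 : |(M.e z).2 - (M.e o).2| ≤ C + |(M.e o).2| :=
      (abs_sub _ _).trans (by linarith)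
    have h5 : ((M.e z).2 - (M.e o).2) ^ 2 ≤ (C + |(M.e o).2|) ^ 2 := by
      rw [← sq_abs ((M.e z).2 - (M.e o).2)]; exact pow_le_pow_left₀ (abs_nonneg _) h4 2
    have h7 : -1 ≤ κ := by rcases M.curv with rfl | rfl | rfl <;> norm_num
    have h8 : ‖(M.e z).1 - (M.e o).1‖ ≤ 2 * S + (C + |(M.e o).2|) ^ 2 + 1 := by
      nlinarith [sq_nonneg (‖(M.e z).1 - (M.e o).1‖ - 1), sq_nonneg ((M.e z).2 - (M.e o).2)]
    rw [mem_preimage, mem_closedBall_zero_iff]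
    apply max_le_max
    · have := norm_add_le ((M.e z).1 - (M.e o).1) (M.e o).1
      rw [sub_add_cancel] at this
      linarith
    · exact h1
  exact (M.isClosedEmbedding_e.isCompact_preimage
    (ProperSpace.isCompact_closedBall 0 _)).of_isClosed_subset
    isClosed_closedBall hcl

/-- Radial projection to the model. -/
lemma exists_normalization (M : Model κ X d) (x₀ : X) : ∃ nrm : Amb d → X,
    (∀ y : Amb d, 0 < br κ y y → (κ ≠ 1 → 0 < y.2) → y = √(br κ y y) • M.e (nrm y)) ∧
    ∀ z, M.e (nrm (M.e z)) = M.e z ∧ ContinuousAt nrm (M.e z) := by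
  have : ∀ y : Amb d, ∃ x, 0 < br κ y y → (κ ≠ 1 → 0 < y.2) →
      M.e x = (√(br κ y y))⁻¹ • y := fun y => by
    by_cases h : 0 < br κ y y ∧ (κ ≠ 1 → 0 < y.2)
    · obtain ⟨h1, h2⟩ := h
      have h3 := Real.sqrt_pos.2 h1
      obtain ⟨x, hx⟩ := M.surj ((√(br κ y y))⁻¹ • y) (by
          rw [br_smul_left, br_smul_right, ← mul_assoc, ← mul_inv, Real.mul_self_sqrt h1.le,
            inv_mul_cancel₀ h1.ne'])
        (fun h => by
          have := h2 h
          simp only [Prod.smul_snd, smul_eq_mul]; positivity)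
      exact ⟨x, fun _ _ => hx⟩
    · exact ⟨x₀, fun h1 h2 => absurd ⟨h1, h2⟩ h⟩
  choose nrm hn using this
  refine ⟨nrm, fun y h1 h2 => ?_, fun z => ⟨?_, ?_⟩⟩
  · rw [hn y h1 h2, smul_inv_smul₀ (Real.sqrt_pos.2 h1).ne']
  · rw [hn _ (by rw [M.q_eq]; norm_num) (fun h => M.ht_pos h z), M.q_eq]; simp
  · rw [M.isInducing_e.continuousAt_iff]
    have h1 : ∀ᶠ y in nhds (M.e z), 0 < br κ y y :=
      continuous_br_self.continuousAt.eventually (lt_mem_nhds (by simp [M.q_eq]))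
    have h2 : ∀ᶠ y in nhds (M.e z), κ ≠ 1 → 0 < y.2 := by
      by_cases h : κ = 1
      · simp [h]
      · filter_upwards [continuous_snd.continuousAt.eventually (lt_mem_nhds (M.ht_pos h z))]
          with y hy _ using hy
    have h3 : (fun y => (√(br κ y y))⁻¹ • y) =ᶠ[nhds (M.e z)] M.e ∘ nrm := by
      filter_upwards [h1, h2] with y hy1 hy2 using (hn y hy1 hy2).symm
    refine ContinuousAt.congr ?_ h3
    exact (continuous_br_self.sqrt.continuousAt.inv₀ (by simp [M.q_eq])).smul continuousAt_id

/-- A nonnegative combination of two points is proportional to a point between them. -/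
lemma exists_btw_of_combo (M : Model κ X d)
    {x y : X} (hD : κ = 1 → dist x y < Real.pi) {α β : ℝ} (hα : 0 ≤ α)
    (hβ : 0 ≤ β) (h : 0 < α + β) : ∃ (z : X) (c : ℝ), 0 < c ∧ Btw x z y ∧
      α • M.e x + β • M.e y = c • M.e z ∧ (x ≠ y → 0 < α → z ≠ y) ∧ (x ≠ y → 0 < β → z ≠ x) := by
  by_cases hxy : x = y
  · subst hxy
    exact ⟨x, α + β, h, by simp [Btw], by rw [add_smul], by simp, by simp⟩
  obtain ⟨γ, h0, h1, h2, h3⟩ := M.exists_geodesic hxy hD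
  have hp : 0 < dist x y := dist_pos.2 hxy
  set D := dist x y with hDd
  have hs := M.curv.sn_pos hp hD
  have hcont : Continuous fun s => α * sn κ s - β * sn κ (D - s) := by
    have := M.curv.continuous_sn
    fun_prop
  obtain ⟨s, ⟨hs0, hs1⟩, hss⟩ := intermediate_value_Icc hp.le hcont.continuousOn
    (show (0 : ℝ) ∈ _ by
      simp only [sub_zero, sub_self, M.curv.sn_at_zero]
      constructor <;> nlinarith)
  simp only at hss
  have n1 : 0 ≤ sn κ s := M.curv.sn_nonneg hs0 (fun h => by linarith [hD h])
  have n2 : 0 ≤ sn κ (D - s) := M.curv.sn_nonneg (by linarith) (fun h => by linarith [hD h])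
  have e1 : dist x (γ s) = s := by
    nth_rw 1 [← h0]
    rw [h2, abs_of_nonpos] <;> first | linarith | skip
    intro h; rw [abs_of_nonpos] <;> linarith [hD h]
  have e2 : dist (γ s) y = D - s := by
    nth_rw 1 [← h1]
    rw [h2, abs_of_nonpos] <;> first | linarith | skip
    intro h; rw [abs_of_nonpos] <;> linarith [hD h]
  have hsum : 0 < sn κ s + sn κ (D - s) := by
    rcases hs0.eq_or_lt with h4 | h4
    · rw [← h4, sub_zero, M.curv.sn_at_zero]; linarith
    · have := M.curv.sn_pos h4 (fun h => by linarith [hD h]); linarith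
  refine ⟨γ s, (α + β) * sn κ D / (sn κ s + sn κ (D - s)), by positivity, ?_, ?_, ?_, ?_⟩
  · unfold Btw; rw [e1, e2, ← hDd]; ring
  · apply smul_right_injective _ hsum.ne'
    simp only [smul_smul]
    rw [mul_div_cancel₀ _ hsum.ne', mul_smul, h3, smul_add, smul_add]
    simp only [smul_smul]
    congr 2
    · linear_combination hss
    · linear_combination -hss
  · intro _ ha he
    rw [he, dist_self] at e2
    rw [← e2, M.curv.sn_at_zero, show s = D by linarith] at hss
    nlinarith
  · intro _ ha he
    rw [he, dist_self] at e1
    rw [← e1, M.curv.sn_at_zero, sub_zero] at hss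
    nlinarith

/-- Normalized power functions are linear up to a universal summand. -/
lemma phi_linear (M : Model κ X d) (c : X) {P : ℝ} (hP : 0 < cs κ P) : ∃ G : Amb d →ₗ[ℝ] ℝ,
    ∀ z, phi κ c P z = G (M.e z) + (κ + (1 - κ * κ) * (‖(M.e z).1‖ ^ 2 / 2)) := by
  let A : Amb d →ₗ[ℝ] ℝ :=
    { toFun := fun y => Bf κ (M.e c) y
      map_add' := fun y y' => Bf_add_right y y' _
      map_smul' := fun a y => Bf_smul_right y _ a }
  refine ⟨(-(cs κ P)⁻¹) • A + ((1 - κ * κ) * (‖(M.e c).1‖ ^ 2 - P ^ 2) / 2) • LinearMap.snd ℝ _ _,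
    fun z => ?_⟩
  change (vs κ (dist c z) - vs κ P) / cs κ P = (-(cs κ P)⁻¹) * Bf κ (M.e c) (M.e z) +
    ((1 - κ * κ) * (‖(M.e c).1‖ ^ 2 - P ^ 2) / 2) * (M.e z).2 + _
  rcases M.curv.sq_cases with h | h
  · have h1 := M.curv.mul_vs (dist c z)
    have h2 := M.curv.mul_vs P
    have h3 : vs κ (dist c z) - vs κ P = κ * cs κ P - κ * cs κ (dist c z) := by
      linear_combination κ * h1 - κ * h2 - (vs κ (dist c z) - vs κ P) * h
    rw [Bf_eq _ _ h, ← M.cs_dist, h, h3]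
    field_simp
    ring
  · have h1 : cs κ P = 1 := by rw [h, cs_zero']
    have h2 : vs κ P = P ^ 2 / 2 := by simp only [vs, h, sn_zero']; ring
    have h3 := M.vs_dist c z
    simp only [Bf, Prod.fst_sub, Prod.snd_sub, M.ht_one h, real_inner_self_eq_norm_sq,
      norm_sub_sq_real] at h3
    rw [h1, h2, h3, M.ht_one h]
    unfold Bf
    rw [M.ht_one h, M.ht_one h]
    clear h1 h2 h3
    subst h
    ring

lemma exists_unit_tangent (M : Model κ X d)
    {a : X} {r : Amb d} (h : br κ (M.e a) r = 0) (hr : r ≠ 0) :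
    ∃ c : ℝ, 0 < c ∧ Bf κ (c • r) (c • r) = 1 := by
  have h1 : 0 < Bf κ r r := by
    by_contra hc
    exact hr (M.eq_zero_of_tangent (z := a) (by rw [br_comm]; exact h) (not_lt.1 hc))
  refine ⟨(√(Bf κ r r))⁻¹, by positivity, ?_⟩
  rw [Bf_smul_left, Bf_smul_right, ← mul_assoc, ← mul_inv, Real.mul_self_sqrt h1.le,
    inv_mul_cancel₀ h1.ne']

lemma exists_two_equidistant (M : Model κ X d) (hd : 2 ≤ d) (a b : X) {t : ℝ} (ht : 0 < t)
    (ht1 : κ = 1 → t ≤ Real.pi / 2) : ∃ z z', z ≠ z' ∧ dist a z = t ∧ dist a z' = t ∧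
      dist z b = dist z' b := by
  let A : Amb d →ₗ[ℝ] ℝ × ℝ :=
    { toFun := fun y => (br κ (M.e a) y, Bf κ (M.e a - M.e b) y)
      map_add' := fun y y' => by simp [br_add_right, Bf_add_right]
      map_smul' := fun c y => by simp [br_smul_right, Bf_smul_right] }
  have hker : LinearMap.ker A ≠ ⊥ := LinearMap.ker_ne_bot_of_finrank_lt (by simp; omega)
  obtain ⟨r, hr, hr0⟩ := Submodule.exists_mem_ne_zero_of_ne_bot hker
  have hr' : (br κ (M.e a) r, Bf κ (M.e a - M.e b) r) = (0, 0) := hr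
  obtain ⟨h1, h2⟩ := Prod.mk.inj hr'
  obtain ⟨c, hc, hc1⟩ := M.exists_unit_tangent h1 hr0
  have h1' : br κ (M.e a) (c • r) = 0 := by rw [br_smul_right, h1, mul_zero]
  have h2' : Bf κ (M.e a - M.e b) (c • r) = 0 := by rw [Bf_smul_right, h2, mul_zero]
  set u := c • r
  obtain ⟨γ, hγ⟩ := M.exists_exp a h1' hc1
  have hγ0 : γ 0 = a := M.e_inj (by rw [hγ, M.curv.cs_at_zero, M.curv.sn_at_zero]; simp)
  have hd := fun s t => M.dist_exp h1' hc1 hγ (s := s) (t := t)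
  refine ⟨γ t, γ (-t), ?_, ?_, ?_, ?_⟩
  · rw [← dist_pos, hd, abs_of_pos] <;> first | linarith | skip
    intro h; rw [abs_of_pos] <;> linarith [ht1 h]
  · rw [← hγ0, hd, abs_of_neg] <;> first | linarith | skip
    intro h; rw [abs_of_neg] <;> linarith [ht1 h, Real.pi_pos]
  · rw [← hγ0, hd, abs_of_pos] <;> first | linarith | skip
    intro h; rw [abs_of_pos] <;> linarith [ht1 h, Real.pi_pos]
  · rw [M.dist_eq_iff, M.vs_dist, M.vs_dist, hγ, hγ, M.curv.cs_neg, M.curv.sn_neg]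
    have e1 : Bf κ (cs κ t • M.e a - M.e b) u = 0 := by
      rcases M.curv.sq_cases with h | h
      · rw [Bf_sub_left, Bf_eq _ _ h, br_comm, br_comm, h1'] at h2'
        rw [Bf_sub_left, Bf_smul_left, Bf_eq _ _ h, h1']
        linarith
      · rw [show cs κ t = 1 by rw [h, cs_zero'], one_smul, h2']
    have e2 : cs κ t • M.e a + sn κ t • u - M.e b = cs κ t • M.e a - M.e b + sn κ t • u := by abel
    have e3 : cs κ t • M.e a + -sn κ t • u - M.e b =
      cs κ t • M.e a - M.e b + (-sn κ t) • u := by abel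
    rw [e2, e3]
    simp only [Bf_add_left, Bf_add_right, Bf_smul_left, Bf_smul_right,
      Bf_comm u (cs κ t • M.e a - M.e b)]
    rw [e1]; ring

lemma exists_off_plane (M : Model κ X d)
    (hd : 2 ≤ d) {K : Set X} (hK : (interior K).Nonempty) (v v' : Amb d) :
    ∃ F : Amb d →ₗ[ℝ] ℝ, F v = 0 ∧ F v' = 0 ∧ ∃ k ∈ K, F (M.e k) ≠ 0 := by
  have hlt : Submodule.span ℝ ({v, v'} : Set (Amb d)) < ⊤ := by
    apply lt_top_iff_ne_top.2
    intro h
    classical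
    have h1 := finrank_span_finset_le_card (R := ℝ) ({v, v'} : Finset (Amb d))
    have h2 : ({v, v'} : Finset (Amb d)).card ≤ 2 := Finset.card_le_two
    rw [show (({v, v'} : Finset (Amb d)) : Set (Amb d)) = {v, v'} by simp, Set.finrank, h,
      finrank_top] at h1
    simp at h1
    omega
  obtain ⟨F, hF, hFk⟩ := Submodule.exists_le_ker_of_lt_top _ hlt
  have hv : F v = 0 := hFk (Submodule.subset_span (by simp))
  have hv' : F v' = 0 := hFk (Submodule.subset_span (by simp))
  refine ⟨F, hv, hv', ?_⟩
  obtain ⟨k, hk⟩ := hK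
  by_cases h0 : F (M.e k) = 0
  · obtain ⟨y, hy⟩ : ∃ y, F y ≠ 0 := by
      by_contra hc; push Not at hc; exact hF (LinearMap.ext hc)
    set r := y - br κ (M.e k) y • M.e k with hr
    have h1 : br κ (M.e k) r = 0 := by rw [hr, br_sub_right, br_smul_right, M.q_eq]; ring
    have h2 : F r ≠ 0 := by rw [hr, map_sub, map_smul, h0]; simpa using hy
    obtain ⟨c, hc, hc1⟩ := M.exists_unit_tangent h1 (by rintro h; rw [h] at h2; simp at h2)
    obtain ⟨γ, hγ⟩ := M.exists_exp k (u := c • r) (by rw [br_smul_right, h1, mul_zero]) hc1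
    have hγ0 : γ 0 = k := M.e_inj (by rw [hγ, M.curv.cs_at_zero, M.curv.sn_at_zero]; simp)
    have hd := fun s t => M.dist_exp (by rw [br_smul_right, h1, mul_zero]) hc1 hγ (s := s) (t := t)
    obtain ⟨ε, hε, hb⟩ := Metric.mem_nhds_iff.1 (mem_interior_iff_mem_nhds.1 hk)
    have hm : 0 < min (ε / 2) 1 := by positivity
    have hpi := Real.pi_gt_three
    refine ⟨γ (min (ε / 2) 1), hb ?_, ?_⟩
    · rw [mem_ball, ← hγ0, hd, sub_zero, abs_of_pos hm]
      · linarith [min_le_left (ε / 2) 1]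
      · intro _; rw [sub_zero, abs_of_pos hm]; linarith [min_le_right (ε / 2) 1]
    · rw [hγ, map_add, map_smul, map_smul, map_smul, h0]
      have := M.curv.sn_pos hm (fun _ => by linarith [min_le_right (ε / 2) 1])
      simp only [smul_eq_mul, mul_zero, zero_add]
      exact mul_ne_zero this.ne' (mul_ne_zero hc.ne' h2)
  · exact ⟨k, interior_subset hk, h0⟩

lemma exists_seg (M : Model κ X d) {x y : X} (hD : κ = 1 → dist x y < Real.pi) : ∃ γ : ℝ → X,
    γ 0 = x ∧ γ (dist x y) = y ∧
    (∀ s ∈ Icc 0 (dist x y), ∀ t ∈ Icc 0 (dist x y), dist (γ s) (γ t) = |s - t|) ∧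
    (∀ s ∈ Icc 0 (dist x y), dist x (γ s) = s ∧ dist (γ s) y = dist x y - s ∧ Btw x (γ s) y) ∧
    ContinuousOn γ (Icc 0 (dist x y)) := by
  have key : ∃ γ : ℝ → X, γ 0 = x ∧ γ (dist x y) = y ∧
      ∀ s ∈ Icc 0 (dist x y), ∀ t ∈ Icc 0 (dist x y), dist (γ s) (γ t) = |s - t| := by
    by_cases hxy : x = y
    · subst hxy
      refine ⟨fun _ => x, rfl, rfl, fun s hs t ht => ?_⟩
      simp only [dist_self, Icc_self, mem_singleton_iff] at hs ht
      simp [hs, ht]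
    · obtain ⟨γ, h0, h1, h2, -⟩ := M.exists_geodesic hxy hD
      refine ⟨γ, h0, h1, fun s hs t ht => h2 s t fun h => ?_⟩
      rw [abs_le]
      constructor <;> linarith [hD h, hs.1, hs.2, ht.1, ht.2]
  obtain ⟨γ, h0, h1, h2⟩ := key
  refine ⟨γ, h0, h1, h2, fun s hs => ?_, ?_⟩
  · have a1 : dist x (γ s) = s := by
      have := h2 0 ⟨le_rfl, dist_nonneg⟩ s hs
      rwa [h0, zero_sub, abs_neg, abs_of_nonneg hs.1] at this
    have a2 : dist (γ s) y = dist x y - s := by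
      have := h2 s hs _ ⟨dist_nonneg, le_rfl⟩
      rwa [h1, abs_of_nonpos (by linarith [hs.2]), neg_sub] at this
    exact ⟨a1, a2, by unfold Btw; rw [a1, a2]; ring⟩
  · refine LipschitzOnWith.continuousOn (K := 1)
      (LipschitzOnWith.of_dist_le_mul fun s hs t ht => ?_)
    rw [h2 s hs t ht, Real.dist_eq]; simp

/-- A segment from a point of a closed set to a point outside it meets the boundary. -/
lemma exists_exit (M : Model κ X d)
    {K : Set X} (hK : IsClosed K) {a b : X} (hD : κ = 1 → dist a b < Real.pi)
    (ha : a ∈ K) (hb : b ∉ K) : ∃ z ∈ frontier K, Btw a z b := by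
  obtain ⟨γ, h0, h1, -, h3, h4⟩ := M.exists_seg hD
  have hpc : IsPreconnected (γ '' Icc 0 (dist a b)) := isPreconnected_Icc.image _ h4
  by_contra hc
  push Not at hc
  have hsub : γ '' Icc 0 (dist a b) ⊆ interior K ∪ Kᶜ := by
    rintro _ ⟨s, hs, rfl⟩
    by_cases h : γ s ∈ K
    · left
      by_contra hi
      exact hc _ (by rw [hK.frontier_eq]; exact ⟨h, hi⟩) (h3 s hs).2.2
    · exact Or.inr h
  have ha' : a ∈ γ '' Icc 0 (dist a b) := ⟨0, ⟨le_rfl, dist_nonneg⟩, h0⟩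
  have hb' : b ∈ γ '' Icc 0 (dist a b) := ⟨_, ⟨dist_nonneg, le_rfl⟩, h1⟩
  obtain ⟨z, -, hz1, hz2⟩ := hpc _ _ isOpen_interior hK.isOpen_compl hsub
    ⟨a, ha', (hsub ha').resolve_right fun h => h ha⟩ ⟨b, hb', hb⟩
  exact hz2 (interior_subset hz1)

/-- A boundary point with a local supporting ball is not strictly between points of `K`. -/
lemma not_strictly_between (M : Model κ X d) {K : Set X} (hK : GConvex K) {x y w c : X} {P η : ℝ}
    (hD : κ = 1 → dist x y < Real.pi) (hx : x ∈ K) (hy : y ∈ K) (h : Btw x w y) (hwx : w ≠ x)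
    (hwy : w ≠ y) (hη : 0 < η) (hP : κ = 1 → P < Real.pi / 2) (hc : dist c w = P)
    (hloc : ∀ k ∈ K, dist k w ≤ η → dist c k ≤ P) : False := by
  obtain ⟨γ, -, -, h2, h3, -⟩ := M.exists_seg hD
  set s := dist x w with hs
  have hb : dist x w + dist w y = dist x y := h
  have hs0 : 0 < s := dist_pos.2 hwx.symm
  have hs1 : 0 < dist w y := dist_pos.2 hwy
  have hsI : s ∈ Icc 0 (dist x y) := ⟨hs0.le, by linarith⟩
  have hw : γ s = w := M.btw_unique hD (h3 s hsI).2.2 h (h3 s hsI).1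
  set t := min (min s (dist w y)) η
  have ht : 0 < t := by positivity
  have ht1 : t ≤ s := (min_le_left _ _).trans (min_le_left _ _)
  have ht2 : t ≤ dist w y := (min_le_left _ _).trans (min_le_right _ _)
  have ht3 : t ≤ η := min_le_right _ _
  have hm : s - t ∈ Icc 0 (dist x y) := ⟨by linarith, by linarith⟩
  have hp : s + t ∈ Icc 0 (dist x y) := ⟨by linarith, by linarith⟩
  have d1 : dist (γ (s - t)) w = t := by
    rw [← hw, h2 _ hm _ hsI, show s - t - s = -t by ring, abs_neg, abs_of_pos ht]
  have d2 : dist (γ (s + t)) w = t := by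
    rw [← hw, h2 _ hp _ hsI, show s + t - s = t by ring, abs_of_pos ht]
  have d3 : dist (γ (s - t)) (γ (s + t)) = 2 * t := by
    rw [h2 _ hm _ hp, show s - t - (s + t) = -(2 * t) by ring, abs_neg, abs_of_pos (by linarith)]
  have := M.ball_strict (c := c) (x := γ (s - t)) (y := γ (s + t)) (z := w)
    (by rw [← hc]; exact dist_nonneg) hP
    (hloc _ (hK x hx y hy _ (M.uniqueBtwPt hD (h3 _ hm).2.2)) (by linarith))
    (hloc _ (hK x hx y hy _ (M.uniqueBtwPt hD (h3 _ hp).2.2)) (by linarith))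
    (by unfold Btw; rw [d1, dist_comm, d2, d3]; ring)
    (by rintro h; rw [← h, dist_self] at d1; linarith)
    (by rintro h; rw [← h, dist_self] at d2; linarith)
  linarith

lemma eq_of_smul_eq (M : Model κ X d) {x y : X} {a b : ℝ} (ha : 0 < a) (hb : 0 < b)
    (h : a • M.e x = b • M.e y) : a = b ∧ x = y := by
  have h1 : br κ (a • M.e x) (a • M.e x) = br κ (b • M.e y) (b • M.e y) := by rw [h]
  simp only [br_smul_left, br_smul_right, M.q_eq] at h1
  have h2 : a = b := by nlinarith
  refine ⟨h2, M.e_inj ?_⟩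
  rw [h2] at h
  exact smul_right_injective _ hb.ne' h

/-- The cone over `K` in the ambient space. -/
def cone (M : Model κ X d) (K : Set X) : Set (Amb d) :=
  {y | ∃ z ∈ K, ∃ c : ℝ, 0 < c ∧ y = c • M.e z}

lemma cone_combo (M : Model κ X d) {K : Set X} (hK : GConvex K)
    (hKd : κ = 1 → ∀ x ∈ K, ∀ y ∈ K, dist x y < Real.pi) {u v : Amb d} (hu : u ∈ M.cone K)
    (hv : v ∈ M.cone K) {a b : ℝ} (ha : 0 ≤ a) (hb : 0 ≤ b) (hab : 0 < a + b) :
    a • u + b • v ∈ M.cone K := by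
  obtain ⟨x, hx, c, hc, rfl⟩ := hu
  obtain ⟨y, hy, c', hc', rfl⟩ := hv
  have hD : κ = 1 → dist x y < Real.pi := fun h => hKd h x hx y hy
  have hpos : 0 < a * c + b * c' := by
    rcases ha.eq_or_lt with h | h
    · have : 0 < b := by linarith
      positivity
    · positivity
  obtain ⟨z, q, hq, hz, he, -⟩ := M.exists_btw_of_combo hD (α := a * c) (β := b * c')
    (by positivity) (by positivity) hpos
  exact ⟨z, hK x hx y hy z (M.uniqueBtwPt hD hz), q, hq, by rw [smul_smul, smul_smul, he]⟩

lemma dist_le_of_combo (M : Model κ X d)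
    {p v w : X} {g μ : ℝ} (hD : κ = 1 → dist p w < Real.pi) (hg : 0 ≤ g)
    (hμ : 0 < μ) (h : M.e w + g • M.e p = μ • M.e v) : dist p v ≤ dist p w := by
  obtain ⟨z, c, hc, hz, he, -⟩ := M.exists_btw_of_combo (x := w) (y := p)
    (by rwa [dist_comm]) (α := 1) zero_le_one hg (by linarith)
  rw [one_smul, h] at he
  obtain ⟨-, rfl⟩ := M.eq_of_smul_eq hμ hc he
  have : dist w v + dist v p = dist w p := hz
  rw [dist_comm p v, dist_comm p w]
  linarith [dist_nonneg (x := w) (y := v)]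

lemma not_neg_smul (M : Model κ X d) {p w : X} {g : ℝ} (hc : 0 < cs κ (dist p w)) (hg : 0 ≤ g) :
    M.e w ≠ -(g • M.e p) := by
  intro h
  rw [M.cs_dist, h, br_neg_right, br_smul_right, M.q_eq] at hc
  linarith

/-- One side of the pencil argument: near `w`, the points of the pencil stay in `K`. -/
lemma pencil_side (M : Model κ X d) {K : Set X} (hKcl : IsClosed K) (hK : GConvex K)
    (hKd : κ = 1 → ∀ x ∈ K, ∀ y ∈ K, dist x y < Real.pi)
    {x v w p zt : X} (hx : x ∈ K) (hv : v ∈ K) (hw : w ∈ K) {lam mu g np k t η ct : ℝ}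
    (hlam : 0 < lam) (hmu : 0 < mu) (hg : 0 < g)
    (hew : M.e w = lam • M.e x + mu • M.e v - g • M.e p)
    {N : Amb d →ₗ[ℝ] ℝ} (hNp : 0 < np) (hNpe : N (M.e p) = np)
    (hN : ∀ z ∈ frontier K, dist z w ≤ η → (∃ a b q : ℝ, 0 ≤ a ∧ 0 ≤ b ∧ 0 ≤ q ∧
      M.e z = a • M.e x + b • M.e v - q • M.e p) → N (M.e z) ≤ 0)
    (ht : |t| < 1) (hgt : 0 < g + t * k) (hct : 0 < ct)
    (hat : ((1 + t) * lam) • M.e x + ((1 - t) * mu) • M.e v - (g + t * k) • M.e p = ct • M.e zt)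
    (hNa : N (M.e zt) = 0) (hzt : dist zt w < η / 3)
    (hzb : ∀ z (q : ℝ), 0 < q → (1 - |t|) • M.e w + ((|t| + t) * lam) • M.e x +
      ((|t| - t) * mu) • M.e v = q • M.e z → dist z w < η / 3) (hηpi : η ≤ 3) : zt ∈ K := by
  by_contra hnt
  have hcone : ∀ y ∈ K, M.e y ∈ M.cone K := fun y hy => ⟨y, hy, 1, one_pos, (one_smul _ _).symm⟩
  have ht1 := neg_abs_le t
  have ht2 := le_abs_self t
  set C := ((1 + t) * lam) • M.e x + ((1 - t) * mu) • M.e v with hC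
  have ha1 : 0 < 1 + t := by linarith
  have ha2 : 0 < 1 - t := by linarith
  have hCc : C ∈ M.cone K := M.cone_combo hK hKd (hcone x hx) (hcone v hv) (by positivity)
    (by positivity) (by positivity)
  set b := (1 - |t|) • M.e w + ((|t| + t) * lam) • M.e x + ((|t| - t) * mu) • M.e v with hb
  have hbc : b ∈ M.cone K := by
    have h1 := M.cone_combo hK hKd (hcone w hw) (hcone x hx) (a := 1 - |t|) (b := (|t| + t) * lam)
      (by linarith) (mul_nonneg (by linarith) hlam.le) (by nlinarith)
    have h2 := M.cone_combo hK hKd h1 (hcone v hv) (a := 1) (b := (|t| - t) * mu)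
      zero_le_one (mul_nonneg (by linarith) hmu.le) (by nlinarith)
    rwa [one_smul] at h2
  have hbC : b = C - ((1 - |t|) * g) • M.e p := by
    rw [hb, hC, hew]; module
  set gb := (1 - |t|) * g with hgb
  have hgb0 : 0 < gb := mul_pos (by linarith) hg
  by_cases hcase : g + t * k ≤ gb
  · have h1 : ct • M.e zt = ((g + t * k) / gb) • b + (1 - (g + t * k) / gb) • C := by
      rw [← hat, hbC]
      have : ((g + t * k) / gb) * gb = g + t * k := div_mul_cancel₀ _ hgb0.ne'
      rw [smul_sub, smul_smul, this]; module
    have h2 := M.cone_combo hK hKd hbc hCc (a := (g + t * k) / gb) (b := 1 - (g + t * k) / gb)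
      (by positivity) (by rw [sub_nonneg, div_le_one hgb0]; exact hcase) (by simp)
    rw [← h1] at h2
    obtain ⟨z, hz, q, hq, he⟩ := h2
    exact hnt ((M.eq_of_smul_eq hct hq he).2 ▸ hz)
  · push Not at hcase
    obtain ⟨zb, hzbK, q, hq, he⟩ := hbc
    have hzbw := hzb zb q hq he
    have hD : κ = 1 → dist zb zt < Real.pi := fun _ => by
      have := dist_triangle_right zb zt w
      linarith [Real.pi_gt_three]
    obtain ⟨E, hE, hbE⟩ := M.exists_exit hKcl hD hzbK hnt
    have hEw : dist E w ≤ η := by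
      have h1 : dist zb E + dist E zt = dist zb zt := hbE
      have h2 := dist_triangle_right zb zt w
      have h3 := dist_triangle E zb w
      rw [dist_comm E zb] at h3
      linarith [dist_nonneg (x := E) (y := zt)]
    obtain ⟨α, β, r, hα, hβ, hr, heE, hab, -⟩ := M.btw_coeffs hD hbE
    have hEt : α ≠ 0 := by
      rintro rfl
      rw [zero_smul, zero_add] at heE
      have hb0 : 0 < β := by
        refine hβ.lt_of_ne ?_
        rintro rfl
        have := M.q_eq E
        rw [heE] at this
        simp [br] at this
      have := (M.eq_of_smul_eq one_pos hb0 ((one_smul _ _).trans heE)).2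
      exact hnt (this ▸ hKcl.frontier_subset hE)
    have hα' : 0 < α := lt_of_le_of_ne hα (Ne.symm hEt)
    have heE' : M.e E = (α / q) • b + (β / ct) • (C - (g + t * k) • M.e p) := by
      rw [hat, he, smul_smul, smul_smul, div_mul_cancel₀ _ hq.ne', div_mul_cancel₀ _ hct.ne', heE]
    have hle := hN E hE hEw ⟨(α / q + β / ct) * ((1 + t) * lam), (α / q + β / ct) * ((1 - t) * mu),
      (α / q * gb + β / ct * (g + t * k)), by positivity, by positivity, by positivity, by
        rw [heE', hbC, hC]; module⟩
    have h1 : N (C - (g + t * k) • M.e p) = 0 := by rw [hat, map_smul, hNa, smul_zero]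
    rw [map_sub, map_smul, hNpe, smul_eq_mul] at h1
    rw [heE', hbC] at hle
    simp only [map_add, map_smul, map_sub, hNpe, smul_eq_mul, h1, mul_zero, add_zero] at hle
    have h2 : 0 < α / q := by positivity
    have h3 : 0 < N C - gb * np := by nlinarith
    nlinarith

lemma _root_.BallChar.Curv.continuous_phi (hκ : Curv κ) (c : X) (P : ℝ) :
    Continuous (phi κ c P) := by
  have := hκ.continuous_vs.comp ((continuous_const (y := c)).dist continuous_id)
  exact (this.sub continuous_const).div_const _

/-- The pencil argument: a point `w₁` outside `K` in the indicated cone, inside the ball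
`closedBall p R`, is incompatible with local supporting balls of radius `P < R`. -/
lemma pencil (M : Model κ X d) {K : Set X} (hKc : IsCompact K) (hK : GConvex K)
    (hKd : κ = 1 → ∀ x ∈ K, ∀ y ∈ K, dist x y < Real.pi) {P R : ℝ} (hP : 0 < P) (hPR : P < R)
    (hR : κ = 1 → R < Real.pi / 2)
    (hloc : ∀ w ∈ frontier K, ∃ c : X, ∃ η > 0, dist c w = P ∧
      ∀ k ∈ K, dist k w ≤ η → dist c k ≤ P)
    {x v p w₁ : X} (hx : x ∈ K) (hv : v ∈ K) (hpx : R < dist p x) (hpv : R < dist p v)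
    {Fp Fx Fv : Amb d →ₗ[ℝ] ℝ} (hpp : Fp (M.e p) = 1) (hpx0 : Fp (M.e x) = 0)
    (hpv0 : Fp (M.e v) = 0) (hxp : Fx (M.e p) = 0) (hxx : Fx (M.e x) = 1) (hxv : Fx (M.e v) = 0)
    (hvp : Fv (M.e p) = 0) (hvx : Fv (M.e x) = 0) (hvv : Fv (M.e v) = 1)
    (hw₁ : w₁ ∉ K) (hpw₁ : dist p w₁ < R) {lam mu g : ℝ} (hlam : 0 ≤ lam) (hmu : 0 ≤ mu)
    (hg : 0 ≤ g) (hew₁ : M.e w₁ = lam • M.e x + mu • M.e v - g • M.e p) : False := by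
  have hcl := hKc.isClosed
  have hpi := Real.pi_pos
  have hcsR : 0 < cs κ R := M.curv.cs_pos (by linarith) hR
  have hcsP : 0 < cs κ P := M.curv.cs_pos hP.le fun h => by linarith [hR h]
  have hRpi : κ = 1 → R ≤ Real.pi := fun h => by linarith [hR h]
  have hcspos : ∀ z, dist p z ≤ R → 0 < cs κ (dist p z) := fun z hz =>
    M.curv.cs_pos dist_nonneg fun h => by linarith [hR h]
  set Φ := phi κ p R with hΦ
  have hΦle : ∀ z, Φ z ≤ 0 ↔ dist p z ≤ R := fun z => M.phi_nonpos_iff (by linarith) hcsR hRpi z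
  have hΦlt : ∀ z, Φ z < 0 ↔ dist p z < R := fun z => M.phi_neg_iff (by linarith) hcsR hRpi z
  let Q : X → Prop := fun z => M.e z = Fx (M.e z) • M.e x + Fv (M.e z) • M.e v
      + Fp (M.e z) • M.e p ∧ 0 ≤ Fx (M.e z) ∧ 0 ≤ Fv (M.e z) ∧ Fp (M.e z) ≤ 0
  have hQ : ∀ z, (∃ a b q : ℝ, 0 ≤ a ∧ 0 ≤ b ∧ 0 ≤ q ∧
      M.e z = a • M.e x + b • M.e v - q • M.e p) → Q z := by
    rintro z ⟨a, b, q, ha, hb, hq, he⟩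
    have h1 : Fx (M.e z) = a := by rw [he]; simp [hxp, hxx, hxv]
    have h2 : Fv (M.e z) = b := by rw [he]; simp [hvp, hvx, hvv]
    have h3 : Fp (M.e z) = -q := by rw [he]; simp [hpp, hpx0, hpv0]
    refine ⟨?_, ?_, ?_, ?_⟩
    · rw [h1, h2, h3, he]; module
    all_goals linarith
  have cFx : Continuous fun z => Fx (M.e z) :=
    (LinearMap.continuous_of_finiteDimensional Fx).comp M.continuous_e
  have cFv : Continuous fun z => Fv (M.e z) :=
    (LinearMap.continuous_of_finiteDimensional Fv).comp M.continuous_e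
  have cFp : Continuous fun z => Fp (M.e z) :=
    (LinearMap.continuous_of_finiteDimensional Fp).comp M.continuous_e
  have hQcl : IsClosed {z | Q z} := by
    refine (isClosed_eq M.continuous_e (((cFx.smul continuous_const).add
      (cFv.smul continuous_const)).add (cFp.smul continuous_const))).and
      ((isClosed_le continuous_const cFx).and
      ((isClosed_le continuous_const cFv).and (isClosed_le cFp continuous_const)))
  have cΦ : Continuous Φ := M.curv.continuous_phi p R
  set A := frontier K ∩ ({z | Q z} ∩ {z | Φ z ≤ 0}) with hA
  have hAc : IsCompact A :=
    (hKc.of_isClosed_subset isClosed_frontier hcl.frontier_subset).inter_right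
    (hQcl.inter (isClosed_le cΦ continuous_const))
  -- the third coordinate is negative on `A`
  have hlin : ∀ z ∈ A, Fp (M.e z) < 0 := by
    rintro z ⟨hzf, ⟨he, h1, h2, h3⟩, h4⟩
    refine h3.lt_of_ne fun h0 => ?_
    have hzR := (hΦle z).1 h4
    rw [h0, zero_smul, add_zero] at he
    have hsum : 0 < Fx (M.e z) + Fv (M.e z) := by
      by_contra hcon
      have e1 : Fx (M.e z) = 0 := by linarith
      have e2 : Fv (M.e z) = 0 := by linarith
      have := M.q_eq z
      rw [he, e1, e2] at this
      simp [br] at this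
    have hD : κ = 1 → dist x v < Real.pi := fun h => hKd h x hx v hv
    obtain ⟨z', c, hc, hz', he', -⟩ := M.exists_btw_of_combo hD h1 h2 hsum
    obtain ⟨-, rfl⟩ := M.eq_of_smul_eq one_pos hc ((one_smul _ _).trans (he.trans he'))
    obtain ⟨c, η, hη, hcz, hl⟩ := hloc z hzf
    exact M.not_strictly_between hK hD hx hv hz' (by rintro rfl; linarith)
      (by rintro rfl; linarith) hη (fun h => by linarith [hR h]) hcz hl
  -- a point of `A` with `Φ < 0`
  obtain ⟨z₀, hz₀A, hz₀⟩ : ∃ z ∈ A, Φ z < 0 := by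
    have hsum : 0 < lam + mu := by
      by_contra hcon
      have e1 : lam = 0 := by linarith
      have e2 : mu = 0 := by linarith
      refine M.not_neg_smul (hcspos w₁ hpw₁.le) hg ?_
      rw [hew₁, e1, e2]; module
    have hD : κ = 1 → dist x v < Real.pi := fun h => hKd h x hx v hv
    obtain ⟨m, c, hc, hm, he, -⟩ := M.exists_btw_of_combo hD hlam hmu hsum
    have hmK := hK x hx v hv m (M.uniqueBtwPt hD hm)
    have hpm : dist p m ≤ dist p w₁ := M.dist_le_of_combo (fun h => by linarith [hR h]) hg hc
      (by rw [hew₁, ← he]; module)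
    have hD2 : κ = 1 → dist m w₁ < Real.pi := fun h => by
      linarith [dist_triangle_left m w₁ p, hR h]
    obtain ⟨z, hzf, hz⟩ := M.exists_exit hcl hD2 hmK hw₁
    have hpz : dist p z ≤ dist p w₁ :=
      mem_closedBall'.1 (M.ball_gconvex dist_nonneg (fun h => by linarith [hR h]) m
        (mem_closedBall'.2 hpm) w₁ (mem_closedBall'.2 le_rfl) z (M.uniqueBtwPt hD2 hz))
    have hz' : Φ z < 0 := (hΦlt z).2 (by linarith)
    obtain ⟨α, β, -, hα, hβ, -, hez, -⟩ := M.btw_coeffs hD2 hz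
    refine ⟨z, ⟨hzf, hQ z ⟨(α / c + β) * lam, (α / c + β) * mu, β * g, by positivity,
      by positivity, by positivity, ?_⟩, hz'.le⟩, hz'⟩
    have hem : M.e m = (1 / c) • (lam • M.e x + mu • M.e v) := by
      rw [he, smul_smul, one_div_mul_cancel hc.ne', one_smul]
    rw [hez, hem, hew₁]; module
  -- minimize
  obtain ⟨w, hwA, hmin⟩ := hAc.exists_isMinOn ⟨z₀, hz₀A⟩
    (f := fun z => Φ z / (-Fp (M.e z))) (cΦ.continuousOn.div cFp.neg.continuousOn
      fun z hz => by linarith [hlin z hz])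
  set τ := Φ w / (-Fp (M.e w)) with hτ
  have hτneg : τ < 0 := by
    have h1 : τ ≤ Φ z₀ / (-Fp (M.e z₀)) := hmin hz₀A
    have h2 := div_neg_of_neg_of_pos hz₀ (neg_pos.2 (hlin z₀ hz₀A))
    linarith
  have hg0 := hlin w hwA
  have hΨw : Φ w + τ * Fp (M.e w) = 0 := by
    have : τ * (-Fp (M.e w)) = Φ w := div_mul_cancel₀ _ (by linarith)
    linarith
  have hΨ : ∀ z ∈ frontier K, Q z → 0 ≤ Φ z + τ * Fp (M.e z) := by
    intro z hz hq
    by_cases h : Φ z ≤ 0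
    · have hzA : z ∈ A := ⟨hz, hq, h⟩
      have h1 : τ ≤ Φ z / (-Fp (M.e z)) := hmin hzA
      rw [le_div_iff₀ (neg_pos.2 (hlin z hzA))] at h1
      linarith
    · have := mul_nonneg_of_nonpos_of_nonpos hτneg.le hq.2.2.2
      linarith
  obtain ⟨hwf, ⟨hwe, hwx, hwv, -⟩, -⟩ := hwA
  have hwK := hcl.frontier_subset hwf
  set g₀ := -Fp (M.e w) with hg₀
  have hg₀pos : 0 < g₀ := by linarith
  have hwR : dist p w < R := (hΦlt w).1 (by nlinarith)
  set lm := Fx (M.e w)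
  set mm := Fv (M.e w)
  have hwe' : M.e w = lm • M.e x + mm • M.e v - g₀ • M.e p := by
    rw [hg₀, neg_smul, sub_neg_eq_add]; exact hwe
  have hpwpi : κ = 1 → dist p w < Real.pi := fun h => by linarith [hR h]
  have hlm : 0 < lm := by
    refine hwx.lt_of_ne fun h0 => ?_
    rw [← h0, zero_smul, zero_add] at hwe'
    rcases hwv.eq_or_lt with h1 | h1
    · refine M.not_neg_smul (hcspos w hwR.le) hg₀pos.le ?_
      rw [hwe', ← h1]; module
    · have := M.dist_le_of_combo (v := v) hpwpi hg₀pos.le h1 (by rw [hwe']; module)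
      linarith
  have hmm : 0 < mm := by
    refine hwv.lt_of_ne fun h0 => ?_
    rw [← h0, zero_smul, add_zero] at hwe'
    have := M.dist_le_of_combo (v := x) hpwpi hg₀pos.le hlm (by rw [hwe']; module)
    linarith
  obtain ⟨c, η', hη', hcw, hloc'⟩ := hloc w hwf
  set η := min η' 3 with hη
  have hη0 : 0 < η := by positivity
  have hlocw : ∀ k ∈ K, dist k w ≤ η → phi κ c P k ≤ 0 := fun k hk hkw =>
    (M.phi_nonpos_iff hP.le hcsP (fun h => by linarith [hR h]) k).2
      (hloc' k hk (hkw.trans (min_le_left _ _)))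
  obtain ⟨GR, hGR⟩ := M.phi_linear p hcsR
  obtain ⟨GP, hGP⟩ := M.phi_linear c hcsP
  set N : Amb d →ₗ[ℝ] ℝ := GP - GR - τ • Fp with hNdef
  have hNe : ∀ z, N (M.e z) = phi κ c P z - (Φ z + τ * Fp (M.e z)) := fun z => by
    simp only [hNdef, LinearMap.sub_apply, LinearMap.smul_apply, smul_eq_mul]
    linarith [hGR z, hGP z]
  have hNw : N (M.e w) = 0 := by
    rw [hNe, hΨw, phi, hcw]; simp
  have hNp : 0 < N (M.e p) := by
    rw [hNe, hpp, hΦ]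
    unfold phi
    rw [dist_self, M.curv.vs_at_zero, zero_sub, neg_div]
    have h1 : vs κ P / cs κ P ≤ vs κ R / cs κ R := by
      rw [div_le_div_iff₀ hcsP hcsR]
      have := M.curv.vs_le hP.le hPR.le hRpi
      have h2 := M.curv.mul_vs P
      have h3 := M.curv.mul_vs R
      have h4 : cs κ P = 1 - κ * vs κ P := by linarith
      have h5 : cs κ R = 1 - κ * vs κ R := by linarith
      rw [h4, h5]; nlinarith
    have h2 : -(vs κ P / cs κ P) ≤ (vs κ (dist c p) - vs κ P) / cs κ P := by
      rw [sub_div]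
      have := div_nonneg (vs_nonneg κ (dist c p)) hcsP.le
      linarith
    linarith
  set k := (lm * N (M.e x) - mm * N (M.e v)) / N (M.e p) with hk
  have hkN : k * N (M.e p) = lm * N (M.e x) - mm * N (M.e v) := div_mul_cancel₀ _ hNp.ne'
  have hNw' : lm * N (M.e x) + mm * N (M.e v) = g₀ * N (M.e p) := by
    rw [hwe'] at hNw
    simp only [map_add, map_sub, map_smul, smul_eq_mul] at hNw
    linarith
  obtain ⟨nrm, hn1, hn2⟩ := M.exists_normalization w
  have hnw : nrm (M.e w) = w := M.e_inj (hn2 w).1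
  let a : ℝ → Amb d := fun t => ((1 + t) * lm) • M.e x + ((1 - t) * mm) • M.e v
    - (g₀ + t * k) • M.e p
  let b : ℝ → Amb d := fun t => (1 - |t|) • M.e w + ((|t| + t) * lm) • M.e x
    + ((|t| - t) * mm) • M.e v
  have ca : Continuous a := by fun_prop
  have cb : Continuous b := by fun_prop
  have ha0 : a 0 = M.e w := by simp [a, hwe']
  have hb0 : b 0 = M.e w := by simp [b]
  have cnrm : ∀ f : ℝ → Amb d, Continuous f → f 0 = M.e w →
      ∀ᶠ t in nhds 0, dist (nrm (f t)) w < η / 3 := by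
    intro f hf hf0
    have h1 : ContinuousAt nrm (f 0) := hf0 ▸ (hn2 w).2
    have h2 : ContinuousAt (fun t => nrm (f t)) 0 := ContinuousAt.comp (g := nrm) h1 hf.continuousAt
    have h3 : nrm (f 0) = w := by rw [hf0, hnw]
    have h4 := h2.eventually (ball_mem_nhds (nrm (f 0)) (show 0 < η / 3 by positivity))
    rw [h3] at h4
    exact h4
  have ev : ∀ᶠ t in nhds (0 : ℝ), (|t| < 1 ∧ 0 < g₀ + t * k) ∧ (0 < br κ (a t) (a t) ∧
      (κ ≠ 1 → 0 < (a t).2)) ∧ dist (nrm (a t)) w < η / 3 ∧ dist (nrm (b t)) w < η / 3 := by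
    refine (Eventually.and ?_ ?_).and
      ((Eventually.and ?_ ?_).and ((cnrm a ca ha0).and (cnrm b cb hb0)))
    · exact (continuous_abs.tendsto (0 : ℝ)).eventually (gt_mem_nhds (by simp))
    · exact (show Continuous fun t : ℝ => g₀ + t * k by fun_prop).continuousAt.eventually
        (lt_mem_nhds (by simpa using hg₀pos))
    · refine (continuous_br_self.comp ca).continuousAt.eventually (lt_mem_nhds ?_)
      simp [ha0, M.q_eq]
    · by_cases h : κ = 1
      · simp [h]
      · filter_upwards [(continuous_snd.comp ca).continuousAt.eventually (lt_mem_nhds (a := 0)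
          (by simpa [ha0] using M.ht_pos h w))] with t ht _ using ht
  obtain ⟨δ, hδ, hev⟩ := Metric.eventually_nhds_iff.1 ev
  have side : ∀ t : ℝ, |t| < δ → nrm (a t) ∈ K ∧ ∃ ct : ℝ, 0 < ct ∧ a t = ct • M.e (nrm (a t)) := by
    intro t ht
    obtain ⟨⟨h1, h2⟩, ⟨h3, h4⟩, h5, h6⟩ := hev (show dist t 0 < δ by simpa using ht)
    have hat := hn1 _ h3 h4
    have hct := Real.sqrt_pos.2 h3
    have hNa : N (M.e (nrm (a t))) = 0 := by
      have : N (a t) = 0 := by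
        simp only [a, map_sub, map_add, map_smul, smul_eq_mul]
        linear_combination hNw' - t * hkN
      rw [hat, map_smul, smul_eq_mul] at this
      exact (mul_eq_zero.1 this).resolve_left hct.ne'
    refine ⟨M.pencil_side hcl hK hKd hx hv hwK hlm hmm hg₀pos hwe' hNp rfl ?_ h1 h2 hct hat hNa
      h5 ?_ (min_le_right _ _), _, hct, hat⟩
    · intro z hz hzw hq
      rw [hNe]
      linarith [hlocw z (hcl.frontier_subset hz) hzw, hΨ z hz (hQ z hq)]
    · intro z q hq hbz
      have e1 : br κ (b t) (b t) = q ^ 2 := by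
        rw [show b t = q • M.e z from hbz, br_smul_left, br_smul_right, M.q_eq]; ring
      have e2 := hn1 (b t) (by rw [e1]; positivity) (fun h => by
        rw [show b t = q • M.e z from hbz]
        have := M.ht_pos h z
        simp only [Prod.smul_snd, smul_eq_mul]; positivity)
      have e3 := (M.eq_of_smul_eq hq (Real.sqrt_pos.2 (by rw [e1]; positivity))
        (hbz.symm.trans e2)).2
      rw [e3]; exact h6
  have htδ : |δ / 2| < δ := by rw [abs_of_pos (by positivity)]; linarith
  obtain ⟨hz1, c1, hc1, he1⟩ := side (δ / 2) htδ
  obtain ⟨hz2, c2, hc2, he2⟩ := side (-(δ / 2)) (by rwa [abs_neg])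
  set z1 := nrm (a (δ / 2))
  set z2 := nrm (a (-(δ / 2)))
  have hD : κ = 1 → dist z1 z2 < Real.pi := fun h => hKd h _ hz1 _ hz2
  obtain ⟨z, q, hq, hz, he, -⟩ := M.exists_btw_of_combo hD hc1.le hc2.le (by positivity)
  have hzw : z = w := by
    refine (M.eq_of_smul_eq hq two_pos ?_).2
    rw [← he, ← he1, ← he2, hwe']
    simp only [a]; module
  subst hzw
  have hne : ∀ t : ℝ, t ≠ 0 → ∀ ct : ℝ, a t ≠ ct • M.e z := by
    intro t ht ct h
    have f1 := congrArg Fx h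
    have f2 := congrArg Fv h
    simp only [a, map_sub, map_add, map_smul, smul_eq_mul, hxp, hxx, hxv, hvp, hvx, hvv] at f1 f2
    have g1 : (1 + t - ct) * lm = 0 := by linarith
    have g2 : (1 - t - ct) * mm = 0 := by linarith
    have g3 := (mul_eq_zero.1 g1).resolve_right hlm.ne'
    have g4 := (mul_eq_zero.1 g2).resolve_right hmm.ne'
    exact ht (by linarith)
  exact M.not_strictly_between hK hD hz1 hz2 hz
    (by rintro h; rw [← h] at he1; exact hne _ (by linarith) _ he1)
    (by rintro h; rw [← h] at he2; exact hne _ (by linarith) _ he2)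
    hη' (fun h => by linarith [hR h]) hcw hloc'

end Model

lemma exists_dual {V : Type*} [AddCommGroup V] [Module ℝ V] {u v w : V}
    (h : ∀ a b c : ℝ, a • u + b • v + c • w = 0 → a = 0 ∧ b = 0 ∧ c = 0) :
    ∃ F G H : V →ₗ[ℝ] ℝ, (F u = 1 ∧ F v = 0 ∧ F w = 0) ∧ (G u = 0 ∧ G v = 1 ∧ G w = 0) ∧
      (H u = 0 ∧ H v = 0 ∧ H w = 1) := by
  let f : (ℝ × ℝ × ℝ) →ₗ[ℝ] V :=
    { toFun := fun t => t.1 • u + t.2.1 • v + t.2.2 • w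
      map_add' := fun s t => by simp only [Prod.fst_add, Prod.snd_add]; module
      map_smul' := fun s t => by
        simp only [Prod.smul_fst, Prod.smul_snd, smul_eq_mul, RingHom.id_apply]; module }
  have hf : LinearMap.ker f = ⊥ := by
    rw [LinearMap.ker_eq_bot']
    rintro ⟨a, b, c⟩ h0
    obtain ⟨rfl, rfl, rfl⟩ := h a b c h0
    rfl
  obtain ⟨g, hg⟩ := LinearMap.exists_leftInverse_of_injective f hf
  have h1 : g u = (1, 0, 0) := by simpa [f] using LinearMap.congr_fun hg (1, 0, 0)
  have h2 : g v = (0, 1, 0) := by simpa [f] using LinearMap.congr_fun hg (0, 1, 0)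
  have h3 : g w = (0, 0, 1) := by simpa [f] using LinearMap.congr_fun hg (0, 0, 1)
  refine ⟨LinearMap.fst ℝ _ _ ∘ₗ g, LinearMap.fst ℝ _ _ ∘ₗ LinearMap.snd ℝ _ _ ∘ₗ g,
    LinearMap.snd ℝ _ _ ∘ₗ LinearMap.snd ℝ _ _ ∘ₗ g, ?_⟩
  simp [h1, h2, h3]

namespace Model
variable {κ : ℝ} {d : ℕ}

lemma pair_independent (M : Model κ X d)
    {p x : X} (hpx : p ≠ x) (hD : κ = 1 → dist p x < Real.pi) {a b : ℝ}
    (h : a • M.e p + b • M.e x = 0) : a = 0 ∧ b = 0 := by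
  have h1 : br κ (M.e x) (a • M.e p + b • M.e x) = 0 := by rw [h]; simp [br]
  rw [br_add_right, br_smul_right, br_smul_right, M.q_eq, ← M.cs_dist, dist_comm] at h1
  have ha : a = 0 := by
    by_contra ha
    have h2 : M.e p = cs κ (dist p x) • M.e x := by
      apply smul_right_injective _ ha
      simp only
      have : b = -(a * cs κ (dist p x)) := by linarith
      rw [this] at h
      rw [smul_smul, ← sub_eq_zero, ← h]; module
    have h3 : cs κ (dist p x) ^ 2 = 1 := by
      have := M.q_eq p
      rw [h2, br_smul_left, br_smul_right, M.q_eq] at this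
      linarith
    have h4 := M.curv.sq (dist p x)
    have h5 := M.curv.sn_pos (dist_pos.2 hpx) hD
    have h6 : κ = 0 := by
      have : κ * sn κ (dist p x) ^ 2 = 0 := by linarith
      exact (mul_eq_zero.1 this).resolve_right (by positivity)
    have h7 : cs κ (dist p x) = 1 := by rw [M.cs_dist, M.br_zero h6]
    rw [h7, one_smul] at h2
    exact hpx (M.e_inj h2)
  rw [ha] at h1
  exact ⟨ha, by linarith⟩

/-- A body with local supporting balls of radius `P` at all boundary points is contained in each
of these balls. -/
lemma local_to_global (M : Model κ X d)
    (hd : 2 ≤ d) {K : Set X} (hKc : IsCompact K) (hK : GConvex K)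
    (hKi : (interior K).Nonempty)
    (hKd : κ = 1 → ∀ x ∈ K, ∀ y ∈ K, dist x y < Real.pi) {P : ℝ} (hP : 0 < P)
    (hP1 : κ = 1 → P < Real.pi / 2)
    (hloc : ∀ w ∈ frontier K, ∃ c : X, ∃ η > 0, dist c w = P ∧
      ∀ k ∈ K, dist k w ≤ η → dist c k ≤ P)
    {x c : X} (hxf : x ∈ frontier K) {η : ℝ} (hη : 0 < η) (hcx : dist c x = P)
    (hl : ∀ k ∈ K, dist k x ≤ η → dist c k ≤ P) {z : X} (hz : z ∈ K) : dist c z ≤ P := by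
  by_contra! hcz
  have hcl := hKc.isClosed
  have hx := hcl.frontier_subset hxf
  obtain ⟨δ, hδ, hδ1, hδ2⟩ : ∃ δ > 0, 2 * δ < dist c z - P ∧ (κ = 1 → P + δ < Real.pi / 2) := by
    by_cases h : κ = 1
    · have h1 := hP1 h
      refine ⟨min ((dist c z - P) / 3) ((Real.pi / 2 - P) / 2), lt_min (by linarith) (by linarith),
        ?_, fun _ => ?_⟩
      · linarith [min_le_left ((dist c z - P) / 3) ((Real.pi / 2 - P) / 2)]
      · linarith [min_le_right ((dist c z - P) / 3) ((Real.pi / 2 - P) / 2)]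
    · exact ⟨(dist c z - P) / 3, by linarith, by linarith, fun h' => absurd h' h⟩
  have hpi := Real.pi_pos
  have hxc : x ≠ c := by rintro rfl; rw [dist_self] at hcx; linarith
  obtain ⟨γ, g0, g1, g2, -⟩ := M.exists_geodesic hxc (by
    intro h; rw [dist_comm, hcx]; linarith [hP1 h])
  rw [dist_comm x c, hcx] at g1
  set p := γ (P + δ)
  have hxp : dist x p = P + δ := by
    rw [← g0, g2, zero_sub, abs_neg, abs_of_pos (by linarith)]
    intro h; rw [zero_sub, abs_neg, abs_of_pos (by linarith)]; linarith [hδ2 h]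
  have hcp : dist c p = δ := by
    rw [← g1, g2, show P - (P + δ) = -δ by ring, abs_neg, abs_of_pos hδ]
    intro h; rw [show P - (P + δ) = -δ by ring, abs_neg, abs_of_pos hδ]; linarith [hδ2 h]
  have hpc : dist p c = δ := by rw [dist_comm, hcp]
  have hpx : dist p x = P + δ := by rw [dist_comm, hxp]
  have hpcx : Btw p c x := by unfold Btw; rw [hpc, hcx, hpx]; ring
  -- points of the ball on the outer sphere coincide with `x`
  have huniq : ∀ u, dist c u ≤ P → dist p u ≤ P + δ ∧ (P + δ ≤ dist p u → u = x) := by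
    intro u hu
    have h1 := dist_triangle p c u
    refine ⟨by linarith, fun h => ?_⟩
    have h2 : dist c u = P := by linarith
    refine M.btw_extend_unique (x := p) (y := c) (by linarith) (fun h => by linarith [hδ2 h]) ?_
      hpcx (by rw [h2, hcx])
    unfold Btw; linarith
  -- move `z` off the plane
  obtain ⟨F, hFp, hFx, k, hk, hFk⟩ := M.exists_off_plane hd hKi (M.e p) (M.e x)
  obtain ⟨v, hv, hpv, hFv⟩ : ∃ v ∈ K, P + δ < dist p v ∧ F (M.e v) ≠ 0 := by
    have hpz : P + δ < dist p z := by linarith [dist_triangle_left c z p]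
    by_cases hFz : F (M.e z) = 0
    · have hzk : z ≠ k := by rintro rfl; exact hFk hFz
      have hD : κ = 1 → dist z k < Real.pi := fun h => hKd h z hz k hk
      have hD0 := dist_pos.2 hzk
      obtain ⟨γ', -, -, -, q3, -⟩ := M.exists_seg hD
      set t := min (dist z k) ((dist p z - (P + δ)) / 2)
      have ht0 : 0 < t := lt_min hD0 (by linarith)
      have ht1 : t ≤ dist z k := min_le_left _ _
      have ht2 : t ≤ (dist p z - (P + δ)) / 2 := min_le_right _ _
      obtain ⟨q4, q5, q6⟩ := q3 t ⟨ht0.le, ht1⟩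
      refine ⟨γ' t, hK z hz k hk _ (M.uniqueBtwPt hD q6), ?_, fun h0 => ?_⟩
      · have := dist_triangle_right p z (γ' t)
        linarith
      · have h1 := congrArg F (M.btw_combo q6)
        simp only [map_add, map_smul, smul_eq_mul, h0, hFz, q4] at h1
        have h2 := M.curv.sn_pos ht0 (fun h => by linarith [hD h])
        have : sn κ t * F (M.e k) = 0 := by linarith
        exact hFk ((mul_eq_zero.1 this).resolve_left h2.ne')
    · exact ⟨z, hz, hpz, hFz⟩
  have hpx' : p ≠ x := dist_pos.1 (by linarith)
  have hxv : x ≠ v := by rintro rfl; exact hFv hFx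
  obtain ⟨Fp, Fx, Fv, ⟨a1, a2, a3⟩, ⟨b1, b2, b3⟩, c1, c2, c3⟩ :=
    exists_dual (u := M.e p) (v := M.e x) (w := M.e v) (fun a b c h => by
      have h1 := congrArg F h
      simp only [map_add, map_smul, smul_eq_mul, hFp, hFx, mul_zero, zero_add, map_zero] at h1
      have h2 := (mul_eq_zero.1 h1).resolve_right hFv
      rw [h2, zero_smul, add_zero] at h
      obtain ⟨h3, h4⟩ := M.pair_independent hpx' (fun h => by linarith [hδ2 h]) h
      exact ⟨h3, h4, h2⟩)
  -- a point `y` of the segment close to `x`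
  have hD : κ = 1 → dist x v < Real.pi := fun h => hKd h x hx v hv
  have hD0 := dist_pos.2 hxv
  obtain ⟨γ', -, -, -, q3, -⟩ := M.exists_seg hD
  set t := min (dist x v / 2) (η / 2)
  have ht0 : 0 < t := lt_min (by linarith) (by linarith)
  have ht1 : t ≤ dist x v / 2 := min_le_left _ _
  have ht2 : t ≤ η / 2 := min_le_right _ _
  obtain ⟨q4, q5, q6⟩ := q3 t ⟨ht0.le, by linarith⟩
  set y := γ' t
  have hyK : y ∈ K := hK x hx v hv _ (M.uniqueBtwPt hD q6)
  have hyx : y ≠ x := by rintro h; rw [h, dist_self] at q4; linarith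
  have hyv : y ≠ v := by rintro h; rw [h, dist_self] at q5; linarith
  obtain ⟨α, β, r, -, -, -, hey, -, -, hpos⟩ := M.btw_coeffs hD q6
  obtain ⟨hα, hβ, -⟩ := hpos hyx hyv
  have hFy : F (M.e y) ≠ 0 := by
    rw [hey, map_add, map_smul, map_smul, hFx]
    simp only [smul_eq_mul, mul_zero, zero_add]
    exact mul_ne_zero hβ.ne' hFv
  obtain ⟨hpy1, hpy2⟩ := huniq y (hl y hyK (by rw [dist_comm, q4]; linarith))
  have hpy : dist p y < P + δ := lt_of_not_ge fun h => hyx (hpy2 h)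
  have hpy' : p ≠ y := by rintro h; rw [← h] at hFy; exact hFy hFp
  have hpyD : κ = 1 → dist p y < Real.pi := fun h => by linarith [hδ2 h]
  obtain ⟨γ₁, r0, r1, r2, r3⟩ := M.exists_geodesic hpy' hpyD
  set D := dist p y with hDdef
  have hDpos : 0 < D := dist_pos.2 hpy'
  have hsD := M.curv.sn_pos hDpos hpyD
  have hr : ∀ s, 0 ≤ s → s ≤ P + δ → dist p (γ₁ s) = s := by
    intro s hs hs1
    rw [← r0, r2, zero_sub, abs_neg, abs_of_nonneg hs]
    intro h; rw [zero_sub, abs_neg, abs_of_nonneg hs]; linarith [hδ2 h]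
  have hr' : ∀ s, D ≤ s → s ≤ P + δ → dist y (γ₁ s) = s - D := by
    intro s hs hs1
    rw [← r1, r2, abs_of_nonpos (by linarith)]
    · ring
    · intro h; rw [abs_of_nonpos (by linarith)]; linarith [hδ2 h]
  have hend : P < dist c (γ₁ (P + δ)) := by
    by_contra! hcon
    have h1 := (huniq _ hcon).2 (hr _ (by linarith) le_rfl).ge
    have h2 := congrArg F (r3 (P + δ))
    rw [h1] at h2
    simp only [map_add, map_smul, smul_eq_mul, hFx, hFp, mul_zero, zero_add] at h2
    have h3 := M.curv.sn_pos (s := P + δ) (by linarith) (fun h => by linarith [hδ2 h])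
    exact mul_ne_zero h3.ne' hFy h2.symm
  -- move slightly back along the ray
  set m := min ((dist c (γ₁ (P + δ)) - P) / 2) ((P + δ - D) / 2)
  have hm0 : 0 < m := lt_min (by linarith) (by linarith)
  have hm1 : m ≤ (dist c (γ₁ (P + δ)) - P) / 2 := min_le_left _ _
  have hm2 : m ≤ (P + δ - D) / 2 := min_le_right _ _
  set s := P + δ - m
  have hsm : dist (γ₁ s) (γ₁ (P + δ)) = m := by
    have : s - (P + δ) = -m := by simp only [s]; ring
    rw [r2, this, abs_neg, abs_of_pos hm0]
    intro h; rw [this, abs_neg, abs_of_pos hm0]; linarith [hδ2 h]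
  have hsD' : D < s := by simp only [s]; linarith
  have hsR : s < P + δ := by simp only [s]; linarith
  have hcs : P < dist c (γ₁ s) := by
    have := dist_triangle c (γ₁ s) (γ₁ (P + δ))
    linarith
  have hw₁ : γ₁ s ∉ K := by
    intro hin
    have h1 := hl _ hin (by
      have h2 := dist_triangle_left (γ₁ s) x y
      rw [hr' s hsD'.le hsR.le, dist_comm y x, q4] at h2
      have h3 := dist_triangle_right p x y
      rw [hpx, q4] at h3
      linarith)
    linarith
  have hsn1 : 0 ≤ sn κ (s - D) := M.curv.sn_nonneg (by linarith) (fun h => by linarith [hδ2 h])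
  have hsn2 : 0 ≤ sn κ s := M.curv.sn_nonneg (by linarith) (fun h => by linarith [hδ2 h])
  set R := (max s P + (P + δ)) / 2
  have hR1 : s < R := by
    have := le_max_left s P
    simp only [R]; linarith
  have hR2 : P < R := by
    have := le_max_right s P
    simp only [R]; linarith
  have hR3 : R < P + δ := by
    have : max s P < P + δ := max_lt hsR (by linarith)
    simp only [R]; linarith
  refine M.pencil hKc hK hKd hP hR2 (fun h => by linarith [hδ2 h]) hloc hx hv
    (by rw [hpx]; exact hR3) (hR3.trans hpv) a1 a2 a3 b1 b2 b3 c1 c2 c3 hw₁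
    (by rw [hr s (by linarith) hsR.le]; exact hR1)
    (lam := sn κ s * α / sn κ D) (mu := sn κ s * β / sn κ D) (g := sn κ (s - D) / sn κ D)
    (by positivity) (by positivity) (by positivity) ?_
  apply smul_right_injective _ hsD.ne'
  simp only [smul_sub, smul_add, smul_smul, mul_div_cancel₀ _ hsD.ne']
  rw [r3, hey, show D - s = -(s - D) by ring, M.curv.sn_neg]
  module

end Model

/-- `f` is a product of `n` reflections. -/
def IsReflectionProduct (n : ℕ) (f : X ≃ᵢ X) : Prop :=
  ∃ l : List (X ≃ᵢ X), (∀ σ ∈ l, IsReflection σ) ∧ l.length = n ∧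
    f = l.foldr IsometryEquiv.trans (IsometryEquiv.refl X)

lemma isReflectionProduct_refl : IsReflectionProduct 0 (IsometryEquiv.refl X) :=
  ⟨[], by simp, rfl, rfl⟩

lemma IsReflectionProduct.cons {n : ℕ} {f σ : X ≃ᵢ X} (hf : IsReflectionProduct n f)
    (hσ : IsReflection σ) : IsReflectionProduct (n + 1) (σ.trans f) := by
  obtain ⟨l, h1, h2, rfl⟩ := hf
  exact ⟨σ :: l, by simpa using ⟨hσ, h1⟩, by simp [h2], rfl⟩

lemma IsReflectionProduct.orientationPreserving {n : ℕ} {f : X ≃ᵢ X}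
    (hf : IsReflectionProduct n f) (hn : Even n) : OrientationPreserving f := by
  obtain ⟨l, h1, h2, h3⟩ := hf
  exact ⟨l, h1, h2 ▸ hn, h3⟩

lemma orientationPreserving_refl : OrientationPreserving (IsometryEquiv.refl X) :=
  isReflectionProduct_refl.orientationPreserving (by simp)

namespace Model
variable {κ : ℝ} {d : ℕ}

lemma exists_reflection_fixing (M : Model κ X d) (hd : 2 ≤ d) (y p : X) :
    ∃ τ : X ≃ᵢ X, IsReflection τ ∧ τ y = y ∧ τ p = p := by
  obtain ⟨z, z', hne, h1, h2, h3⟩ := M.exists_two_equidistant hd y p (t := 1) one_pos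
    (fun _ => by linarith [Real.pi_gt_three])
  obtain ⟨τ, hτ, -, hfix⟩ := M.exists_reflection hne
  refine ⟨τ, hτ, (hfix y).2 (by rw [h1, h2]), (hfix p).2 ?_⟩
  rw [dist_comm p, dist_comm p, h3]

/-- Orientation preserving congruences act transitively on pairs of points at given distance. -/
lemma exists_orientationPreserving (M : Model κ X d)
    (hd : 2 ≤ d) {y p b c : X} (h : dist y p = dist b c) :
    ∃ ψ : X ≃ᵢ X, OrientationPreserving ψ ∧ ψ y = b ∧ ψ p = c := by
  have step : ∀ p', dist b p' = dist b c →
      ∃ n, ∃ f : X ≃ᵢ X, IsReflectionProduct n f ∧ f b = b ∧ f p' = c := by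
    intro p' hp'
    by_cases h1 : p' = c
    · exact ⟨0, _, isReflectionProduct_refl, rfl, h1⟩
    · obtain ⟨σ, hσ, h2, h3⟩ := M.exists_reflection h1
      exact ⟨1, _, isReflectionProduct_refl.cons hσ, (h3 b).2 hp', h2⟩
  obtain ⟨n, f, hf, hfy, hfp⟩ : ∃ n, ∃ f : X ≃ᵢ X, IsReflectionProduct n f ∧ f y = b ∧ f p = c := by
    by_cases h1 : y = b
    · subst h1; exact step p h
    · obtain ⟨σ, hσ, h2, -⟩ := M.exists_reflection h1
      obtain ⟨n, f, hf, h3, h4⟩ := step (σ p) (by rw [← h2, σ.dist_eq, h, h2])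
      exact ⟨n + 1, _, hf.cons hσ, by simp [h2, h3], by simp [h4]⟩
  rcases Nat.even_or_odd n with hn | hn
  · exact ⟨f, hf.orientationPreserving hn, hfy, hfp⟩
  · obtain ⟨τ, hτ, h1, h2⟩ := M.exists_reflection_fixing hd y p
    exact ⟨τ.trans f, (hf.cons hτ).orientationPreserving hn.add_one, by simp [h1, hfy],
      by simp [h2, hfp]⟩

end Model

section Equivariance

lemma btw_map (f : X ≃ᵢ X) {x z y : X} : Btw (f x) (f z) (f y) ↔ Btw x z y := by
  simp only [Btw, f.dist_eq]

lemma uniqueBtwPt_map (f : X ≃ᵢ X) {x z y : X} (h : UniqueBtwPt x z y) :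
    UniqueBtwPt (f x) (f z) (f y) := by
  refine ⟨(btw_map f).2 h.1, fun w hw hd => ?_⟩
  obtain ⟨v, rfl⟩ := f.surjective w
  rw [f.dist_eq, f.dist_eq] at hd
  rw [h.2 v ((btw_map f).1 hw) hd]

lemma GConvex.preimage {C : Set X} (hC : GConvex C) (f : X ≃ᵢ X) : GConvex (f ⁻¹' C) :=
  fun _ hx _ hy _ hz => hC _ hx _ hy _ (uniqueBtwPt_map f hz)

lemma subset_gconvexHull (Y : Set X) : Y ⊆ gconvexHull Y :=
  subset_sInter fun _ hC => hC.2

lemma gconvexHull_min {Y C : Set X} (hC : GConvex C) (h : Y ⊆ C) : gconvexHull Y ⊆ C :=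
  sInter_subset_of_mem ⟨hC, h⟩

lemma gconvex_gconvexHull (Y : Set X) : GConvex (gconvexHull Y) :=
  fun x hx y hy z hz C hC => hC.1 x (hx C hC) y (hy C hC) z hz

lemma image_gconvexHull_subset (f : X ≃ᵢ X) (Y : Set X) :
    f '' gconvexHull Y ⊆ gconvexHull (f '' Y) := by
  rw [image_subset_iff]
  refine gconvexHull_min ((gconvex_gconvexHull _).preimage f) fun y hy => ?_
  exact subset_gconvexHull _ (mem_image_of_mem f hy)

lemma image_gconvexHull (f : X ≃ᵢ X) (Y : Set X) :
    f '' gconvexHull Y = gconvexHull (f '' Y) := by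
  refine (image_gconvexHull_subset f Y).antisymm fun y hy => ?_
  have h := image_gconvexHull_subset f.symm (f '' Y) (mem_image_of_mem _ hy)
  rw [← image_comp] at h
  simp only [Function.comp_def, IsometryEquiv.symm_apply_apply, image_id'] at h
  exact ⟨_, h, f.apply_symm_apply y⟩

lemma onLine_map (f : X ≃ᵢ X) {a b z : X} : OnLine (f a) (f b) (f z) ↔ OnLine a b z := by
  simp only [OnLine, btw_map]

lemma image_perpDisc (f : X ≃ᵢ X) (a b : X) (ε : ℝ) :
    f '' perpDisc a b ε = perpDisc (f a) (f b) ε := by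
  ext w
  obtain ⟨v, rfl⟩ := f.surjective w
  rw [f.injective.mem_set_image]
  refine and_congr ?_ (by rw [f.dist_eq])
  conv_rhs => rw [f.surjective.forall]
  exact forall_congr' fun z => by rw [onLine_map, f.dist_eq, f.dist_eq]

lemma image_segCyl (f : X ≃ᵢ X) (a b : X) (ε : ℝ) :
    f '' segCyl a b ε = segCyl (f a) (f b) ε := by
  rw [segCyl, image_gconvexHull, image_union, image_perpDisc, image_perpDisc, segCyl]

lemma segCyl_comm (a b : X) (ε : ℝ) : segCyl a b ε = segCyl b a ε := by
  rw [segCyl, union_comm, segCyl]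

lemma IsReflection.apply_apply {σ : X ≃ᵢ X} (h : IsReflection σ) (x : X) : σ (σ x) = x := by
  rw [← IsometryEquiv.trans_apply, h.1]; rfl

lemma image_inter_segCyl {σ : X ≃ᵢ X} {N : Set X} {a b : X} (hN : σ '' N = N) (ha : σ a = b)
    (hb : σ b = a) (ε : ℝ) : σ '' (N ∩ segCyl a b ε) = N ∩ segCyl a b ε := by
  rw [image_inter σ.injective, hN, image_segCyl, ha, hb, segCyl_comm]

lemma image_hull_of_swap {σ : X ≃ᵢ X} {c₁ c₂ : X} (h₁ : σ c₁ = c₂) (h₂ : σ c₂ = c₁) (r : ℝ) :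
    σ '' gconvexHull (closedBall c₁ r ∪ closedBall c₂ r) =
      gconvexHull (closedBall c₁ r ∪ closedBall c₂ r) := by
  rw [image_gconvexHull, image_union, σ.image_closedBall, σ.image_closedBall, h₁, h₂, union_comm]

/-- A central symmetry of a subset containing the endpoints of the unique diametral segment
swaps these endpoints. -/
lemma UniqueDiametral.swap {N S : Set X} {a b : X} (h : UniqueDiametral N a b) (hSN : S ⊆ N)
    (ha : a ∈ S) (hb : b ∈ S) {σ : X ≃ᵢ X} {p : X} (hS : σ '' S = S)
    (hm : ∀ x ∈ S, IsMidpoint p x (σ x)) : σ a = b ∧ σ b = a := by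
  obtain ⟨-, -, hab, hd, hu⟩ := h
  have hσ : ∀ x ∈ S, σ x ∈ N := fun x hx => hSN (hS ▸ mem_image_of_mem σ hx)
  rcases hu _ (hσ a ha) _ (hσ b hb) (by rw [σ.dist_eq, hd]) with ⟨h1, h2⟩ | h1
  · have key : ∀ x ∈ S, σ x = x → x = p := fun x hx h => by
      have := (hm x hx).1
      rw [h, Btw, dist_self, dist_comm p x] at this
      exact dist_eq_zero.1 (by linarith)
    exact absurd ((key a ha h1).trans (key b hb h2).symm) hab
  · exact h1

lemma left_mem_segCyl (a b : X) {ε : ℝ} (hε : 0 ≤ ε) : a ∈ segCyl a b ε :=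
  subset_gconvexHull _ (Or.inl ⟨fun _ _ => by simp, by simpa⟩)

lemma right_mem_segCyl (a b : X) {ε : ℝ} (hε : 0 ≤ ε) : b ∈ segCyl a b ε :=
  segCyl_comm b a ε ▸ left_mem_segCyl b a hε

end Equivariance

namespace Model
variable {κ : ℝ} {d : ℕ}

lemma gconvex_ball (M : Model κ X d)
    {s : X} {r : ℝ} (hr : κ = 1 → r ≤ Real.pi / 2) : GConvex (ball s r) := by
  intro x hx y hy z hz
  rw [mem_ball'] at hx hy
  have := M.ball_gconvex (c := s) (P := max (dist s x) (dist s y)) (by positivity)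
    (fun h => (max_lt hx hy).trans_le (hr h)) x (by simp [dist_comm]) y (by simp [dist_comm]) z hz
  rw [mem_closedBall'] at this
  exact mem_ball'.2 (this.trans_lt (max_lt hx hy))

lemma add_lt_pi_of_hemisphere (M : Model κ X d)
    {c₁ c₂ : X} {r : ℝ} (hr : 0 < r) (hr1 : κ = 1 → r < Real.pi / 2)
    (hs : κ = 1 → ∃ s : X, closedBall c₁ r ∪ closedBall c₂ r ⊆ ball s (Real.pi / 2)) (h : κ = 1) :
    dist c₁ c₂ + 2 * r < Real.pi := by
  obtain ⟨s, hs⟩ := hs h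
  have hr1 := hr1 h
  have hlt : ∀ x ∈ closedBall c₁ r, ∀ y ∈ closedBall c₂ r, dist x y < Real.pi := fun x hx y hy => by
    have h1 := mem_ball.1 (hs (Or.inl hx))
    have h2 := mem_ball.1 (hs (Or.inr hy))
    linarith [dist_triangle_right x y s]
  by_cases hc : c₁ = c₂
  · rw [hc, dist_self]; linarith
  by_contra! hcon
  have hD := hlt c₁ (mem_closedBall_self hr.le) c₂ (mem_closedBall_self hr.le)
  obtain ⟨γ, h0, h1, h2, -⟩ := M.exists_geodesic hc fun _ => hD
  have hpi := Real.pi_pos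
  have hD0 := dist_nonneg (x := c₁) (y := c₂)
  have h3 := hlt (γ (-r)) (by
    rw [mem_closedBall, ← h0, h2] <;> rw [sub_zero, abs_neg, abs_of_pos hr]
    intro; linarith) (γ (Real.pi - r)) (by
    rw [mem_closedBall]
    nth_rw 1 [← h1]
    have : |Real.pi - r - dist c₁ c₂| ≤ r := abs_le.2 ⟨by linarith, by linarith⟩
    rw [h2 _ _ fun _ => by linarith]
    exact this)
  have h4 : |-r - (Real.pi - r)| = Real.pi := by
    rw [show -r - (Real.pi - r) = -Real.pi by ring, abs_neg, abs_of_pos hpi]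
  rw [h2 _ _ fun _ => h4.le, h4] at h3
  exact lt_irrefl _ h3

lemma hull_subset_closedBall (M : Model κ X d) {c₁ c₂ m : X} {r : ℝ} (hr : 0 < r)
    (hlt : κ = 1 → dist c₁ c₂ + 2 * r < Real.pi) (hm : IsMidpoint m c₁ c₂) :
    gconvexHull (closedBall c₁ r ∪ closedBall c₂ r) ⊆ closedBall m (dist c₁ c₂ / 2 + r) := by
  have h1 : dist c₁ m + dist m c₂ = dist c₁ c₂ := hm.1
  have h2 := hm.2
  refine gconvexHull_min (M.ball_gconvex (by positivity) fun h => by linarith [hlt h]) ?_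
  refine union_subset (closedBall_subset_closedBall' ?_) (closedBall_subset_closedBall' ?_)
  · linarith
  · rw [dist_comm]; linarith

lemma centrallySymmetric_hull (M : Model κ X d) {c₁ c₂ : X} {r : ℝ} (hr : 0 < r)
    (hlt : κ = 1 → dist c₁ c₂ + 2 * r < Real.pi) :
    CentrallySymmetric (gconvexHull (closedBall c₁ r ∪ closedBall c₂ r)) := by
  have hD : κ = 1 → dist c₁ c₂ < Real.pi := fun h => by linarith [hlt h]
  obtain ⟨m, hm⟩ := M.exists_midpoint hD
  obtain ⟨σ, h1, h2, h3, h4⟩ := M.exists_point_symmetry m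
  have h5 := M.point_symmetry_swap hm h3 hD
  refine ⟨σ, m, h1, h2, image_hull_of_swap h5 (by rw [← h5, h1]) r, fun x hx => h4 x fun h => ?_⟩
  have := mem_closedBall.1 (M.hull_subset_closedBall hr hlt hm hx)
  linarith [hlt h]

/-- The endpoints of a diametral segment of the hull of two congruent balls. -/
lemma exists_diametral_hull (M : Model κ X d) {c₁ c₂ : X} (hc : c₁ ≠ c₂) {r : ℝ} (hr : 0 < r)
    (hlt : κ = 1 → dist c₁ c₂ + 2 * r < Real.pi) :
    ∃ a b, Btw c₂ c₁ a ∧ Btw c₁ c₂ b ∧ dist c₁ a = r ∧ dist c₂ b = r ∧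
      a ∈ gconvexHull (closedBall c₁ r ∪ closedBall c₂ r) ∧
      b ∈ gconvexHull (closedBall c₁ r ∪ closedBall c₂ r) ∧
      dist a b = diam (gconvexHull (closedBall c₁ r ∪ closedBall c₂ r)) := by
  have hD : κ = 1 → dist c₁ c₂ < Real.pi := fun h => by linarith [hlt h]
  obtain ⟨m, hm⟩ := M.exists_midpoint hD
  obtain ⟨γ, h0, h1, h2, -⟩ := M.exists_geodesic hc hD
  have hD0 := dist_nonneg (x := c₁) (y := c₂)
  set D := dist c₁ c₂
  have hdist : ∀ s t, s ≤ t → -r ≤ s → t ≤ D + r → dist (γ s) (γ t) = t - s := by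
    intro s t hst hs ht
    have : |s - t| = t - s := by rw [abs_sub_comm, abs_of_nonneg (by linarith)]
    rw [h2, this]
    intro h; rw [this]; linarith [hlt h]
  have e1 := hdist (-r) 0 (by linarith) le_rfl (by linarith)
  have e2 := hdist (-r) D (by linarith) le_rfl (by linarith)
  have e3 := hdist (-r) (D + r) (by linarith) le_rfl le_rfl
  have e4 := hdist 0 (D + r) (by linarith) (by linarith) le_rfl
  have e5 := hdist D (D + r) (by linarith) (by linarith) le_rfl
  rw [h0] at e1 e4
  rw [h1] at e2 e5
  have ha : γ (-r) ∈ gconvexHull (closedBall c₁ r ∪ closedBall c₂ r) :=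
    subset_gconvexHull _ (Or.inl (by rw [mem_closedBall]; linarith))
  have hb : γ (D + r) ∈ gconvexHull (closedBall c₁ r ∪ closedBall c₂ r) :=
    subset_gconvexHull _ (Or.inr (by rw [mem_closedBall']; linarith))
  have hsub := M.hull_subset_closedBall hr hlt hm
  refine ⟨γ (-r), γ (D + r), ?_, ?_, ?_, by linarith, ha, hb, le_antisymm ?_ ?_⟩
  · unfold Btw; rw [dist_comm c₂ c₁, dist_comm c₁ (γ _), dist_comm c₂ (γ _)]; linarith
  · unfold Btw; linarith
  · rw [dist_comm]; linarith
  · exact dist_le_diam_of_mem (isBounded_closedBall.subset hsub) ha hb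
  · refine diam_le_of_forall_dist_le dist_nonneg fun x hx y hy => ?_
    have q1 := mem_closedBall.1 (hsub hx)
    have q2 := mem_closedBall.1 (hsub hy)
    linarith [dist_triangle_right x y m]

lemma gconvexHull_closedBall (M : Model κ X d)
    {c : X} {r : ℝ} (hr : 0 < r) (hr1 : κ = 1 → r < Real.pi / 2) :
    gconvexHull (closedBall c r) = closedBall c r :=
  (gconvexHull_min (M.ball_gconvex hr.le hr1) subset_rfl).antisymm (subset_gconvexHull _)

lemma not_uniqueDiametral_closedBall (M : Model κ X d) (hd : 2 ≤ d) {c : X} {r : ℝ} (hr : 0 < r)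
    (hr1 : κ = 1 → r < Real.pi / 2) (a b : X) : ¬ UniqueDiametral (closedBall c r) a b := by
  rintro ⟨ha, hb, hab, -, hu⟩
  have hpi := Real.pi_pos
  have key : ∀ z, dist c z = r → z = a ∨ z = b := by
    intro z hz
    obtain ⟨γ, h0, h1, h2, -⟩ := M.exists_geodesic (x := c) (y := z)
      (dist_pos.1 (by rw [hz]; exact hr)) (fun h => by rw [hz]; linarith [hr1 h])
    rw [hz] at h1
    have e1 : dist (γ (-r)) c = r := by
      rw [← h0, h2] <;> rw [sub_zero, abs_neg, abs_of_pos hr]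
      intro h; linarith [hr1 h]
    have e2 : dist z (γ (-r)) = 2 * r := by
      have : |r - -r| = 2 * r := by rw [sub_neg_eq_add, ← two_mul, abs_of_pos (by linarith)]
      rw [← h1, h2, this]
      intro h; rw [this]; linarith [hr1 h]
    have hz' : z ∈ closedBall c r := by rw [mem_closedBall', hz]
    have hg : γ (-r) ∈ closedBall c r := by rw [mem_closedBall, e1]
    have e3 : diam (closedBall c r) ≤ dist z (γ (-r)) := by
      refine diam_le_of_forall_dist_le dist_nonneg fun x hx y hy => ?_
      linarith [dist_triangle_right x y c, mem_closedBall.1 hx, mem_closedBall.1 hy]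
    exact (hu z hz' _ hg (le_antisymm (dist_le_diam_of_mem isBounded_closedBall hz' hg) e3)).imp
      And.left And.left
  obtain ⟨z, z', hne, h1, h2, h3⟩ := M.exists_two_equidistant hd c a (t := r) hr
    (fun h => (hr1 h).le)
  rcases key z h1 with rfl | rfl
  · rw [dist_self] at h3
    exact hne (dist_eq_zero.1 h3.symm).symm
  · rcases key z' h2 with rfl | rfl
    · rw [dist_self] at h3
      exact hne (dist_eq_zero.1 h3)
    · exact hne rfl

lemma symmetricWrtPerpBisector_hull (M : Model κ X d) (hd : 2 ≤ d) {c₁ c₂ : X} {r : ℝ} (hr : 0 < r)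
    (hr1 : κ = 1 → r < Real.pi / 2) (hlt : κ = 1 → dist c₁ c₂ + 2 * r < Real.pi) {a b : X}
    (hab : UniqueDiametral (gconvexHull (closedBall c₁ r ∪ closedBall c₂ r)) a b) :
    SymmetricWrtPerpBisector (gconvexHull (closedBall c₁ r ∪ closedBall c₂ r)) a b := by
  by_cases hc : c₁ = c₂
  · subst hc
    rw [union_self, M.gconvexHull_closedBall hr hr1] at hab
    exact absurd hab (M.not_uniqueDiametral_closedBall hd hr hr1 a b)
  obtain ⟨σ, hσ, h1, -⟩ := M.exists_reflection hc
  have h2 : σ c₂ = c₁ := by rw [← h1, hσ.apply_apply]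
  obtain ⟨a', b', q1, q2, q3, q4, q5, q6, q7⟩ := M.exists_diametral_hull hc hr hlt
  have h3 : σ a' = b' := by
    refine M.btw_extend_unique (x := c₁) (y := c₂) (dist_pos.2 hc)
      (fun h => by linarith [hlt h]) ?_ q2 ?_
    · rw [← h2]; nth_rw 2 [← h1]; rwa [btw_map]
    · rw [q4, ← h1, σ.dist_eq, q3]
  refine ⟨σ, hσ, ?_, image_hull_of_swap h1 h2 r⟩
  rcases hab.2.2.2.2 a' q5 b' q6 q7 with ⟨rfl, rfl⟩ | ⟨rfl, rfl⟩
  · exact h3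
  · rw [← h3, hσ.apply_apply]

section Conditions
variable {K L : Set X}

lemma hullUnion_of_balls {p q : X} {r : ℝ} (hK : K = closedBall p r) (hL : L = closedBall q r)
    (φ ψ : X ≃ᵢ X) :
    (⇑φ '' K) ∪ (⇑ψ '' L) = closedBall (φ p) r ∪ closedBall (ψ q) r := by
  rw [hK, hL, φ.image_closedBall, ψ.image_closedBall]

lemma cond1_of_cond7 (M : Model κ X d) (hS : IsSphereSpace X d ↔ κ = 1)
    (h : T7Cond7 d K L) : T7Cond1 d K L := by
  obtain ⟨r, hr, hr1, ⟨p, hK⟩, q, hL⟩ := h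
  rw [hS] at hr1
  intro φ ψ hg
  obtain ⟨-, -, hs⟩ := hg
  rw [hS, hullUnion_of_balls hK hL] at hs
  rw [hullUnion, hullUnion_of_balls hK hL]
  exact M.centrallySymmetric_hull hr (M.add_lt_pi_of_hemisphere hr hr1 hs)

lemma cond2_of_cond7 (M : Model κ X d) (hS : IsSphereSpace X d ↔ κ = 1)
    (hd : 2 ≤ d) (h : T7Cond7 d K L) : T7Cond2 d K L := by
  obtain ⟨r, hr, hr1, ⟨p, hK⟩, q, hL⟩ := h
  rw [hS] at hr1
  intro φ ψ hg a b hab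
  obtain ⟨-, -, hs⟩ := hg
  rw [hS, hullUnion_of_balls hK hL] at hs
  rw [hullUnion, hullUnion_of_balls hK hL] at hab ⊢
  exact M.symmetricWrtPerpBisector_hull hd hr hr1 (M.add_lt_pi_of_hemisphere hr hr1 hs) hab

lemma exists_segCyl_subset_hemisphere (M : Model κ X d)
    {φ ψ : X ≃ᵢ X} (hKcl : IsClosed K) (hLcl : IsClosed L)
    (hg : GoodPair d K L φ ψ) {x y : X} (hx : x ∈ frontier K) (hy : y ∈ frontier L) :
    ∃ ε₀ > (0 : ℝ), ∀ ε : ℝ, 0 < ε → ε < ε₀ → IsSphereSpace X d →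
      ∃ s : X, (⇑φ '' K) ∪ (⇑ψ '' L) ⊆ ball s (Real.pi / 2) ∧
        segCyl (φ x) (ψ y) ε ⊆ ball s (Real.pi / 2) := by
  by_cases h : IsSphereSpace X d
  · obtain ⟨s, hs⟩ := hg.2.2 h
    have h1 := mem_ball.1 (hs (Or.inl (mem_image_of_mem φ (hKcl.frontier_subset hx))))
    have h2 := mem_ball.1 (hs (Or.inr (mem_image_of_mem ψ (hLcl.frontier_subset hy))))
    refine ⟨min (Real.pi / 2 - dist (φ x) s) (Real.pi / 2 - dist (ψ y) s),
      lt_min (by linarith) (by linarith), fun ε _ hε _ => ⟨s, hs, ?_⟩⟩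
    have h3 := hε.trans_le (min_le_left _ _)
    have h4 := hε.trans_le (min_le_right _ _)
    refine gconvexHull_min (M.gconvex_ball fun _ => le_rfl) (union_subset ?_ ?_)
    · intro w hw
      have := hw.2
      exact mem_ball.2 (by linarith [dist_triangle w (φ x) s])
    · intro w hw
      have := hw.2
      exact mem_ball.2 (by linarith [dist_triangle w (ψ y) s])
  · exact ⟨1, one_pos, fun _ _ _ h' => absurd h' h⟩

lemma cond5_of_cond3 (M : Model κ X d) (hKcl : IsClosed K) (hLcl : IsClosed L) (h : T7Cond3 d K L) :
    T7Cond5 d K L := by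
  obtain ⟨δ, hδ, h⟩ := h
  refine ⟨δ, hδ, fun φ ψ hg x hx y hy hbig hud => ?_⟩
  obtain ⟨ε₀, hε₀, hε⟩ := M.exists_segCyl_subset_hemisphere hKcl hLcl hg hx hy
  obtain ⟨σ, p, h1, h2, h3, h4⟩ := h φ ψ hg x hx y hy hbig hud
  obtain ⟨h5, h6⟩ := hud.swap subset_rfl hud.1 hud.2.1 h3 h4
  exact ⟨ε₀, hε₀, fun ε h7 h8 => ⟨hε ε h7 h8, σ, p, h1, h2, image_inter_segCyl h3 h5 h6 ε,
    fun z hz => h4 z hz.1⟩⟩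

lemma cond6_of_cond4 (M : Model κ X d) (hKcl : IsClosed K) (hLcl : IsClosed L) (h : T7Cond4 d K L) :
    T7Cond6 d K L := by
  obtain ⟨δ, hδ, h⟩ := h
  refine ⟨δ, hδ, fun φ ψ hg x hx y hy hbig hud => ?_⟩
  obtain ⟨ε₀, hε₀, hε⟩ := M.exists_segCyl_subset_hemisphere hKcl hLcl hg hx hy
  obtain ⟨σ, h1, h2, h3⟩ := h φ ψ hg x hx y hy hbig hud
  exact ⟨ε₀, hε₀, fun ε h7 h8 => ⟨hε ε h7 h8, σ, h1, h2,
    image_inter_segCyl h3 h2 (by rw [← h2, h1.apply_apply]) ε⟩⟩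

end Conditions
end Model

lemma cond3_of_cond1 {d : ℕ} {K L : Set X} (h : T7Cond1 d K L) : T7Cond3 d K L :=
  ⟨1, one_pos, fun φ ψ hg _ _ _ _ _ _ => h φ ψ hg⟩

lemma cond4_of_cond2 {d : ℕ} {K L : Set X} (h : T7Cond2 d K L) : T7Cond4 d K L :=
  ⟨1, one_pos, fun φ ψ hg _ _ _ _ _ hud => h φ ψ hg _ _ hud⟩

namespace Model
variable {κ : ℝ} {d : ℕ}

lemma dist_le_of_vs_le (M : Model κ X d) {x y z w : X} (h : vs κ (dist x y) ≤ vs κ (dist z w)) :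
    dist x y ≤ dist z w :=
  M.curv.le_of_vs_le dist_nonneg h fun h => M.dist_le h _ _

/-- The Pythagorean defect at `a` vanishes exactly on the hyperplane orthogonal to `[a, b]`
at `a`. -/
lemma mem_perpDisc (M : Model κ X d)
    {a b w : X} (h0 : 0 < dist a b) (hD : κ = 1 → dist a b < Real.pi)
    (h : vs κ (dist b w) = vs κ (dist a b) + vs κ (dist a w) * cs κ (dist a b))
    (hc : 0 ≤ cs κ (dist a w)) {ε : ℝ} (hε : dist a w ≤ ε) : w ∈ perpDisc a b ε := by
  refine ⟨fun z hz => ?_, by rwa [dist_comm]⟩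
  have hs := M.curv.sn_pos h0 hD
  suffices hv : sn κ (dist a b) * vs κ (dist w z) = sn κ (dist a b) *
      (vs κ (dist a w) * cs κ (dist a z) + vs κ (dist a z)) by
    have hv := mul_left_cancel₀ hs.ne' hv
    apply M.dist_le_of_vs_le
    rw [dist_comm w a, hv]
    have h1 := M.curv.mul_vs (dist a z)
    have h2 := M.curv.mul_vs (dist a w)
    have h3 : vs κ (dist a w) * cs κ (dist a z) + vs κ (dist a z) =
        vs κ (dist a w) + vs κ (dist a z) * cs κ (dist a w) := by
      linear_combination vs κ (dist a w) * h1 - vs κ (dist a z) * h2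
    rw [h3]
    have := mul_nonneg (vs_nonneg κ (dist a z)) hc
    linarith
  have hz0 := M.curv.vs_at_zero
  rcases hz with hz | hz | hz
  · have s1 := M.stewart hz w
    have s2 := M.stewart hz a
    have hE : dist a z + dist z b = dist a b := hz
    have s3 := M.curv.sn_add (dist a z) (dist z b)
    have s4 := M.curv.cs_add (dist a z) (dist z b)
    have s5 := M.curv.sq (dist a z)
    rw [hE] at s3 s4
    rw [dist_self, hz0] at s2
    rw [dist_comm w a, dist_comm w b, h] at s1
    have s6 : sn κ (dist z b) + sn κ (dist a z) * cs κ (dist a b) =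
        sn κ (dist a b) * cs κ (dist a z) := by
      rw [s3, s4]; linear_combination (-sn κ (dist z b)) * s5
    linear_combination s1 - s2 + vs κ (dist a w) * s6
  · have s1 := M.stewart hz w
    have s2 := M.stewart hz a
    have hE : dist z a + dist a b = dist z b := hz
    have s3 := M.curv.sn_add (dist z a) (dist a b)
    rw [hE] at s3
    rw [dist_self, hz0] at s2
    rw [dist_comm w a, dist_comm w b, h] at s1
    rw [dist_comm a z] at s2 ⊢
    linear_combination s2 - s1 + vs κ (dist a w) * s3
  · have s1 := M.stewart hz w
    have s2 := M.stewart hz a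
    have hE : dist a b + dist b z = dist a z := hz
    have s3 := M.curv.sn_add (dist a b) (dist b z)
    have s4 := M.curv.cs_add (dist a b) (dist b z)
    have s5 := M.curv.sq (dist a b)
    rw [hE] at s3 s4
    rw [dist_self, hz0] at s2
    rw [dist_comm w a, dist_comm w b, h] at s1
    have s6 : sn κ (dist a z) * cs κ (dist a b) - sn κ (dist b z) =
        sn κ (dist a b) * cs κ (dist a z) := by
      rw [s3, s4]; linear_combination sn κ (dist b z) * s5
    linear_combination s2 - s1 + vs κ (dist a w) * s6

/-- The cylinder about `[a, b]` contains a neighbourhood of `a` in every ball touching it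
at `a`. -/
lemma exists_mem_segCyl (M : Model κ X d)
    {a b p : X} (h0 : 0 < dist a b) (hD : κ = 1 → dist a b < Real.pi)
    (hp : Btw a p b) (hR0 : 0 < dist a p) (hR : κ = 1 → dist a p < Real.pi / 2) {ε : ℝ}
    (hε : 0 < ε) :
    ∃ η > 0, ∀ w, dist p w ≤ dist a p → dist w a ≤ η → w ∈ segCyl a b ε := by
  set D := dist a b with hDd
  set R := dist a p with hRd
  have hpi := Real.pi_pos
  have hsD := M.curv.sn_pos h0 hD
  have hRpi : κ = 1 → R < Real.pi := fun h => by linarith [hR h]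
  have hsR := M.curv.sn_pos hR0 hRpi
  have hcR := M.curv.cs_pos hR0.le hR
  have hz0 := M.curv.vs_at_zero
  have hOm : ∀ w, dist p w ≤ R → vs κ (dist b w) - vs κ D - vs κ (dist a w) * cs κ D ≤ 0 := by
    intro w hw
    have s1 := M.stewart hp w
    have s2 := M.stewart hp a
    have hE : R + dist p b = D := hp
    have s3 := M.curv.sn_add R (dist p b)
    have s4 := M.curv.cs_add R (dist p b)
    have s5 := M.curv.sq R
    rw [hE] at s3 s4
    rw [dist_self, hz0] at s2
    rw [dist_comm w p, dist_comm w a, dist_comm w b] at s1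
    rw [← hDd, ← hRd] at s1 s2
    have s6 : sn κ (dist p b) + sn κ R * cs κ D = sn κ D * cs κ R := by
      rw [s3, s4]; linear_combination (-sn κ (dist p b)) * s5
    have s7 : vs κ (dist p w) ≤ vs κ R := M.curv.vs_le dist_nonneg hw fun h => (hRpi h).le
    have s8 : sn κ R * (vs κ (dist b w) - vs κ D - vs κ (dist a w) * cs κ D) =
        sn κ D * (vs κ (dist p w) - vs κ R) - sn κ D * cs κ R * vs κ (dist a w) := by
      linear_combination (-1) * s1 + s2 - vs κ (dist a w) * s6
    have s9 : sn κ D * (vs κ (dist p w) - vs κ R) ≤ 0 :=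
      mul_nonpos_of_nonneg_of_nonpos hsD.le (by linarith)
    have s10 : 0 ≤ sn κ D * cs κ R * vs κ (dist a w) :=
      mul_nonneg (mul_nonneg hsD.le hcR.le) (vs_nonneg _ _)
    by_contra! hcon
    have := mul_pos hsR hcon
    linarith
  obtain ⟨h, hh0, hh1, hh2, hh3⟩ : ∃ h > 0, h ≤ ε / 2 ∧ h ≤ 1 / 2 ∧
      (κ = 1 → D + 2 * h < Real.pi) := by
    by_cases hk : κ = 1
    · refine ⟨min (min (ε / 2) (1 / 2)) ((Real.pi - D) / 4), ?_, ?_, ?_, fun _ => ?_⟩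
      · exact lt_min (by positivity) (by linarith [hD hk])
      · exact (min_le_left _ _).trans (min_le_left _ _)
      · exact (min_le_left _ _).trans (min_le_right _ _)
      · linarith [min_le_right (min (ε / 2) (1 / 2)) ((Real.pi - D) / 4), hD hk]
    · exact ⟨min (ε / 2) (1 / 2), by positivity, min_le_left _ _, min_le_right _ _,
        fun h => absurd h hk⟩
  have hsh := M.curv.sn_pos hh0 fun h => by linarith [hh3 h]
  have hlim : ∃ r₀ > 0, ∀ r, 0 ≤ r → r < r₀ →
      0 < vs κ (D + h - r) - vs κ D - max (cs κ D) 0 * vs κ (h + r) := by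
    have hcont : Continuous fun r : ℝ =>
        vs κ (D + h - r) - vs κ D - max (cs κ D) 0 * vs κ (h + r) := by
      have := M.curv.continuous_vs
      fun_prop
    have hpos : 0 < vs κ (D + h - 0) - vs κ D - max (cs κ D) 0 * vs κ (h + 0) := by
      rw [sub_zero, add_zero, M.curv.vs_add D h]
      rcases le_total 0 (cs κ D) with hc | hc
      · rw [max_eq_left hc]
        linarith [mul_pos hsD hsh]
      · rw [max_eq_right hc]
        have := M.curv.vs_lt h0.le (show D < D + h by linarith) fun h => by linarith [hh3 h]
        rw [M.curv.vs_add D h] at this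
        linarith
    obtain ⟨r₀, hr₀, hr⟩ := Metric.eventually_nhds_iff.1
      (hcont.continuousAt.eventually (lt_mem_nhds hpos))
    exact ⟨r₀, hr₀, fun r hr1 hr2 => hr (by simpa [abs_of_nonneg hr1] using hr2)⟩
  obtain ⟨r₀, hr₀, hr⟩ := hlim
  refine ⟨min (r₀ / 2) (min h (D / 2)), by positivity, fun w hw hwa => ?_⟩
  have hw1 := hwa.trans (min_le_left _ _)
  have hw2 := (hwa.trans (min_le_right _ _)).trans (min_le_left _ _)
  have hw3 := (hwa.trans (min_le_right _ _)).trans (min_le_right _ _)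
  have hr' := hr (dist w a) dist_nonneg (by linarith)
  have t1 := dist_triangle a w b
  have t2 := dist_triangle w a b
  rw [dist_comm a w] at t1
  set r := dist w a with hrd
  have hB0 : 0 < dist b w := by rw [dist_comm]; linarith
  rw [dist_comm w b] at t1 t2
  set B := dist b w with hBd
  obtain ⟨γ, g0, g1, g2, -⟩ := M.exists_geodesic (dist_pos.1 hB0) fun h => by linarith [hh3 h]
  have gb : ∀ s ∈ Icc B (B + h), dist b (γ s) = s := fun s hs => by
    have h1 := hs.1; have h2 := hs.2
    have h3 : |0 - s| = s := by rw [zero_sub, abs_neg, abs_of_nonneg (by linarith)]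
    rw [← g0, g2, h3]
    intro h; rw [h3]; linarith [hh3 h]
  have gw : ∀ s ∈ Icc B (B + h), dist w (γ s) = s - B := fun s hs => by
    have h1 := hs.1; have h2 := hs.2
    have h3 : |B - s| = s - B := by rw [abs_sub_comm, abs_of_nonneg (by linarith)]
    rw [← hBd] at g1
    rw [← g1, g2, h3]
    intro h; rw [h3]; linarith [hh3 h]
  have gst : ∀ s ∈ Icc B (B + h), ∀ t ∈ Icc B (B + h), dist (γ s) (γ t) = |s - t| :=
    fun s hs t ht => g2 _ _ fun h => by
      rw [abs_le]; constructor <;> linarith [hs.1, hs.2, ht.1, ht.2, hh3 h]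
  have gcont : ContinuousOn γ (Icc B (B + h)) := by
    refine LipschitzOnWith.continuousOn (K := 1) (LipschitzOnWith.of_dist_le_mul ?_)
    intro s hs t ht
    rw [gst s hs t ht, Real.dist_eq, NNReal.coe_one, one_mul]
  have hle : B ≤ B + h := by linarith
  have fcont : ContinuousOn (fun s => vs κ (dist b (γ s)) - vs κ D - vs κ (dist a (γ s)) * cs κ D)
      (Icc B (B + h)) := by
    have hv := M.curv.continuous_vs
    have hd : ∀ x : X, ContinuousOn (fun s => vs κ (dist x (γ s))) (Icc B (B + h)) := fun x =>
      (hv.comp (continuous_const.dist continuous_id)).comp_continuousOn gcont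
    exact ((hd b).sub continuousOn_const).sub ((hd a).mul continuousOn_const)
  have hmem1 : B ∈ Icc B (B + h) := ⟨le_rfl, hle⟩
  have hmem2 : B + h ∈ Icc B (B + h) := ⟨hle, le_rfl⟩
  have da : ∀ s ∈ Icc B (B + h), dist a (γ s) ≤ r + h := fun s hs => by
    have := dist_triangle a w (γ s)
    rw [gw s hs, dist_comm a w, ← hrd] at this
    linarith [hs.2]
  obtain ⟨s, hs, hfs⟩ := intermediate_value_Icc hle fcont (show (0 : ℝ) ∈ Icc _ _ from ⟨by
      rw [← hBd] at g1
      simp only [g1]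
      exact hOm w hw, by
      simp only [gb _ hmem2]
      have h1 : vs κ (D + h - r) ≤ vs κ (B + h) :=
        M.curv.vs_le (by linarith) (by linarith) fun h => by linarith [hh3 h]
      have h2 : vs κ (dist a (γ (B + h))) ≤ vs κ (h + r) :=
        M.curv.vs_le dist_nonneg (by linarith [da _ hmem2]) fun h => by linarith [hh3 h]
      have h3 : vs κ (dist a (γ (B + h))) * cs κ D ≤ max (cs κ D) 0 * vs κ (h + r) := by
        rw [mul_comm]
        exact mul_le_mul (le_max_left _ _) h2 (vs_nonneg _ _) (le_max_right _ _)
      linarith⟩)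
  have hda := da s hs
  have hmem : γ s ∈ perpDisc a b ε :=
    M.mem_perpDisc h0 hD (by linarith [hfs])
      (M.curv.cs_pos dist_nonneg fun _ => by linarith [Real.pi_gt_three]).le (by linarith)
  refine gconvex_gconvexHull _ b (subset_gconvexHull _ (Or.inr ?_)) (γ s)
    (subset_gconvexHull _ (Or.inl hmem)) w (M.uniqueBtwPt (fun h => ?_) ?_)
  · exact ⟨fun z _ => by simp, by simpa using hε.le⟩
  · rw [gb s hs]; linarith [hs.2, hh3 h]
  · unfold Btw
    rw [gw s hs, gb s hs, ← hBd]; ring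

/-- The hull of a set inside a ball and away from its point `b`, together with a subset of a
smaller ball touching at `b`, stays inside the smaller ball near `b`. -/
lemma exists_hull_subset_ball (M : Model κ X d) {b c m : X} (hc : Btw b c m) (hP : 0 < dist b c)
    (hPρ : dist b c < dist b m) (hρ : κ = 1 → dist b m < Real.pi / 2) {A B : Set X}
    (hA : A ⊆ closedBall m (dist b m)) (hB : B ⊆ closedBall c (dist b c)) {d₀ : ℝ} (hd₀ : 0 < d₀)
    (hAb : ∀ z ∈ A, d₀ ≤ dist z b) :
    ∃ η > 0, ∀ w ∈ gconvexHull (A ∪ B), dist w b ≤ η → dist c w ≤ dist b c := by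
  have hE : dist b c + dist c m = dist b m := hc
  set P := dist b c with hPd
  set ρ := dist b m with hρd
  have hpi := Real.pi_pos
  have hcP := M.curv.cs_pos hP.le fun h => by linarith [hρ h]
  have hsP := M.curv.sn_pos hP fun h => by linarith [hρ h]
  have hρ0 : 0 < ρ := by linarith
  have hsρ := M.curv.sn_pos hρ0 fun h => by linarith [hρ h]
  have hcρ := M.curv.cs_pos hρ0.le hρ
  have hBm : B ⊆ closedBall m ρ :=
    hB.trans (closedBall_subset_closedBall' (by linarith))
  have hG : GConvex (closedBall m ρ) := M.ball_gconvex hρ0.le hρ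
  have hsub : gconvexHull (A ∪ B) ⊆ closedBall m ρ := gconvexHull_min hG (union_subset hA hBm)
  -- the comparison factor
  obtain ⟨lam, hlam, hA'⟩ : ∃ lam < 1, ∀ z ∈ A, phi κ c P z ≤ lam * vs κ (dist z b) := by
    refine ⟨sn κ (dist c m) / (sn κ ρ * cs κ P), ?_, fun z hz => ?_⟩
    · rw [div_lt_one (mul_pos hsρ hcP)]
      have s1 := M.curv.sn_add ρ (-P)
      rw [M.curv.sn_neg, M.curv.cs_neg, show ρ + -P = dist c m by linarith] at s1
      linarith [mul_pos hcρ hsP]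
    · have s1 := M.stewart hc z
      have s2 := M.stewart hc b
      rw [dist_self, M.curv.vs_at_zero] at s2
      rw [← hPd, ← hρd] at s1 s2
      have hzm : vs κ (dist z m) ≤ vs κ ρ :=
        M.curv.vs_le dist_nonneg (hA hz) fun h => by linarith [hρ h]
      have s3 := mul_le_mul_of_nonneg_left hzm hsP.le
      rw [phi, div_mul_eq_mul_div, div_le_div_iff₀ hcP (mul_pos hsρ hcP), dist_comm c z]
      have s4 : sn κ ρ * (vs κ (dist z c) - vs κ P) ≤ sn κ (dist c m) * vs κ (dist z b) := by
        linarith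
      have := mul_le_mul_of_nonneg_right s4 hcP.le
      linarith
  have hv0 : 0 < (1 - lam) * vs κ (min d₀ 1) :=
    mul_pos (by linarith) (M.curv.vs_pos (by positivity) fun h =>
      (min_le_right _ _).trans (by linarith [Real.pi_gt_three]))
  obtain ⟨t₀, ht₀, hunif⟩ := Metric.uniformContinuousOn_iff.1
    (isCompact_Icc.uniformContinuousOn_of_continuous
      (M.curv.continuous_vs.continuousOn (s := Icc 0 (2 * ρ + 1)))) _ hv0
  refine ⟨min (t₀ / 3) (1 / 3), by positivity, fun w hw hwb => ?_⟩
  have hw1 := hwb.trans (min_le_left _ _)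
  have hw2 := hwb.trans (min_le_right _ _)
  by_contra! hcw
  have hwm := mem_closedBall.1 (hsub hw)
  have hcwD : κ = 1 → dist c w < Real.pi := fun h => by
    linarith [dist_triangle_right c w m, hρ h]
  obtain ⟨γ, -, -, -, q3, -⟩ := M.exists_seg hcwD
  obtain ⟨q4, q5, q6⟩ := q3 P ⟨hP.le, hcw.le⟩
  set w' := γ P
  have hww : dist w' w ≤ dist w b := by linarith [dist_triangle c b w, dist_comm c b, dist_comm b w]
  have hw'b : dist w' b < t₀ ∧ dist w' b ≤ 1 := by
    have := dist_triangle w' w b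
    constructor <;> linarith
  have key : gconvexHull (A ∪ B) ⊆
      {z | z ∈ closedBall m ρ ∧ phi κ c P z - vs κ (dist w' z) ≤ 0} := by
    refine gconvexHull_min ?_ (union_subset (fun z hz => ⟨hA hz, ?_⟩) fun z hz => ⟨hBm hz, ?_⟩)
    · rintro x ⟨hx, hx'⟩ y ⟨hy, hy'⟩ z hz
      refine ⟨hG x hx y hy z hz, ?_⟩
      have hD : κ = 1 → dist x y < Real.pi := fun h => by
        linarith [dist_triangle_right x y m, hρ h, mem_closedBall.1 hx, mem_closedBall.1 hy]
      obtain ⟨α, β, q, hα, hβ, hq, -, hsum, hm, -⟩ := M.btw_coeffs hD hz.1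
      rw [M.phi_combo hsum hm hcP, hm w']
      linarith [mul_nonpos_of_nonneg_of_nonpos hα hx', mul_nonpos_of_nonneg_of_nonpos hβ hy']
    · have h1 := hA' z hz
      have h2 := hAb z hz
      have h3 : dist z b ≤ 2 * ρ := by
        have := mem_closedBall.1 (hA hz)
        linarith [dist_triangle_right z b m]
      have h4 := abs_dist_sub_le w' b z
      have h5 := abs_le.1 h4
      have h6 := hunif (dist z b) ⟨dist_nonneg, by linarith⟩ (dist w' z)
        ⟨dist_nonneg, by rw [dist_comm b z] at h5; linarith [h5.2, hw'b.2]⟩ (by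
          rw [Real.dist_eq, dist_comm z b, abs_sub_comm]; exact h4.trans_lt hw'b.1)
      rw [Real.dist_eq] at h6
      have h7 := (abs_lt.1 h6).2
      have h8 : vs κ (min d₀ 1) ≤ vs κ (dist z b) :=
        M.curv.vs_le (by positivity) ((min_le_left _ _).trans h2) fun h => M.dist_le h _ _
      have h9 := mul_le_mul_of_nonneg_left h8 (show 0 ≤ 1 - lam by linarith)
      linarith
    · have h1 := (M.phi_nonpos_iff hP.le hcP (fun h => by linarith [hρ h]) z).2
        (mem_closedBall'.1 (hB hz))
      linarith [vs_nonneg κ (dist w' z)]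
  have hT := (key hw).2
  have hE' : P + dist w' w = dist c w := by rw [q5]; ring
  rw [phi, ← hE', M.curv.vs_add] at hT
  have h0 : 0 < dist w' w := by linarith
  have h1 := mul_pos hsP (M.curv.sn_pos h0 fun h => by linarith [hcwD h])
  have h2 : (vs κ P + vs κ (dist w' w) * cs κ P + sn κ P * sn κ (dist w' w) - vs κ P) / cs κ P -
      vs κ (dist w' w) = sn κ P * sn κ (dist w' w) / cs κ P := by
    field_simp; ring
  rw [h2] at hT
  exact absurd hT (not_le.2 (by positivity))

lemma eq_of_touch (M : Model κ X d)
    {m p a z : X} {ρ R : ℝ} (hR : R < ρ) (hρ : κ = 1 → ρ < Real.pi / 2)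
    (hR0 : 0 ≤ R) (hmp : dist m p = ρ - R) (hpa : dist p a = R) (hma : dist m a = ρ)
    (hpz : dist p z ≤ R) (hmz : ρ ≤ dist m z) : z = a := by
  have h1 : dist p z = R := by linarith [dist_triangle m p z]
  refine M.btw_extend_unique (x := m) (y := p) (by linarith)
    (fun h => by linarith [hρ h, Real.pi_pos]) ?_ ?_ (by rw [h1, hpa])
  · unfold Btw; linarith [dist_triangle m p z]
  · unfold Btw; linarith

end Model

/-- Some symmetry of a truncated hull exchanges the endpoints of its diametral segment. -/
def SwapCond (d : ℕ) (K L : Set X) : Prop :=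
  ∃ δ > (0 : ℝ), ∀ φ ψ : X ≃ᵢ X, GoodPair d K L φ ψ →
    ∀ x ∈ frontier K, ∀ y ∈ frontier L,
      BigDiam d X (hullUnion K L φ ψ) δ →
      UniqueDiametral (hullUnion K L φ ψ) (φ x) (ψ y) →
      ∃ ε > (0 : ℝ), ∃ σ : X ≃ᵢ X, σ (φ x) = ψ y ∧ σ (ψ y) = φ x ∧
        σ '' (hullUnion K L φ ψ ∩ segCyl (φ x) (ψ y) ε) =
          hullUnion K L φ ψ ∩ segCyl (φ x) (ψ y) ε

lemma swapCond_of_cond5 {d : ℕ} {K L : Set X} (h : T7Cond5 d K L) : SwapCond d K L := by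
  obtain ⟨δ, hδ, h⟩ := h
  refine ⟨δ, hδ, fun φ ψ hg x hx y hy hbig hud => ?_⟩
  obtain ⟨ε₀, hε₀, hε⟩ := h φ ψ hg x hx y hy hbig hud
  obtain ⟨-, σ, p, -, -, h3, h4⟩ := hε (ε₀ / 2) (by positivity) (by linarith)
  obtain ⟨h5, h6⟩ := hud.swap inter_subset_left ⟨hud.1, left_mem_segCyl _ _ (by positivity)⟩
    ⟨hud.2.1, right_mem_segCyl _ _ (by positivity)⟩ h3 h4
  exact ⟨ε₀ / 2, by positivity, σ, h5, h6, h3⟩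

lemma swapCond_of_cond6 {d : ℕ} {K L : Set X} (h : T7Cond6 d K L) : SwapCond d K L := by
  obtain ⟨δ, hδ, h⟩ := h
  refine ⟨δ, hδ, fun φ ψ hg x hx y hy hbig hud => ?_⟩
  obtain ⟨ε₀, hε₀, hε⟩ := h φ ψ hg x hx y hy hbig hud
  obtain ⟨-, σ, h1, h2, h3⟩ := hε (ε₀ / 2) (by positivity) (by linarith)
  exact ⟨ε₀ / 2, by positivity, σ, h2, by rw [← h2, h1.apply_apply], h3⟩

lemma hullUnion_comm (K L : Set X) (φ ψ : X ≃ᵢ X) : hullUnion K L φ ψ = hullUnion L K ψ φ := by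
  rw [hullUnion, union_comm, hullUnion]

lemma UniqueDiametral.symm {N : Set X} {a b : X} (h : UniqueDiametral N a b) :
    UniqueDiametral N b a := by
  obtain ⟨ha, hb, hab, hd, hu⟩ := h
  exact ⟨hb, ha, hab.symm, by rw [dist_comm, hd], fun x hx y hy h => (hu x hx y hy h).symm⟩

lemma SwapCond.symm {d : ℕ} {K L : Set X} (h : SwapCond d K L) : SwapCond d L K := by
  obtain ⟨δ, hδ, h⟩ := h
  refine ⟨δ, hδ, fun φ ψ hg x hx y hy hbig hud => ?_⟩
  rw [hullUnion_comm] at hbig hud ⊢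
  obtain ⟨ε, hε, σ, h1, h2, h3⟩ := h ψ φ ⟨hg.2.1, hg.1, fun h => by
    rw [union_comm]; exact hg.2.2 h⟩ y hy x hx hbig hud.symm
  exact ⟨ε, hε, σ, h2, h1, by rw [segCyl_comm]; exact h3⟩

namespace Model
variable {κ : ℝ} {d : ℕ}

lemma exists_local_ball (M : Model κ X d)
    (hd : 2 ≤ d) (hS : IsSphereSpace X d ↔ κ = 1) {K L : Set X}
    (hKcl : IsClosed K) (hLcl : IsClosed L) (hK : SupportingSpheres d K) (hKL : SwapCond d K L)
    {P : ℝ} (hP : 0 < P) (hP1 : κ = 1 → P < Real.pi / 2) {y p₂ : X} (hy : y ∈ frontier L)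
    (hL : L ⊆ closedBall p₂ P) (hyp : dist p₂ y = P) :
    ∀ x ∈ frontier K, ∃ c : X, ∃ η > 0, dist c x = P ∧ ∀ k ∈ K, dist k x ≤ η → dist c k ≤ P := by
  obtain ⟨δ, hδ, hKL⟩ := hKL
  intro a ha
  obtain ⟨p₁, R, hR, hKp, hap, hR1⟩ := hK a ha
  rw [hS] at hR1
  rw [mem_sphere] at hap
  have hpi := Real.pi_pos
  obtain ⟨ρ, hRρ, hPρ, hρ1, hρ2⟩ : ∃ ρ, R < ρ ∧ P < ρ ∧
      (κ = 1 → ρ < Real.pi / 2 ∧ Real.pi - δ < 2 * ρ) ∧ (κ ≠ 1 → 1 / δ < 2 * ρ) := by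
    by_cases h : κ = 1
    · obtain ⟨ρ, h1, h2⟩ := exists_between (a₁ := max (max R P) ((Real.pi - δ) / 2))
        (a₂ := Real.pi / 2) (max_lt (max_lt (hR1 h) (hP1 h)) (by linarith))
      rw [max_lt_iff, max_lt_iff] at h1
      exact ⟨ρ, h1.1.1, h1.1.2, fun _ => ⟨h2, by linarith [h1.2]⟩, fun h' => absurd h h'⟩
    · obtain ⟨ρ, h1⟩ := exists_gt (max (max R P) (1 / δ / 2))
      rw [max_lt_iff, max_lt_iff] at h1
      exact ⟨ρ, h1.1.1, h1.1.2, fun h' => absurd h' h, fun _ => by linarith [h1.2]⟩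
  have hρ1' := fun h => (hρ1 h).1
  obtain ⟨γ, g0, g1, g2, -⟩ := M.exists_geodesic (x := a) (y := p₁)
    (dist_pos.1 (by rw [hap]; exact hR)) (fun h => by rw [hap]; linarith [hR1 h])
  rw [hap] at g1
  have g3 : ∀ s t, 0 ≤ s → s ≤ t → t ≤ 2 * ρ → dist (γ s) (γ t) = t - s := by
    intro s t h1 h2 h3
    have : |s - t| = t - s := by rw [abs_sub_comm, abs_of_nonneg (by linarith)]
    rw [g2, this]
    intro h; rw [this]; linarith [hρ1' h]
  set m := γ ρ with hm
  set b := γ (2 * ρ) with hb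
  set c := γ (2 * ρ - P) with hc
  have e_ab : dist a b = 2 * ρ := by rw [← g0, g3] <;> linarith
  have e_am : dist a m = ρ := by rw [← g0, g3] <;> linarith
  have e_mb : dist m b = ρ := by rw [hm, g3] <;> linarith
  have e_pm : dist p₁ m = ρ - R := by rw [← g1, g3] <;> linarith
  have e_pb : dist p₁ b = 2 * ρ - R := by rw [← g1, g3] <;> linarith
  have e_cb : dist c b = P := by rw [hc, g3] <;> linarith
  have e_mc : dist m c = ρ - P := by rw [hm, g3] <;> linarith
  obtain ⟨ψ, hψ, hψy, hψp⟩ := M.exists_orientationPreserving hd (y := y) (p := p₂) (b := b) (c := c)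
    (by rw [dist_comm y, hyp, dist_comm b, e_cb])
  set φ := IsometryEquiv.refl X
  have hφK : φ '' K = K := image_id K
  have haK := hKcl.frontier_subset ha
  have hφa : φ a = a := rfl
  set B := ψ '' L with hBd
  have hB : B ⊆ closedBall c P := by
    rw [hBd, ← hψp, ← ψ.image_closedBall]; exact image_mono hL
  have hbB : b ∈ B := ⟨y, hLcl.frontier_subset hy, hψy⟩
  have hN : hullUnion K L φ ψ = gconvexHull (K ∪ B) := by rw [hullUnion, hφK]
  -- the hull meets the big sphere only in `a` and `b`
  have hU : K ∪ B ⊆ {z | dist m z ≤ ρ ∧ (ρ ≤ dist m z → z = a ∨ z = b)} := by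
    rintro z (hz | hz)
    · have h1 := mem_closedBall'.1 (hKp hz)
      refine ⟨by linarith [dist_triangle m p₁ z, dist_comm m p₁], fun h => Or.inl ?_⟩
      exact M.eq_of_touch hRρ hρ1' hR.le (by rw [dist_comm, e_pm]) (by rw [dist_comm, hap])
        (by rw [dist_comm, e_am]) h1 h
    · have h1 := mem_closedBall'.1 (hB hz)
      refine ⟨by linarith [dist_triangle m c z], fun h => Or.inr ?_⟩
      exact M.eq_of_touch hPρ hρ1' hP.le e_mc e_cb e_mb h1 h
  have hρ0 : 0 < ρ := by linarith
  have hNU : gconvexHull (K ∪ B) ⊆ {z | dist m z ≤ ρ ∧ (ρ ≤ dist m z → z = a ∨ z = b)} := by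
    refine gconvexHull_min ?_ hU
    intro x hx y hy z hz
    by_cases h1 : z = x
    · rwa [h1]
    by_cases h2 : z = y
    · rwa [h2]
    have := M.ball_strict hρ0.le hρ1' hx.1 hy.1 hz.1 h1 h2
    exact ⟨this.le, fun h => absurd this (not_lt.2 h)⟩
  have haN : a ∈ gconvexHull (K ∪ B) := subset_gconvexHull _ (Or.inl haK)
  have hbN : b ∈ gconvexHull (K ∪ B) := subset_gconvexHull _ (Or.inr hbB)
  have hball : gconvexHull (K ∪ B) ⊆ closedBall m ρ := fun z hz => mem_closedBall'.2 (hNU hz).1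
  have hle : ∀ x ∈ gconvexHull (K ∪ B), ∀ y ∈ gconvexHull (K ∪ B), dist x y ≤ 2 * ρ :=
    fun x hx y hy => by linarith [dist_triangle_left x y m, (hNU hx).1, (hNU hy).1]
  have hdiam : diam (gconvexHull (K ∪ B)) = 2 * ρ := by
    refine le_antisymm (diam_le_of_forall_dist_le (by linarith) hle) ?_
    rw [← e_ab]
    exact dist_le_diam_of_mem (isBounded_closedBall.subset hball) haN hbN
  have hud : UniqueDiametral (gconvexHull (K ∪ B)) a b := by
    refine ⟨haN, hbN, dist_pos.1 (by rw [e_ab]; linarith), by rw [e_ab, hdiam], ?_⟩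
    intro x hx y hy h
    rw [hdiam] at h
    have h1 := hNU hx
    have h2 := hNU hy
    have h3 := dist_triangle_left x y m
    have hxy : x ≠ y := dist_pos.1 (by rw [h]; linarith)
    rcases h1.2 (by linarith [h2.1]) with rfl | rfl <;>
      rcases h2.2 (by linarith [h1.1]) with rfl | rfl
    · exact absurd rfl hxy
    · exact Or.inl ⟨rfl, rfl⟩
    · exact Or.inr ⟨rfl, rfl⟩
    · exact absurd rfl hxy
  have hgood : GoodPair d K L φ ψ := by
    refine ⟨orientationPreserving_refl, hψ, fun h => ⟨m, fun z hz => ?_⟩⟩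
    rw [hφK] at hz
    exact mem_ball'.2 (((hU hz).1).trans_lt (hρ1' (hS.1 h)))
  have hbig : BigDiam d X (hullUnion K L φ ψ) δ := by
    rw [hN]
    refine ⟨fun h => ?_, fun h => ?_⟩
    · rw [hdiam]; exact (hρ1 (hS.1 h)).2
    · rw [hdiam]; exact hρ2 fun h' => h (hS.2 h')
  obtain ⟨ε, hε, σ, s1, s2, s3⟩ := hKL φ ψ hgood a ha y hy hbig (by rw [hN, hφa, hψy]; exact hud)
  rw [hN, hφa, hψy] at s3
  rw [hφa, hψy] at s1 s2
  obtain ⟨η₁, hη₁, hη₁'⟩ := M.exists_hull_subset_ball (b := b) (c := c) (m := m) (A := K) (B := B)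
    (by unfold Btw; rw [dist_comm b c, dist_comm c m, dist_comm b m]; linarith)
    (by rw [dist_comm, e_cb]; exact hP) (by rw [dist_comm, e_cb, dist_comm, e_mb]; exact hPρ)
    (by rw [dist_comm, e_mb]; exact hρ1')
    (by rw [dist_comm b, e_mb]
        exact (subset_union_left.trans (subset_gconvexHull _)).trans hball)
    (by rw [dist_comm b, e_cb]; exact hB) (d₀ := 2 * ρ - 2 * R) (by linarith) (fun z hz => by
      have := mem_closedBall'.1 (hKp hz)
      linarith [dist_triangle p₁ z b])
  obtain ⟨η₂, hη₂, hη₂'⟩ := M.exists_mem_segCyl (a := a) (b := b) (p := p₁)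
    (by rw [e_ab]; linarith) (fun h => by rw [e_ab]; linarith [hρ1' h])
    (by unfold Btw; linarith) (by rw [hap]; exact hR) (by rw [hap]; exact hR1) hε
  refine ⟨σ.symm c, min η₁ η₂, lt_min hη₁ hη₂, ?_, fun k hk hka => ?_⟩
  · rw [← σ.dist_eq, σ.apply_symm_apply, s1, e_cb]
  · have h1 : k ∈ gconvexHull (K ∪ B) ∩ segCyl a b ε :=
      ⟨subset_gconvexHull _ (Or.inl hk), hη₂' k (by rw [hap]; exact mem_closedBall'.1 (hKp hk))
        (hka.trans (min_le_right _ _))⟩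
    have h2 := mem_image_of_mem σ h1
    rw [s3] at h2
    have h3 := hη₁' (σ k) h2.1 (by rw [← s1, σ.dist_eq]; exact hka.trans (min_le_left _ _))
    rwa [dist_comm b, e_cb, ← σ.apply_symm_apply c, σ.dist_eq] at h3

/-- A body with supporting spheres lies in a ball. -/
lemma exists_bounding_ball (M : Model κ X d)
    (hS : IsSphereSpace X d ↔ κ = 1) {K : Set X} (hKcl : IsClosed K)
    (hKne : K.Nonempty) (hKpr : K ≠ univ)
    (hKhemi : IsSphereSpace X d → ∃ p : X, K ⊆ ball p (Real.pi / 2))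
    (hKsupp : SupportingSpheres d K) :
    ∃ (p : X) (R : ℝ), K ⊆ closedBall p R ∧ (κ = 1 → R < Real.pi / 2) := by
  by_cases hκ : κ = 1
  · obtain ⟨p, hp⟩ := hKhemi (hS.2 hκ)
    have hKc : IsCompact K := (M.isCompact_closedBall p (Real.pi / 2)).of_isClosed_subset hKcl
      (hp.trans ball_subset_closedBall)
    obtain ⟨z, hz, hm⟩ := hKc.exists_isMaxOn hKne
      ((continuous_id.dist continuous_const).continuousOn (f := fun x => dist x p))
    exact ⟨p, dist z p, fun w hw => hm hw, fun _ => hp hz⟩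
  · obtain ⟨a, ha⟩ := hKne
    obtain ⟨b, hb⟩ := (ne_univ_iff_exists_notMem K).1 hKpr
    obtain ⟨x, hx, -⟩ := M.exists_exit hKcl (fun h => absurd h hκ) ha hb
    obtain ⟨p, R, -, hR, -⟩ := hKsupp x hx
    exact ⟨p, R, hR, fun h => absurd h hκ⟩

/-- A body lying in a ball has a ball of minimal radius containing it. -/
lemma exists_circumball (M : Model κ X d) (hd : 2 ≤ d) {K : Set X} (hKc : IsCompact K)
    (hKi : (interior K).Nonempty) {p₀ : X} {R₀ : ℝ} (hb : K ⊆ closedBall p₀ R₀)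
    (hR : κ = 1 → R₀ < Real.pi / 2) :
    ∃ (q : X) (P : ℝ), 0 < P ∧ (κ = 1 → P < Real.pi / 2) ∧ K ⊆ closedBall q P ∧
      ∀ p, ∃ z ∈ K, P ≤ dist p z := by
  have hne : K.Nonempty := hKi.mono interior_subset
  obtain ⟨k, hk⟩ := hne
  have hR0 : 0 ≤ R₀ := dist_nonneg.trans (hb hk)
  let T : Set (X × ℝ) := (closedBall p₀ (2 * R₀) ×ˢ Icc 0 R₀) ∩
    ⋂ z ∈ K, {a | dist a.1 z ≤ a.2}
  have hT : IsCompact T := by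
    refine ((M.isCompact_closedBall _ _).prod isCompact_Icc).inter_right ?_
    exact isClosed_biInter fun z _ =>
      isClosed_le (continuous_fst.dist continuous_const) continuous_snd
  have hmem : ∀ p r, r ≤ R₀ → (∀ z ∈ K, dist p z ≤ r) → (p, r) ∈ T := by
    intro p r hr h
    refine ⟨⟨?_, dist_nonneg.trans (h k hk), hr⟩, mem_iInter₂.2 h⟩
    have h1 : dist k p₀ ≤ R₀ := hb hk
    show dist p p₀ ≤ _
    linarith [dist_triangle p k p₀, h k hk]
  obtain ⟨⟨q, P⟩, hq, hmin⟩ := hT.exists_isMinOn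
    ⟨(p₀, R₀), hmem p₀ R₀ le_rfl fun z hz => mem_closedBall'.1 (hb hz)⟩
    (continuous_snd.continuousOn (f := (Prod.snd : X × ℝ → ℝ)))
  have hKq : ∀ z ∈ K, dist q z ≤ P := fun z hz => (mem_iInter₂.1 hq.2 z hz :)
  have hPR : P ≤ R₀ := hq.1.2.2
  refine ⟨q, P, ?_, fun h => hPR.trans_lt (hR h), fun z hz => mem_closedBall'.2 (hKq z hz),
    fun p => ?_⟩
  · by_contra hP
    have hq' : ∀ z ∈ K, z = q := fun z hz =>
      (dist_le_zero.1 ((hKq z hz).trans (not_lt.1 hP))).symm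
    obtain ⟨a, ha⟩ := hKi
    obtain ⟨ε, hε, hεK⟩ := Metric.isOpen_iff.1 isOpen_interior a ha
    obtain ⟨z, -, -, hz, -⟩ := M.exists_two_equidistant hd a a (t := min (ε / 2) 1)
      (lt_min (by linarith) one_pos)
      (fun _ => (min_le_right _ _).trans (by linarith [Real.pi_gt_three]))
    have hzK : z ∈ K := interior_subset (hεK (mem_ball'.2 (by
      rw [hz]; exact (min_le_left _ _).trans_lt (by linarith))))
    rw [hq' z hzK, hq' a (interior_subset ha), dist_self] at hz
    exact (lt_min (show 0 < ε / 2 by linarith) one_pos).ne hz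
  · obtain ⟨z, hz, hm⟩ := hKc.exists_isMaxOn ⟨k, hk⟩
      ((continuous_const.dist continuous_id).continuousOn (f := fun x => dist p x))
    refine ⟨z, hz, ?_⟩
    by_contra hc
    have := hmin (hmem p (dist p z) ((not_le.1 hc).le.trans hPR) fun w hw => hm hw)
    exact hc this

/-- A point of a body on the boundary of a ball containing the body is a boundary point. -/
lemma mem_frontier_of_touch (M : Model κ X d) {K : Set X} {q y : X} {P : ℝ} (hP : 0 < P)
    (hP1 : κ = 1 → P < Real.pi / 2) (hK : K ⊆ closedBall q P) (hy : y ∈ K) (hqy : dist q y = P) :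
    y ∈ frontier K := by
  refine ⟨subset_closure hy, fun hyi => ?_⟩
  obtain ⟨ε, hε, hεK⟩ := Metric.isOpen_iff.1 isOpen_interior y hyi
  obtain ⟨γ, h0, h1, hγ, -⟩ := M.exists_geodesic (x := q) (y := y)
    (dist_pos.1 (by rw [hqy]; exact hP)) (fun h => by rw [hqy]; linarith [hP1 h, Real.pi_pos])
  rw [hqy] at h1
  set s := min (ε / 2) 1
  have hs : 0 < s := lt_min (by linarith) one_pos
  have hs1 : s ≤ 1 := min_le_right _ _
  have hs2 : s ≤ ε / 2 := min_le_left _ _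
  have h2 : dist (γ P) (γ (P + s)) = s := by
    rw [hγ _ _ fun h => ?_]
    · rw [abs_sub_comm, add_sub_cancel_left, abs_of_pos hs]
    · rw [abs_sub_comm, add_sub_cancel_left, abs_of_pos hs]; linarith [Real.pi_gt_three]
  have h3 : dist (γ 0) (γ (P + s)) = P + s := by
    rw [hγ _ _ fun h => ?_]
    · rw [abs_sub_comm, sub_zero, abs_of_pos (by linarith)]
    · rw [abs_sub_comm, sub_zero, abs_of_pos (by linarith)]
      linarith [Real.pi_gt_three, hP1 h]
  have h4 : γ (P + s) ∈ K := interior_subset (hεK (mem_ball'.2 (by rw [← h1, h2]; linarith)))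
  have h5 := mem_closedBall'.1 (hK h4)
  rw [← h0, h3] at h5
  linarith

/-- A body whose boundary points all have local supporting balls of the circumradius is a ball. -/
lemma eq_closedBall (M : Model κ X d) (hd : 2 ≤ d) {K : Set X} (hKc : IsCompact K) (hK : GConvex K)
    (hKi : (interior K).Nonempty) {q : X} {P : ℝ} (hP : 0 < P)
    (hP1 : κ = 1 → P < Real.pi / 2) (hKq : K ⊆ closedBall q P)
    (hmin : ∀ p, ∃ z ∈ K, P ≤ dist p z)
    (hloc : ∀ w ∈ frontier K, ∃ c, ∃ η > 0, dist c w = P ∧ ∀ k ∈ K, dist k w ≤ η → dist c k ≤ P) :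
    K = closedBall q P := by
  have hKd : κ = 1 → ∀ x ∈ K, ∀ y ∈ K, dist x y < Real.pi := fun h x hx y hy => by
    have h1 := mem_closedBall.1 (hKq hx)
    have h2 := mem_closedBall'.1 (hKq hy)
    linarith [dist_triangle x q y, hP1 h]
  have hfr : ∀ x ∈ frontier K, dist q x = P := by
    intro x hx
    obtain ⟨c, η, hη, hcx, hl⟩ := hloc x hx
    have hc : ∀ z ∈ K, dist c z ≤ P := fun z hz =>
      M.local_to_global hd hKc hK hKi hKd hP hP1 hloc hx hη hcx hl hz
    by_cases hcq : c = q
    · rwa [← hcq]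
    have hxK : x ∈ K := hKc.isClosed.frontier_subset hx
    obtain ⟨m, hm, hm'⟩ := M.exists_midpoint (x := c) (y := q) fun h => by
      linarith [dist_triangle c x q, hc x hxK, mem_closedBall.1 (hKq hxK), hP1 h]
    have hcq' := dist_pos.2 hcq
    have hm1 : m ≠ c := by
      rintro rfl; rw [dist_self] at hm'; exact hcq (dist_eq_zero.1 hm'.symm)
    have hm2 : m ≠ q := by
      rintro rfl; rw [dist_self] at hm'; exact hcq (dist_eq_zero.1 hm')
    obtain ⟨z, hz, hzm⟩ := hmin m
    have := M.ball_strict (c := z) hP.le hP1 (by rw [dist_comm]; exact hc z hz) (hKq hz) hm hm1 hm2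
    rw [dist_comm] at this
    linarith
  refine hKq.antisymm fun w hw => ?_
  by_contra hwK
  obtain ⟨k, hk⟩ := hKi
  have hkK := interior_subset hk
  obtain ⟨z, hz, hkz⟩ := M.exists_exit (a := k) (b := w) hKc.isClosed (fun h => by
    linarith [dist_triangle k q w, mem_closedBall.1 (hKq hkK), mem_closedBall'.1 hw, hP1 h])
    hkK hwK
  have h1 := M.ball_strict (c := q) hP.le hP1 (mem_closedBall'.1 (hKq hkK)) (mem_closedBall'.1 hw)
    hkz (fun h => hz.2 (h ▸ hk)) (fun h => hwK (h ▸ hKc.isClosed.frontier_subset hz))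
  exact h1.ne (hfr z hz)

/-- If all boundary points of a body have local supporting balls of radius `P`, then the body
lies in such a ball. -/
lemma circumradius_le (M : Model κ X d)
    (hd : 2 ≤ d) {K : Set X} (hKc : IsCompact K) (hK : GConvex K)
    (hKi : (interior K).Nonempty) {q : X} {P P' : ℝ} (hP : 0 < P)
    (hP1 : κ = 1 → P < Real.pi / 2) (hKq : K ⊆ closedBall q P)
    (hmin : ∀ p, ∃ z ∈ K, P ≤ dist p z) (hP' : 0 < P') (hP1' : κ = 1 → P' < Real.pi / 2)
    (hloc : ∀ w ∈ frontier K, ∃ c, ∃ η > 0, dist c w = P' ∧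
      ∀ k ∈ K, dist k w ≤ η → dist c k ≤ P') : P ≤ P' := by
  have hKd : κ = 1 → ∀ x ∈ K, ∀ y ∈ K, dist x y < Real.pi := fun h x hx y hy => by
    have h1 := mem_closedBall.1 (hKq hx)
    have h2 := mem_closedBall'.1 (hKq hy)
    linarith [dist_triangle x q y, hP1 h]
  obtain ⟨y, hy, hqy⟩ := hmin q
  have hyf := M.mem_frontier_of_touch hP hP1 hKq hy
    (le_antisymm (mem_closedBall'.1 (hKq hy)) hqy)
  obtain ⟨c, η, hη, hcx, hl⟩ := hloc y hyf
  obtain ⟨z, hz, hcz⟩ := hmin c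
  exact hcz.trans (M.local_to_global hd hKc hK hKi hKd hP' hP1' hloc hyf hη hcx hl hz)

lemma cond7_of_swapCond (M : Model κ X d)
    (hd : 2 ≤ d) (hS : IsSphereSpace X d ↔ κ = 1) {K L : Set X}
    (hKcl : IsClosed K) (hLcl : IsClosed L)
    (hKcv : GConvex K) (hLcv : GConvex L)
    (hKint : (interior K).Nonempty) (hLint : (interior L).Nonempty)
    (hKpr : K ≠ univ) (hLpr : L ≠ univ)
    (hKhemi : IsSphereSpace X d → ∃ p : X, K ⊆ ball p (Real.pi / 2))
    (hLhemi : IsSphereSpace X d → ∃ p : X, L ⊆ ball p (Real.pi / 2))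
    (hKsupp : SupportingSpheres d K) (hLsupp : SupportingSpheres d L)
    (h : SwapCond d K L) : T7Cond7 d K L := by
  obtain ⟨p, R, hKp, hR⟩ := M.exists_bounding_ball hS hKcl (hKint.mono interior_subset) hKpr
    hKhemi hKsupp
  obtain ⟨p', R', hLp, hR'⟩ := M.exists_bounding_ball hS hLcl (hLint.mono interior_subset) hLpr
    hLhemi hLsupp
  have hKc := (M.isCompact_closedBall p R).of_isClosed_subset hKcl hKp
  have hLc := (M.isCompact_closedBall p' R').of_isClosed_subset hLcl hLp
  obtain ⟨q, P, hP, hP1, hKq, hKm⟩ := M.exists_circumball hd hKc hKint hKp hR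
  obtain ⟨q', P', hP', hP1', hLq, hLm⟩ := M.exists_circumball hd hLc hLint hLp hR'
  obtain ⟨x, hx, hqx⟩ := hKm q
  obtain ⟨y, hy, hqy⟩ := hLm q'
  have hqx' : dist q x = P := le_antisymm (mem_closedBall'.1 (hKq hx)) hqx
  have hqy' : dist q' y = P' := le_antisymm (mem_closedBall'.1 (hLq hy)) hqy
  have hlocK := M.exists_local_ball hd hS hKcl hLcl hKsupp h hP' hP1'
    (M.mem_frontier_of_touch hP' hP1' hLq hy hqy') hLq hqy'
  have hlocL := M.exists_local_ball hd hS hLcl hKcl hLsupp h.symm hP hP1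
    (M.mem_frontier_of_touch hP hP1 hKq hx hqx') hKq hqx'
  have h1 := M.circumradius_le hd hKc hKcv hKint hP hP1 hKq hKm hP' hP1' hlocK
  have h2 := M.circumradius_le hd hLc hLcv hLint hP' hP1' hLq hLm hP hP1 hlocL
  obtain rfl : P = P' := le_antisymm h1 h2
  exact ⟨P, hP, fun hs => hP1 (hS.1 hs),
    ⟨q, M.eq_closedBall hd hKc hKcv hKint hP hP1 hKq hKm hlocK⟩, q',
    M.eq_closedBall hd hLc hLcv hLint hP' hP1' hLq hLm hlocL⟩

end Model

namespace Model
variable {κ : ℝ} {d : ℕ}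

lemma vs_eq_of_cs_eq (hκ : Curv κ) (h : κ * κ = 1) {t : ℝ} {a b : Amb d} (ha : br κ a a = 1)
    (hb : br κ b b = 1) (hab : cs κ t = br κ a b) :
    vs κ t = 1 / 2 * Bf κ (a - b) (a - b) := by
  have h1 := hκ.mul_vs t
  rw [Bf_eq _ _ h]
  simp only [br_sub_left, br_sub_right, ha, hb, br_comm b a]
  rw [hab] at h1
  linear_combination κ * h1 - vs κ t * h

/-- Separation of the last coordinate. -/
noncomputable def splitLast (v : EuclideanSpace ℝ (Fin (d + 1))) : Amb d :=
  (WithLp.toLp 2 fun i => v i.castSucc, v (Fin.last d))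

lemma br_splitLast (v w : EuclideanSpace ℝ (Fin (d + 1))) :
    br 1 (splitLast v) (splitLast w) = inner ℝ v w := by
  simp only [br, splitLast, PiLp.inner_apply, Fin.sum_univ_castSucc, RCLike.inner_apply,
    conj_trivial]
  ring

lemma exists_splitLast (y : Amb d) : ∃ v, splitLast v = y := by
  refine ⟨WithLp.toLp 2 (Fin.snoc (α := fun _ => ℝ) (fun i => y.1 i) y.2), Prod.ext ?_ ?_⟩
  · ext i; simp [splitLast]
  · simp [splitLast]

lemma exists_of_sphere (h : IsSphereSpace X d) : Nonempty (Model 1 X d) := by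
  obtain ⟨e, -, hr, hdist⟩ := h
  have hn : ∀ x, ‖e x‖ = 1 := fun x => by
    have : e x ∈ Set.range e := ⟨x, rfl⟩
    rw [hr] at this
    exact mem_sphere_zero_iff_norm.1 this
  have hq : ∀ x, br 1 (splitLast (e x)) (splitLast (e x)) = 1 := fun x => by
    rw [br_splitLast, real_inner_self_eq_norm_sq, hn, one_pow]
  exact ⟨{
    e := fun x => splitLast (e x)
    curv := Or.inl rfl
    q_eq := hq
    ht_pos := fun h => absurd rfl h
    surj := fun y hy _ => by
      obtain ⟨v, rfl⟩ := exists_splitLast y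
      rw [br_splitLast, real_inner_self_eq_norm_sq] at hy
      have hv : v ∈ Set.range e := by
        rw [hr, mem_sphere_zero_iff_norm]
        nlinarith [norm_nonneg v]
      obtain ⟨x, rfl⟩ := hv
      exact ⟨x, rfl⟩
    vs_dist := fun x y => by
      have h1 := abs_le.1 (abs_real_inner_le_norm (e x) (e y))
      rw [hn, hn, one_mul] at h1
      refine vs_eq_of_cs_eq (Or.inl rfl) (by norm_num) (hq x) (hq y) ?_
      rw [cs_one, br_splitLast, hdist, Real.cos_arccos h1.1 h1.2]
    dist_le := fun _ x y => by rw [hdist]; exact Real.arccos_le_pi _ }⟩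

lemma exists_of_euclidean (h : IsEuclideanSpaceForm X d) : Nonempty (Model 0 X d) := by
  obtain ⟨e⟩ := h
  exact ⟨{
    e := fun x => (e x, 1)
    curv := Or.inr (Or.inl rfl)
    q_eq := fun x => by simp [br]
    ht_pos := fun _ x => one_pos
    surj := fun y hy hp => by
      have hp := hp (by norm_num)
      simp only [br] at hy
      refine ⟨e.symm y.1, Prod.ext (e.apply_symm_apply _) ?_⟩
      show (1 : ℝ) = y.2
      nlinarith
    vs_dist := fun x y => by
      simp only [vs, sn_zero', Bf, Prod.fst_sub, Prod.snd_sub, real_inner_self_eq_norm_sq]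
      rw [← dist_eq_norm, e.dist_eq]
      ring
    dist_le := fun h => absurd h (by norm_num) }⟩

lemma exists_of_hyperbolic (h : IsHyperbolicSpace X d) : Nonempty (Model (-1) X d) := by
  obtain ⟨e, -, hr, hdist⟩ := h
  have hbr : ∀ y z : Amb d, br (-1) y z = - mink d y z := fun y z => by
    simp only [br, mink]; ring
  have hm : ∀ x, mink d (e x) (e x) = -1 ∧ 0 < (e x).2 := fun x => by
    have : e x ∈ Set.range e := ⟨x, rfl⟩
    rw [hr] at this
    exact this
  have hq : ∀ x, br (-1) (e x) (e x) = 1 := fun x => by rw [hbr, (hm x).1, neg_neg]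
  exact ⟨{
    e := e
    curv := Or.inr (Or.inr rfl)
    q_eq := hq
    ht_pos := fun _ x => (hm x).2
    surj := fun y hy hp => by
      have : y ∈ Set.range e := by
        rw [hr]
        exact ⟨by rw [hbr] at hy; linarith, hp (by norm_num)⟩
      exact this
    vs_dist := fun x y => vs_eq_of_cs_eq (Or.inr (Or.inr rfl)) (by norm_num) (hq x) (hq y)
      (by rw [cs_neg_one, hbr, hdist])
    dist_le := fun h => absurd h (by norm_num) }⟩

lemma eq_one_of_sphere (M : Model κ X d) (hd : 2 ≤ d) (h : IsSphereSpace X d) : κ = 1 := by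
  by_contra hκ
  obtain ⟨x, -⟩ := M.surj (0, 1) (by simp [br]) (fun _ => one_pos)
  obtain ⟨z, -, -, hz, -⟩ := M.exists_two_equidistant hd x x (t := 4) (by norm_num)
    (fun h => absurd h hκ)
  obtain ⟨e, -, -, hdist⟩ := h
  have := Real.arccos_le_pi (inner ℝ (e x) (e z))
  rw [← hdist, hz] at this
  linarith [Real.pi_lt_four]

end Model

lemma IsSpaceForm.exists_model {d : ℕ} (hd : 2 ≤ d) (hX : IsSpaceForm X d) :
    ∃ κ, ∃ _ : Model κ X d, (IsSphereSpace X d ↔ κ = 1) := by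
  rcases hX with h | h | h
  · obtain ⟨M⟩ := Model.exists_of_sphere h
    exact ⟨1, M, fun _ => rfl, fun _ => h⟩
  · obtain ⟨M⟩ := Model.exists_of_euclidean h
    exact ⟨0, M, M.eq_one_of_sphere hd, fun h => absurd h (by norm_num)⟩
  · obtain ⟨M⟩ := Model.exists_of_hyperbolic h
    exact ⟨-1, M, M.eq_one_of_sphere hd, fun h => absurd h (by norm_num)⟩

/-- **Theorem 7.** Under hypothesis (****), if both `K` and `L` have supporting
spheres at all of their boundary points (for `S^d` of radii less than `π/2`), then
conditions (1)–(7) are equivalent. -/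
theorem theorem7
    (d : ℕ) (hd : 2 ≤ d)
    (X : Type*) [MetricSpace X] (hX : IsSpaceForm X d)
    (K L : Set X)
    (hKcl : IsClosed K) (hLcl : IsClosed L)
    (hKcv : GConvex K) (hLcv : GConvex L)
    (hKint : (interior K).Nonempty) (hLint : (interior L).Nonempty)
    (hKpr : K ≠ univ) (hLpr : L ≠ univ)
    (hKhemi : IsSphereSpace X d → ∃ p : X, K ⊆ ball p (Real.pi / 2))
    (hLhemi : IsSphereSpace X d → ∃ p : X, L ⊆ ball p (Real.pi / 2))
    (hKsupp : SupportingSpheres d K) (hLsupp : SupportingSpheres d L) :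
    (T7Cond1 d K L ↔ T7Cond7 d K L) ∧
    (T7Cond2 d K L ↔ T7Cond7 d K L) ∧
    (T7Cond3 d K L ↔ T7Cond7 d K L) ∧
    (T7Cond4 d K L ↔ T7Cond7 d K L) ∧
    (T7Cond5 d K L ↔ T7Cond7 d K L) ∧
    (T7Cond6 d K L ↔ T7Cond7 d K L) := by
  obtain ⟨κ, M, hS⟩ := hX.exists_model hd
  have h7 : SwapCond d K L → T7Cond7 d K L :=
    M.cond7_of_swapCond hd hS hKcl hLcl hKcv hLcv hKint hLint hKpr hLpr hKhemi hLhemi hKsupp hLsupp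
  have h17 : T7Cond7 d K L → T7Cond1 d K L := M.cond1_of_cond7 hS
  have h27 : T7Cond7 d K L → T7Cond2 d K L := M.cond2_of_cond7 hS hd
  have h13 : T7Cond1 d K L → T7Cond3 d K L := cond3_of_cond1
  have h24 : T7Cond2 d K L → T7Cond4 d K L := cond4_of_cond2
  have h35 : T7Cond3 d K L → T7Cond5 d K L := M.cond5_of_cond3 hKcl hLcl
  have h46 : T7Cond4 d K L → T7Cond6 d K L := M.cond6_of_cond4 hKcl hLcl
  have h57 : T7Cond5 d K L → T7Cond7 d K L := fun h => h7 (swapCond_of_cond5 h)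
  have h67 : T7Cond6 d K L → T7Cond7 d K L := fun h => h7 (swapCond_of_cond6 h)
  exact ⟨⟨h57 ∘ h35 ∘ h13, h17⟩, ⟨h67 ∘ h46 ∘ h24, h27⟩, ⟨h57 ∘ h35, h13 ∘ h17⟩,
    ⟨h67 ∘ h46, h24 ∘ h27⟩, ⟨h57, h35 ∘ h13 ∘ h17⟩, ⟨h67, h46 ∘ h24 ∘ h27⟩⟩

end BallChar
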